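/- Let (G_n) be a sequence of weighted graphs with |G_n| = n and β_max = sup_{i,j,n} β_ij(n) < ∞, converging to a graphon W that is irreducible and satisfies ‖T_W‖ > 1. Then there is a constant A such that with high probability the second largest component of G_n(1/n) has at most A·log n vertices. -/

import Mathlib

open MeasureTheory Filter Topology

noncomputable section

namespace Percolation

/-- The symmetrized lift of a two-variable real function to `Sym2`. If `f` is symmetric,
`sym2Val f s(a, b) = f a b`. -/
def sym2Val {α : Type*} (f : α → α → ℝ) : Sym2 α → ℝ :=
  Sym2.lift ⟨fun a b => (f a b + f b a) / 2, fun a b => by simp [add_comm]⟩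

/-- The product over the edges of `F` of a symmetric function of the endpoints. -/
def edgeProd {k : ℕ} (F : SimpleGraph (Fin k)) (f : Fin k → Fin k → ℝ) : ℝ := by
  classical exact ∏ e ∈ F.edgeFinset, sym2Val f e

/-- The homomorphism density `t(F, G)` of a finite simple graph `F` in the weighted graph
on `[n]` with edge weights `β`. -/
def homDensityG {n k : ℕ} (β : Fin n → Fin n → ℝ) (F : SimpleGraph (Fin k)) : ℝ :=
  (∑ v : Fin k → Fin n, edgeProd F fun i j => β (v i) (v j)) / (n : ℝ) ^ k

/-- The unit interval `[0,1] ⊆ ℝ`. -/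
def I01 : Set ℝ := Set.Icc 0 1

/-- The homomorphism density `t(F, W)` of a finite simple graph `F` in a graphon `W`. -/
def homDensityW {k : ℕ} (W : ℝ → ℝ → ℝ) (F : SimpleGraph (Fin k)) : ℝ :=
  ∫ x : Fin k → ℝ in Set.univ.pi fun _ => I01, edgeProd F fun i j => W (x i) (x j)

/-- `G_n → W`: convergence of the homomorphism densities for every finite simple graph. -/
def ConvergesTo (β : ∀ n : ℕ, Fin n → Fin n → ℝ) (W : ℝ → ℝ → ℝ) : Prop :=
  ∀ (k : ℕ) (F : SimpleGraph (Fin k)),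
    Tendsto (fun n => homDensityG (β n) F) atTop (nhds (homDensityW W F))

/-- `W` is a graphon: a bounded symmetric measurable function with nonnegative values. -/
def IsGraphon (W : ℝ → ℝ → ℝ) : Prop :=
  Measurable (Function.uncurry W) ∧ (∀ x y, 0 ≤ W x y) ∧ (∀ x y, W x y = W y x) ∧
    ∃ M : ℝ, ∀ x y, W x y ≤ M

/-- The Bernoulli measure on `Bool` with success probability `p`. -/
def bern (p : ℝ) : Measure Bool :=
  ENNReal.ofReal p • Measure.dirac true + ENNReal.ofReal (1 - p) • Measure.dirac false

/-- The law of the random graph in which each pair `{v, w}` is an edge independently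
with probability `min (p * β v w) 1`; a point of the sample space records for each
unordered pair whether it is an edge. -/
def percMeasure {V : Type*} [Fintype V] [DecidableEq V] (β : V → V → ℝ) (p : ℝ) :
    Measure (Sym2 V → Bool) :=
  Measure.pi fun e => bern (min (p * sym2Val β e) 1)

/-- The simple graph determined by a point of the sample space. -/
def graphOf {V : Type*} (ω : Sym2 V → Bool) : SimpleGraph V :=
  SimpleGraph.fromRel fun i j => ω s(i, j)

/-- The number of vertices of the component of `v` in `G`. -/
def compSize {V : Type*} (G : SimpleGraph V) (v : V) : ℕ := {w | G.Reachable v w}.ncard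

/-- The number of vertices of the largest component of `G`. -/
def C1 {V : Type*} [Fintype V] (G : SimpleGraph V) : ℕ :=
  Finset.univ.sup fun v => compSize G v

/-- The number of vertices of the second largest component of `G` (zero if `G` is
connected): the largest value of `min (|C_v|, |C_w|)` over vertices `v`, `w` lying in
distinct components. -/
def C2 {V : Type*} (G : SimpleGraph V) : ℕ :=
  sSup {m | ∃ v w : V, ¬G.Reachable v w ∧ m = min (compSize G v) (compSize G w)}

/-- The operator `T_W` with kernel `W` applied to `f`. -/
def applyT (W : ℝ → ℝ → ℝ) (f : ℝ → ℝ) (x : ℝ) : ℝ := ∫ y in I01, W x y * f y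

/-- The `L²[0,1]` norm of a function. -/
def l2norm (f : ℝ → ℝ) : ℝ := Real.sqrt (∫ x in I01, f x ^ 2)

/-- The `L²`-operator norm `‖T_W‖` of the integral operator with kernel `W`. -/
def opNorm (W : ℝ → ℝ → ℝ) : ℝ :=
  sSup {r | ∃ f : ℝ → ℝ, Measurable f ∧
    MeasureTheory.IntegrableOn (fun x => f x ^ 2) I01 ∧
    l2norm f ≤ 1 ∧ r = l2norm (applyT W f)}

/-- The survival probability `ρ(W)` of the multitype Poisson branching process with
kernel `W`: the supremum of `∫ f` over measurable `f : [0,1] → [0,1]` satisfying the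
functional equation `f(x) = 1 - exp(-∫ W(x,y) f(y) dy)` almost everywhere. -/
def survival (W : ℝ → ℝ → ℝ) : ℝ :=
  sSup {r | ∃ f : ℝ → ℝ, Measurable f ∧ (∀ x, f x ∈ Set.Icc (0 : ℝ) 1) ∧
    (∀ᵐ x ∂volume.restrict I01, f x = 1 - Real.exp (-∫ y in I01, W x y * f y)) ∧
    r = ∫ x in I01, f x}

/-- A graphon `W` is irreducible if there is no measurable `A ⊆ [0,1]` with
`0 < μ(A) < 1` such that `W = 0` a.e. on `A × ([0,1] \ A)`. -/
def Irreducible (W : ℝ → ℝ → ℝ) : Prop :=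
  ¬∃ A : Set ℝ, MeasurableSet A ∧ A ⊆ I01 ∧ 0 < volume A ∧ volume A < 1 ∧
    ∀ᵐ p : ℝ × ℝ, p.1 ∈ A → p.2 ∈ I01 \ A → W p.1 p.2 = 0

end Percolation
set_option linter.unusedSectionVars false
set_option linter.unusedVariables false
set_option linter.unnecessarySeqFocus false
namespace PercAux
open Percolation

/-- Bernoulli weight -/
def bw (p : ℝ) (b : Bool) : ℝ := if b then p else 1 - p

/-- expectation under product Bernoulli -/
def Ex {ι : Type*} [Fintype ι] [DecidableEq ι] (p : ι → ℝ) (f : (ι → Bool) → ℝ) : ℝ :=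
  ∑ ω, (∏ e, bw (p e) (ω e)) * f ω

section Basic
variable {ι : Type*} [Fintype ι] [DecidableEq ι]

lemma bw_nonneg {p : ℝ} (h0 : 0 ≤ p) (h1 : p ≤ 1) (b : Bool) : 0 ≤ bw p b := by
  unfold bw; split_ifs <;> linarith

lemma Ex_prod (p : ι → ℝ) (h : ι → Bool → ℝ) :
    Ex p (fun ω => ∏ e, h e (ω e)) = ∏ e, (p e * h e true + (1 - p e) * h e false) := by
  unfold Ex
  simp_rw [← Finset.prod_mul_distrib]
  have := Finset.prod_univ_sum (fun _ : ι => (Finset.univ : Finset Bool))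
    (fun e b => bw (p e) b * h e b)
  simp only [Fintype.piFinset_univ] at this
  rw [← this]
  refine Finset.prod_congr rfl fun e _ => ?_
  simp [bw]

lemma Ex_prod_finset (p : ι → ℝ) (D : Finset ι) (h : ι → Bool → ℝ) :
    Ex p (fun ω => ∏ e ∈ D, h e (ω e)) = ∏ e ∈ D, (p e * h e true + (1 - p e) * h e false) := by
  have := Ex_prod p (fun e b => if e ∈ D then h e b else 1)
  simp only [Finset.prod_ite_mem, Finset.univ_inter] at this
  rw [this, ← Finset.prod_subset (Finset.subset_univ D)]
  · exact Finset.prod_congr rfl fun e he => by simp [he]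
  · intro e _ he; simp [he]

lemma Ex_const (p : ι → ℝ) (c : ℝ) : Ex p (fun _ => c) = c := by
  have := Ex_prod p (fun _ _ => 1)
  simp at this
  have h2 : Ex p (fun _ => c) = Ex p (fun _ => 1) * c := by
    unfold Ex; rw [Finset.sum_mul]; simp
  rw [h2, this, one_mul]

lemma Ex_add (p : ι → ℝ) (f g : (ι → Bool) → ℝ) :
    Ex p (fun ω => f ω + g ω) = Ex p f + Ex p g := by
  unfold Ex; rw [← Finset.sum_add_distrib]; simp [mul_add]

lemma Ex_sub (p : ι → ℝ) (f g : (ι → Bool) → ℝ) :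
    Ex p (fun ω => f ω - g ω) = Ex p f - Ex p g := by
  unfold Ex; rw [← Finset.sum_sub_distrib]; simp [mul_sub]

lemma Ex_mul_left (p : ι → ℝ) (c : ℝ) (f : (ι → Bool) → ℝ) :
    Ex p (fun ω => c * f ω) = c * Ex p f := by
  unfold Ex; rw [Finset.mul_sum]; exact Finset.sum_congr rfl fun _ _ => by ring

lemma Ex_mul_right (p : ι → ℝ) (c : ℝ) (f : (ι → Bool) → ℝ) :
    Ex p (fun ω => f ω * c) = Ex p f * c := by
  unfold Ex; rw [Finset.sum_mul]; exact Finset.sum_congr rfl fun _ _ => by ring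

lemma Ex_sum {κ : Type*} (s : Finset κ) (p : ι → ℝ) (f : κ → (ι → Bool) → ℝ) :
    Ex p (fun ω => ∑ k ∈ s, f k ω) = ∑ k ∈ s, Ex p (f k) := by
  unfold Ex; rw [Finset.sum_comm]; simp [Finset.mul_sum]

lemma Ex_mono {p : ι → ℝ} (h0 : ∀ e, 0 ≤ p e) (h1 : ∀ e, p e ≤ 1) {f g : (ι → Bool) → ℝ}
    (h : ∀ ω, f ω ≤ g ω) : Ex p f ≤ Ex p g := by
  unfold Ex
  refine Finset.sum_le_sum fun ω _ => mul_le_mul_of_nonneg_left (h ω) ?_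
  exact Finset.prod_nonneg fun e _ => bw_nonneg (h0 e) (h1 e) _

lemma Ex_nonneg {p : ι → ℝ} (h0 : ∀ e, 0 ≤ p e) (h1 : ∀ e, p e ≤ 1) {f : (ι → Bool) → ℝ}
    (h : ∀ ω, 0 ≤ f ω) : 0 ≤ Ex p f := by
  have := Ex_mono h0 h1 (f := fun _ => 0) h
  rwa [Ex_const] at this

/-- f depends only on coordinates in T -/
def DepOn (T : Set ι) {α : Type*} (f : (ι → Bool) → α) : Prop :=
  ∀ ω ω' : ι → Bool, (∀ e ∈ T, ω e = ω' e) → f ω = f ω'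

lemma Ex_indep (p : ι → ℝ) (T : Set ι) (f g : (ι → Bool) → ℝ) (hf : DepOn T f)
    (hg : DepOn Tᶜ g) : Ex p (fun ω => f ω * g ω) = Ex p f * Ex p g := by
  classical
  let mix : (ι → Bool) × (ι → Bool) → (ι → Bool) × (ι → Bool) := fun x =>
    (fun e => if e ∈ T then x.1 e else x.2 e, fun e => if e ∈ T then x.2 e else x.1 e)
  have hinv : Function.Involutive mix := by
    rintro ⟨a, b⟩
    ext e <;> simp only [mix] <;> split_ifs <;> rfl
  have key : Ex p f * Ex p g = ∑ x : (ι → Bool) × (ι → Bool),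
      ((∏ e, bw (p e) (x.1 e)) * (∏ e, bw (p e) (x.2 e))) * (f x.1 * g x.2) := by
    unfold Ex
    rw [Finset.sum_mul_sum, Fintype.sum_prod_type]
    exact Finset.sum_congr rfl fun _ _ => Finset.sum_congr rfl fun _ _ => by ring
  have key2 : Ex p (fun ω => f ω * g ω) = ∑ x : (ι → Bool) × (ι → Bool),
      ((∏ e, bw (p e) (x.1 e)) * (∏ e, bw (p e) (x.2 e))) * (f x.1 * g x.1) := by
    have h1 := Ex_const p (1:ℝ)
    calc _ = Ex p (fun ω => f ω * g ω) * Ex p (fun _ => 1) := by rw [h1, mul_one]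
      _ = _ := by
        unfold Ex
        rw [Finset.sum_mul_sum, Fintype.sum_prod_type]
        exact Finset.sum_congr rfl fun _ _ => Finset.sum_congr rfl fun _ _ => by ring
  rw [key, key2]
  refine Fintype.sum_equiv hinv.toPerm _ _ ?_
  rintro ⟨a, b⟩
  have e1 : f a = f (mix (a, b)).1 := hf _ _ fun e he => by simp [mix, he]
  have e2 : g a = g (mix (a, b)).2 := hg _ _ fun e he => by
    have : e ∉ T := he
    simp [mix, this]
  simp only [Function.Involutive.coe_toPerm]
  rw [← e1, ← e2, ← Finset.prod_mul_distrib, ← Finset.prod_mul_distrib]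
  congr 1
  refine Finset.prod_congr rfl fun e _ => ?_
  simp only [mix]; split_ifs
  · rfl
  · ring

lemma DepOn.mono {T T' : Set ι} (h : T ⊆ T') {α : Type*} {f : (ι → Bool) → α} (hf : DepOn T f) :
    DepOn T' f := fun ω ω' hw => hf ω ω' fun e he => hw e (h he)

lemma Ex_indep_family {κ : Type*} [DecidableEq κ] (p : ι → ℝ) (J : Finset κ) (T : κ → Set ι)
    (hT : ∀ a ∈ J, ∀ b ∈ J, a ≠ b → Disjoint (T a) (T b)) (φ : κ → (ι → Bool) → ℝ)
    (hφ : ∀ a ∈ J, DepOn (T a) (φ a)) :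
    Ex p (fun ω => ∏ a ∈ J, φ a ω) = ∏ a ∈ J, Ex p (φ a) := by
  induction J using Finset.induction_on with
  | empty => simp [Ex_const]
  | insert a J ha ih =>
    simp only [Finset.prod_insert ha]
    rw [Ex_indep p (T a), ih]
    · intro x hx y hy; exact hT x (by simp [hx]) y (by simp [hy])
    · intro x hx; exact hφ x (by simp [hx])
    · exact hφ a (by simp)
    · intro ω ω' hw
      refine Finset.prod_congr rfl fun x hx => hφ x (by simp [hx]) _ _ fun e he => hw e ?_
      have := hT a (by simp) x (by simp [hx]) (by rintro rfl; exact ha hx)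
      exact fun h => Set.disjoint_left.1 this h he

/-- superposition -/
lemma Ex_or (p q : ι → ℝ) (f : (ι → Bool) → ℝ) :
    Ex (fun e => 1 - (1 - p e) * (1 - q e)) f
      = Ex p (fun ω => Ex q (fun η => f (fun e => ω e || η e))) := by
  classical
  have hlin : ∀ g : (ι → Bool) → ℝ, g = fun ω => ∑ x, g x * ∏ e, (if ω e = x e then (1:ℝ) else 0) := by
    intro g; funext ω
    have : ∀ x, (∏ e, (if ω e = x e then (1:ℝ) else 0)) = if ω = x then 1 else 0 := by
      intro x
      rw [Finset.prod_ite_zero]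
      simp [funext_iff]
    simp [this]
  have hdel : ∀ x : ι → Bool, Ex (fun e => 1 - (1 - p e) * (1 - q e))
      (fun ω => ∏ e, (if ω e = x e then (1:ℝ) else 0))
      = Ex p (fun ω => Ex q (fun η => ∏ e, (if (ω e || η e) = x e then (1:ℝ) else 0))) := by
    intro x
    rw [Ex_prod _ (fun e b => if b = x e then (1:ℝ) else 0)]
    have : ∀ ω : ι → Bool, Ex q (fun η => ∏ e, (if (ω e || η e) = x e then (1:ℝ) else 0)) =
        ∏ e, (q e * (if (ω e || true) = x e then (1:ℝ) else 0)
          + (1 - q e) * (if (ω e || false) = x e then (1:ℝ) else 0)) := fun ω =>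
      Ex_prod q (fun e b => if (ω e || b) = x e then (1:ℝ) else 0)
    simp_rw [this]
    rw [Ex_prod p (fun e b => (q e * (if (b || true) = x e then (1:ℝ) else 0)
          + (1 - q e) * (if (b || false) = x e then (1:ℝ) else 0)))]
    refine Finset.prod_congr rfl fun e _ => ?_
    cases x e <;> simp <;> ring
  conv_lhs => rw [hlin f]
  rw [Ex_sum]
  simp_rw [Ex_mul_left, hdel]
  conv_rhs => rw [hlin f]
  simp_rw [Ex_sum, Ex_mul_left]

lemma Ex_swap (p q : ι → ℝ) (f : (ι → Bool) → (ι → Bool) → ℝ) :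
    Ex p (fun ω => Ex q (fun η => f ω η)) = Ex q (fun η => Ex p (fun ω => f ω η)) := by
  unfold Ex
  simp_rw [Finset.mul_sum]
  rw [Finset.sum_comm]
  exact Finset.sum_congr rfl fun _ _ => Finset.sum_congr rfl fun _ _ => by ring

/-- probability -/
def Pr (p : ι → ℝ) (A : Set (ι → Bool)) : ℝ := Ex p (A.indicator fun _ => 1)

lemma Pr_nonneg {p : ι → ℝ} (h0 : ∀ e, 0 ≤ p e) (h1 : ∀ e, p e ≤ 1) (A) : 0 ≤ Pr p A :=
  Ex_nonneg h0 h1 fun _ => Set.indicator_nonneg (fun _ _ => zero_le_one) _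

lemma Pr_le_one {p : ι → ℝ} (h0 : ∀ e, 0 ≤ p e) (h1 : ∀ e, p e ≤ 1) (A) : Pr p A ≤ 1 := by
  have := Ex_mono h0 h1 (f := A.indicator fun _ => (1:ℝ)) (g := fun _ => 1) fun _ =>
    Set.indicator_le_self' (fun _ _ => zero_le_one) _
  rwa [Ex_const] at this

lemma Pr_le_Ex {p : ι → ℝ} (h0 : ∀ e, 0 ≤ p e) (h1 : ∀ e, p e ≤ 1) (A) (f : (ι → Bool) → ℝ)
    (hf : ∀ ω, 0 ≤ f ω) (hA : ∀ ω ∈ A, 1 ≤ f ω) : Pr p A ≤ Ex p f := by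
  refine Ex_mono h0 h1 fun ω => ?_
  by_cases h : ω ∈ A
  · simpa [h] using hA ω h
  · simpa [h] using hf ω

lemma Pr_mono {p : ι → ℝ} (h0 : ∀ e, 0 ≤ p e) (h1 : ∀ e, p e ≤ 1) {A B : Set (ι → Bool)}
    (h : A ⊆ B) : Pr p A ≤ Pr p B :=
  Ex_mono h0 h1 fun ω => Set.indicator_le_indicator_of_subset h (fun _ => zero_le_one) ω

lemma Pr_compl (p : ι → ℝ) (A) : Pr p Aᶜ = 1 - Pr p A := by
  unfold Pr
  rw [← Ex_const p 1, ← Ex_sub]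
  congr 1; funext ω
  by_cases h : ω ∈ A <;> simp [h, Ex_const]

lemma Pr_union_le {p : ι → ℝ} (h0 : ∀ e, 0 ≤ p e) (h1 : ∀ e, p e ≤ 1) (A B) :
    Pr p (A ∪ B) ≤ Pr p A + Pr p B := by
  unfold Pr
  rw [← Ex_add]
  refine Ex_mono h0 h1 fun ω => ?_
  by_cases h : ω ∈ A <;> by_cases h' : ω ∈ B <;> simp [h, h']

lemma Pr_exists_le {κ : Type*} (s : Finset κ) {p : ι → ℝ} (h0 : ∀ e, 0 ≤ p e) (h1 : ∀ e, p e ≤ 1)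
    (A : κ → Set (ι → Bool)) :
    Pr p {ω | ∃ k ∈ s, ω ∈ A k} ≤ ∑ k ∈ s, Pr p (A k) := by
  unfold Pr
  rw [← Ex_sum]
  refine Ex_mono h0 h1 fun ω => ?_
  by_cases h : ω ∈ {ω | ∃ k ∈ s, ω ∈ A k}
  · rw [Set.indicator_of_mem h]
    obtain ⟨k, hk, hkA⟩ := h
    refine le_trans ?_ (Finset.single_le_sum
      (fun k _ => Set.indicator_nonneg (fun _ _ => zero_le_one) _) hk)
    rw [Set.indicator_of_mem hkA]
  · rw [Set.indicator_of_notMem h]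
    exact Finset.sum_nonneg fun k _ => Set.indicator_nonneg (fun _ _ => zero_le_one) _

end Basic

lemma bern_singleton {p : ℝ} (b : Bool) : bern p {b} = ENNReal.ofReal (bw p b) := by
  cases b <;> simp [bern, bw]

lemma percMeasure_eq {V : Type*} [Fintype V] [DecidableEq V] (β : V → V → ℝ) (q : ℝ)
    (hq : ∀ e, 0 ≤ q * sym2Val β e) (A : Set (Sym2 V → Bool)) :
    percMeasure β q A = ENNReal.ofReal (Pr (fun e => min (q * sym2Val β e) 1) A) := by
  classical
  have hfin : ∀ e, IsFiniteMeasure (bern (min (q * sym2Val β e) 1)) := fun e => by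
    constructor; simp [bern]
  have hs : ∀ ω : Sym2 V → Bool, percMeasure β q {ω} =
      ENNReal.ofReal (∏ e, bw (min (q * sym2Val β e) 1) (ω e)) := by
    intro ω
    unfold percMeasure
    rw [Measure.pi_singleton, ENNReal.ofReal_prod_of_nonneg]
    · simp_rw [bern_singleton]
    · intro e _; exact bw_nonneg (le_min (hq e) zero_le_one) (min_le_right _ _) _
  have hA : A = ((Finset.univ.filter (· ∈ A) : Finset (Sym2 V → Bool)) : Set (Sym2 V → Bool)) := by
    ext; simp
  conv_lhs => rw [hA]
  rw [← sum_measure_singleton]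
  simp_rw [hs]
  rw [← ENNReal.ofReal_sum_of_nonneg]
  · congr 1
    unfold Pr Ex
    rw [Finset.sum_filter]
    refine Finset.sum_congr rfl fun ω _ => ?_
    by_cases h : ω ∈ A <;> simp [h]
  · intro ω _
    exact Finset.prod_nonneg fun e _ => bw_nonneg (le_min (hq e) zero_le_one) (min_le_right _ _) _

end PercAux

set_option linter.unnecessarySeqFocus false
namespace PercAux
open Percolation

section Cluster
variable {V : Type*} [Fintype V] [DecidableEq V]

/-- one-step exploration into S -/
def Stp (ω : Sym2 V → Bool) (S : Finset V) (a b : V) : Prop := b ∈ S ∧ ω s(a, b) = true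

open Classical in
/-- cluster of U explored in S -/
def clu (ω : Sym2 V → Bool) (U S : Finset V) : Finset V :=
  Finset.univ.filter fun w => ∃ u ∈ U, Relation.ReflTransGen (Stp ω S) u w

lemma mem_clu {ω : Sym2 V → Bool} {U S : Finset V} {w : V} :
    w ∈ clu ω U S ↔ ∃ u ∈ U, Relation.ReflTransGen (Stp ω S) u w := by
  simp [clu]

lemma subset_clu (ω : Sym2 V → Bool) (U S : Finset V) : U ⊆ clu ω U S := fun u hu =>
  mem_clu.2 ⟨u, hu, Relation.ReflTransGen.refl⟩

lemma clu_step {ω : Sym2 V → Bool} {U S : Finset V} {a b : V} (ha : a ∈ clu ω U S)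
    (hb : b ∈ S) (h : ω s(a, b) = true) : b ∈ clu ω U S := by
  obtain ⟨u, hu, hr⟩ := mem_clu.1 ha
  exact mem_clu.2 ⟨u, hu, hr.tail ⟨hb, h⟩⟩

lemma clu_induction {ω : Sym2 V → Bool} {U S : Finset V} {P : V → Prop}
    (h0 : ∀ u ∈ U, P u) (h1 : ∀ a b, a ∈ clu ω U S → P a → b ∈ S → ω s(a, b) = true → P b) :
    ∀ w ∈ clu ω U S, P w := by
  intro w hw
  obtain ⟨u, hu, hr⟩ := mem_clu.1 hw
  induction hr with
  | refl => exact h0 u hu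
  | tail hab hbc ih =>
    exact h1 _ _ (mem_clu.2 ⟨u, hu, hab⟩) (ih (mem_clu.2 ⟨u, hu, hab⟩)) hbc.1 hbc.2

lemma clu_subset (ω : Sym2 V → Bool) (U S : Finset V) : clu ω U S ⊆ U ∪ S := by
  intro w hw
  refine clu_induction (P := fun w => w ∈ U ∪ S) (fun u hu => by simp [hu])
    (fun _ b _ _ hb _ => by simp [hb]) w hw

/-- neighbours of u in S -/
def nbr (ω : Sym2 V → Bool) (u : V) (S : Finset V) : Finset V :=
  S.filter fun w => ω s(u, w) = true

lemma mem_nbr {ω : Sym2 V → Bool} {u w : V} {S : Finset V} :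
    w ∈ nbr ω u S ↔ w ∈ S ∧ ω s(u, w) = true := by simp [nbr]

lemma clu_sub_reveal (ω : Sym2 V → Bool) (U S : Finset V) (u : V) (hu : u ∈ U) :
    clu ω (U.erase u ∪ nbr ω u S) (S \ nbr ω u S) ⊆ clu ω U S := by
  refine clu_induction (P := fun w => w ∈ clu ω U S) ?_ ?_
  · intro w hw
    rcases Finset.mem_union.1 hw with h | h
    · exact subset_clu _ _ _ (Finset.mem_of_mem_erase h)
    · exact clu_step (subset_clu _ _ _ hu) (mem_nbr.1 h).1 (mem_nbr.1 h).2
  · intro a b _ ha hb h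
    exact clu_step ha (Finset.mem_sdiff.1 hb).1 h

lemma clu_reveal (ω : Sym2 V → Bool) (U S : Finset V) (u : V) (hu : u ∈ U) :
    clu ω U S = insert u (clu ω (U.erase u ∪ nbr ω u S) (S \ nbr ω u S)) := by
  apply Finset.Subset.antisymm
  · refine clu_induction (P := fun w => w ∈ insert u (clu ω (U.erase u ∪ nbr ω u S) (S \ nbr ω u S))) ?_ ?_
    · intro w hw
      by_cases h : w = u
      · simp [h]
      · refine Finset.mem_insert_of_mem (subset_clu _ _ _ ?_)
        simp [h, hw]
    · intro a b _ ha hb h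
      rcases Finset.mem_insert.1 ha with rfl | ha
      · refine Finset.mem_insert_of_mem (subset_clu _ _ _ ?_)
        simp [mem_nbr, hb, h]
      · refine Finset.mem_insert_of_mem ?_
        by_cases hN : b ∈ nbr ω u S
        · exact subset_clu _ _ _ (by simp [hN])
        · exact clu_step ha (by simp [hb, hN]) h
  · rw [Finset.insert_subset_iff]
    exact ⟨subset_clu _ _ _ hu, clu_sub_reveal ω U S u hu⟩

lemma clu_mono (ω : Sym2 V → Bool) {U U' S S' : Finset V} (hU : U ⊆ U') (hS : S ⊆ S') :
    clu ω U S ⊆ clu ω U' S' :=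
  clu_induction (P := fun w => w ∈ clu ω U' S') (fun u hu => subset_clu _ _ _ (hU hu))
    (fun _ _ _ ha hb h => clu_step ha (hS hb) h)

/-- the cluster depends only on edges inside U ∪ S -/
lemma clu_dep (U S : Finset V) (T : Set (Sym2 V))
    (hT : ∀ a ∈ U ∪ S, ∀ b ∈ S, s(a, b) ∈ T) : DepOn T (fun ω => clu ω U S) := by
  have key : ∀ ω ω' : Sym2 V → Bool, (∀ e ∈ T, ω e = ω' e) → clu ω U S ⊆ clu ω' U S := by
    intro ω ω' h
    refine clu_induction (P := fun w => w ∈ clu ω' U S) (fun u hu => subset_clu _ _ _ hu) ?_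
    intro a b ha ha' hb hab
    refine clu_step ha' hb ?_
    rw [← h _ (hT a (clu_subset _ _ _ ha) b hb)]; exact hab
  intro ω ω' h
  exact Finset.Subset.antisymm (key _ _ h) (key _ _ fun e he => (h e he).symm)

/-- star reveal -/
lemma Ex_star (p : Sym2 V → ℝ) (h0 : ∀ e, 0 ≤ p e) (h1 : ∀ e, p e ≤ 1) (u : V) (S : Finset V)
    (X : Finset V → (Sym2 V → Bool) → ℝ)
    (hX : ∀ N ⊆ S, DepOn {e : Sym2 V | u ∉ e} (X N)) (a : ℝ) (y : V → ℝ)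
    (hb : ∀ N ⊆ S, Ex p (X N) ≤ a * ∏ w ∈ N, y w) :
    Ex p (fun ω => X (nbr ω u S) ω) ≤ a * ∏ w ∈ S, (1 + p s(u, w) * (y w - 1)) := by
  classical
  let I : Finset V → (Sym2 V → Bool) → ℝ := fun N ω => if nbr ω u S = N then 1 else 0
  have hI : ∀ N, DepOn {e : Sym2 V | u ∉ e}ᶜ (I N) := by
    intro N ω ω' h
    have : nbr ω u S = nbr ω' u S := by
      ext w
      rw [mem_nbr, mem_nbr, h s(u, w) (by simp)]
    simp [I, this]
  have e1 : ∀ Y : Finset V → (Sym2 V → Bool) → ℝ, (fun ω => Y (nbr ω u S) ω)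
      = fun ω => ∑ N ∈ S.powerset, Y N ω * I N ω := by
    intro Y; funext ω
    simp only [I, mul_ite, mul_one, mul_zero]
    rw [Finset.sum_ite_eq]
    simp [nbr]
  rw [e1 X, Ex_sum]
  have e2 : ∏ w ∈ S, (1 + p s(u, w) * (y w - 1)) =
      Ex p (fun ω => ∏ w ∈ nbr ω u S, y w) := by
    have h : (fun ω : Sym2 V → Bool => ∏ w ∈ nbr ω u S, y w)
        = fun ω => ∏ w ∈ S, (if ω s(u, w) = true then y w else 1) := by
      funext ω; rw [nbr, Finset.prod_filter]
    rw [h, Ex_indep_family p S (fun w => {s(u, w)})]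
    · refine Finset.prod_congr rfl fun w _ => ?_
      have := Ex_prod_finset p {s(u, w)} (fun e b => if b = true then y w else 1)
      simp only [Finset.prod_singleton] at this
      rw [this]; simp; ring
    · intro a _ b _ hab
      simp only [Set.disjoint_singleton, ne_eq]
      intro h
      rcases Sym2.eq_iff.1 h with h | h
      · exact hab h.2
      · exact hab (h.2.trans h.1)
    · intro w _ ω ω' h
      simp only [h s(u, w) rfl]
  rw [e2, e1 (fun N _ => ∏ w ∈ N, y w), Ex_sum, Finset.mul_sum]
  refine Finset.sum_le_sum fun N hN => ?_
  rw [Ex_indep p _ _ _ (hX N (Finset.mem_powerset.1 hN)) (hI N), Ex_mul_left, ← mul_assoc]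
  refine mul_le_mul_of_nonneg_right (hb N (Finset.mem_powerset.1 hN)) ?_
  exact Ex_nonneg h0 h1 fun ω => by simp only [I]; split_ifs <;> norm_num

lemma dep_reveal (u : V) (U S : Finset V) (hU : u ∉ U) (hS : u ∉ S) :
    DepOn {e : Sym2 V | u ∉ e} (fun ω => clu ω U S) := by
  refine clu_dep U S _ fun a ha b hb => ?_
  simp only [Set.mem_ofPred_eq, Sym2.mem_iff, not_or]
  constructor
  · rintro rfl; simp [hU, hS] at ha
  · rintro rfl; exact hS hb

/-- multiplicative cluster bound -/
lemma Ex_clu_prod (p : Sym2 V → ℝ) (h0 : ∀ e, 0 ≤ p e) (h1 : ∀ e, p e ≤ 1) (x y : V → ℝ)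
    (hx : ∀ v, 0 ≤ x v) (hy : ∀ v, 1 ≤ y v) (Z : Finset V)
    (hxy : ∀ v ∈ Z, x v * ∏ w ∈ Z, (1 + p s(v, w) * (y w - 1)) ≤ y v) :
    ∀ (k : ℕ) (U S : Finset V), U ∪ S ⊆ Z → Disjoint U S → (U ∪ S).card = k →
      Ex p (fun ω => ∏ w ∈ clu ω U S, x w) ≤ ∏ u ∈ U, y u := by
  intro k
  induction k with
  | zero =>
    intro U S _ _ hc
    have h := Finset.card_eq_zero.1 hc
    have hU : U = ∅ := by simpa using (Finset.union_eq_empty.1 h).1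
    subst hU
    have : ∀ ω, clu ω ∅ S = (∅ : Finset V) := fun ω => by
      ext w; simp [mem_clu]
    simp [this, Ex_const]
  | succ k ih =>
    intro U S hZ hd hc
    rcases U.eq_empty_or_nonempty with rfl | ⟨u, hu⟩
    · have : ∀ ω, clu ω ∅ S = (∅ : Finset V) := fun ω => by
        ext w; simp [mem_clu]
      simp [this, Ex_const]
    have huS : u ∉ S := Finset.disjoint_left.1 hd hu
    have hsub : ∀ N ⊆ S, u ∉ U.erase u ∪ N ∧ u ∉ S \ N := fun N hN =>
      ⟨by simp; exact fun h => huS (hN h), by simp [huS]⟩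
    have e1 : (fun ω => ∏ w ∈ clu ω U S, x w) = fun ω =>
        (fun (N : Finset V) (ω : Sym2 V → Bool) =>
          x u * ∏ w ∈ clu ω (U.erase u ∪ N) (S \ N), x w) (nbr ω u S) ω := by
      funext ω
      simp only
      rw [clu_reveal ω U S u hu, Finset.prod_insert]
      intro h
      have hn := hsub _ (Finset.filter_subset _ _ : nbr ω u S ⊆ S)
      rcases Finset.mem_union.1 (clu_subset _ _ _ h) with h | h
      · exact hn.1 h
      · exact hn.2 h
    rw [e1]
    refine (Ex_star p h0 h1 u S (fun (N : Finset V) (ω : Sym2 V → Bool) =>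
          x u * ∏ w ∈ clu ω (U.erase u ∪ N) (S \ N), x w) ?_ (x u * ∏ w ∈ U.erase u, y w) y ?_).trans ?_
    · intro N hN ω ω' h
      simp only
      have := dep_reveal u _ _ (hsub N hN).1 (hsub N hN).2 ω ω' h
      simp only at this
      rw [this]
    · intro N hN
      rw [Ex_mul_left, mul_assoc]
      refine mul_le_mul_of_nonneg_left ?_ (hx u)
      have hdN : Disjoint (U.erase u) N :=
        (hd.mono_left (Finset.erase_subset _ _)).mono_right hN
      rw [← Finset.prod_union hdN]
      have hUS : (U.erase u ∪ N) ∪ (S \ N) = (U ∪ S).erase u := by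
        ext w; simp only [Finset.mem_union, Finset.mem_erase, Finset.mem_sdiff]
        constructor
        · rintro ((h | h) | h)
          · exact ⟨h.1, Or.inl h.2⟩
          · exact ⟨by rintro rfl; exact huS (hN h), Or.inr (hN h)⟩
          · exact ⟨by rintro rfl; exact huS h.1, Or.inr h.1⟩
        · rintro ⟨h1, h2 | h2⟩
          · exact Or.inl (Or.inl ⟨h1, h2⟩)
          · by_cases hwN : w ∈ N
            · exact Or.inl (Or.inr hwN)
            · exact Or.inr ⟨h2, hwN⟩
      refine ih _ _ ?_ ?_ ?_
      · rw [hUS]; exact (Finset.erase_subset _ _).trans hZ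
      · rw [Finset.disjoint_union_left]
        exact ⟨(hd.mono_left (Finset.erase_subset _ _)).mono_right Finset.sdiff_subset,
          Finset.disjoint_sdiff⟩
      · rw [hUS, Finset.card_erase_of_mem (by simp [hu]), hc]; rfl
    · have hpos : 0 ≤ ∏ w ∈ U.erase u, y w :=
        Finset.prod_nonneg fun w _ => zero_le_one.trans (hy w)
      have hfac : ∀ w, 1 ≤ 1 + p s(u, w) * (y w - 1) := fun w => by
        have := mul_nonneg (h0 s(u, w)) (sub_nonneg.2 (hy w)); linarith
      have hle : ∏ w ∈ S, (1 + p s(u, w) * (y w - 1)) ≤ ∏ w ∈ Z, (1 + p s(u, w) * (y w - 1)) := by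
        have hSZ : S ⊆ Z := Finset.subset_union_right.trans hZ
        rw [← Finset.prod_sdiff hSZ]
        refine le_mul_of_one_le_left (Finset.prod_nonneg fun w _ => zero_le_one.trans (hfac w)) ?_
        exact Finset.one_le_prod fun i _ => hfac i
      calc x u * (∏ w ∈ U.erase u, y w) * ∏ w ∈ S, (1 + p s(u, w) * (y w - 1))
          ≤ x u * (∏ w ∈ U.erase u, y w) * ∏ w ∈ Z, (1 + p s(u, w) * (y w - 1)) :=
            mul_le_mul_of_nonneg_left hle (mul_nonneg (hx u) hpos)
        _ = (x u * ∏ w ∈ Z, (1 + p s(u, w) * (y w - 1))) * (∏ w ∈ U.erase u, y w) := by ring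
        _ ≤ y u * ∏ w ∈ U.erase u, y w :=
            mul_le_mul_of_nonneg_right (hxy u (hZ (by simp [hu]))) hpos
        _ = ∏ u ∈ U, y u := Finset.mul_prod_erase U y hu

/-- exploration fails to find a big cluster -/
def Fail (m : ℝ) (U S : Finset V) : Set (Sym2 V → Bool) :=
  {ω | ((clu ω U S).card : ℝ) < m ∧ ∀ v ∈ S, ((clu ω {v} S).card : ℝ) < m}

lemma Pr_fail (p : Sym2 V → ℝ) (h0 : ∀ e, 0 ≤ p e) (h1 : ∀ e, p e ≤ 1) (H : Finset V)
    (f : V → ℝ) (C m θ d : ℝ) (T0 : ℕ) (hC : ∀ v ∈ H, f v ≤ C) (hf0 : ∀ v ∈ H, 0 ≤ f v)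
    (hθ : 0 ≤ θ) (hH : T0 + m ≤ H.card) (hm : 0 ≤ m) (hC0 : 0 ≤ C)
    (hdrift : ∀ u ∈ H, ∀ S ⊆ H, (H.card : ℝ) - S.card ≤ T0 + m →
      θ * (d + f u) + ∑ w ∈ S, p s(u, w) * (Real.exp (-θ * f w) - 1) ≤ 0) :
    ∀ (r : ℕ) (U S : Finset V), U ⊆ H → S ⊆ H → Disjoint U S → r ≤ T0 →
      H.card + r ≤ S.card + U.card + T0 →
      Pr p (Fail m U S) ≤ Real.exp (-θ * (∑ u ∈ U, f u + d * r - C * m)) := by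
  intro r
  induction r with
  | zero =>
    intro U S hU hS hd _ _
    by_cases hUm : m ≤ U.card
    · have : Fail m U S = ∅ := by
        ext ω; simp only [Fail, Set.mem_ofPred_eq, Set.mem_empty_iff_false, iff_false, not_and]
        intro h
        have : (U.card : ℝ) ≤ (clu ω U S).card := by
          exact_mod_cast Finset.card_le_card (subset_clu ω U S)
        linarith
      rw [this]; simp [Pr, Ex_const]; positivity
    · refine (Pr_le_one h0 h1 _).trans ?_
      rw [Real.one_le_exp_iff]
      have : ∑ u ∈ U, f u ≤ U.card * C := by
        have := Finset.sum_le_card_nsmul U f C fun u hu => hC u (hU hu)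
        simpa using this
      have h2 : U.card * C ≤ m * C := mul_le_mul_of_nonneg_right (not_le.1 hUm).le hC0
      have : ∑ u ∈ U, f u + d * (0:ℕ) - C * m ≤ 0 := by push_cast; linarith
      nlinarith
  | succ r ih =>
    intro U S hU hS hd hr hc
    by_cases hUm : m ≤ U.card
    · have : Fail m U S = ∅ := by
        ext ω; simp only [Fail, Set.mem_ofPred_eq, Set.mem_empty_iff_false, iff_false, not_and]
        intro h
        have : (U.card : ℝ) ≤ (clu ω U S).card := by
          exact_mod_cast Finset.card_le_card (subset_clu ω U S)
        linarith
      rw [this]; simp only [Pr, Set.indicator_empty, Ex_const]; positivity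
    push Not at hUm
    have hScard : (H.card : ℝ) - S.card ≤ T0 + m - (r + 1) := by
      have : (H.card : ℝ) + ((r + 1 : ℕ) : ℝ) ≤ S.card + U.card + T0 := by exact_mod_cast hc
      push_cast at this; linarith
    -- common step
    have common : ∀ (u : V) (U1 S1 : Finset V), u ∈ H → U1 ⊆ H → S1 ⊆ H → u ∉ U1 → u ∉ S1 →
        Disjoint U1 S1 → (H.card : ℝ) - S1.card ≤ T0 + m →
        H.card + r ≤ S1.card + U1.card + T0 →
        (∀ ω ∈ Fail m U S, ω ∈ Fail m (U1 ∪ nbr ω u S1) (S1 \ nbr ω u S1)) →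
        Pr p (Fail m U S) ≤ Real.exp (-θ * (∑ w ∈ U1, f w + f u + d * (r + 1 : ℕ) - C * m)) := by
      intro u U1 S1 hu hU1 hS1 huU huS hd1 hS1c hc1 himp
      have step1 : Pr p (Fail m U S) ≤ Ex p (fun ω =>
          (fun (N : Finset V) (ω : Sym2 V → Bool) =>
            (Fail m (U1 ∪ N) (S1 \ N)).indicator (fun _ => (1:ℝ)) ω) (nbr ω u S1) ω) := by
        refine Pr_le_Ex h0 h1 _ _ (fun ω => Set.indicator_nonneg (fun _ _ => zero_le_one) _) ?_
        intro ω hω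
        simp only
        rw [Set.indicator_of_mem (himp ω hω)]
      refine step1.trans ?_
      refine (Ex_star p h0 h1 u S1 (fun (N : Finset V) (ω : Sym2 V → Bool) =>
            (Fail m (U1 ∪ N) (S1 \ N)).indicator (fun _ => (1:ℝ)) ω) ?_
        (Real.exp (-θ * (∑ w ∈ U1, f w + d * r - C * m)))
        (fun w => Real.exp (-θ * f w)) ?_).trans ?_
      · intro N hN ω ω' h
        have hu1 : u ∉ U1 ∪ N := by simp [huU]; exact fun h => huS (hN h)
        have hu2 : u ∉ S1 \ N := by simp [huS]
        have a1 := dep_reveal u _ _ hu1 hu2 ω ω' h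
        have a2 : ∀ v ∈ S1 \ N, clu ω {v} (S1 \ N) = clu ω' {v} (S1 \ N) := fun v hv =>
          dep_reveal u {v} _ (by simp; rintro rfl; exact hu2 hv) hu2 ω ω' h
        have : ω ∈ Fail m (U1 ∪ N) (S1 \ N) ↔ ω' ∈ Fail m (U1 ∪ N) (S1 \ N) := by
          simp only [Fail, Set.mem_ofPred_eq]
          simp only at a1
          rw [a1]
          refine and_congr_right fun _ => forall₂_congr fun v hv => ?_
          rw [a2 v hv]
        by_cases hω : ω ∈ Fail m (U1 ∪ N) (S1 \ N)
        · simp [hω, this.1 hω]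
        · have h' := mt this.2 hω
          simp [hω, h']
      · intro N hN
        have hdN : Disjoint U1 N := hd1.mono_right hN
        refine (ih (U1 ∪ N) (S1 \ N) (Finset.union_subset hU1 (hN.trans hS1))
          (Finset.sdiff_subset.trans hS1) ?_ (by omega) ?_).trans_eq ?_
        · rw [Finset.disjoint_union_left]
          exact ⟨hd1.mono_right Finset.sdiff_subset, Finset.disjoint_sdiff⟩
        · rw [Finset.card_union_of_disjoint hdN, Finset.card_sdiff_of_subset hN]
          have := Finset.card_le_card hN
          omega
        · rw [← Real.exp_sum, ← Real.exp_add, Finset.sum_union hdN, ← Finset.mul_sum]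
          congr 1; ring
      · have hpr : ∏ w ∈ S1, (1 + p s(u, w) * (Real.exp (-θ * f w) - 1))
            ≤ Real.exp (∑ w ∈ S1, p s(u, w) * (Real.exp (-θ * f w) - 1)) := by
          rw [Real.exp_sum]
          refine Finset.prod_le_prod ?_ ?_
          · intro w _
            have := Real.exp_pos (-θ * f w)
            have h2 := h0 s(u, w); have h3 := h1 s(u, w)
            nlinarith
          · intro w _
            have := Real.add_one_le_exp (p s(u, w) * (Real.exp (-θ * f w) - 1))
            linarith
        refine (mul_le_mul_of_nonneg_left hpr (Real.exp_pos _).le).trans ?_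
        rw [← Real.exp_add, Real.exp_le_exp]
        have := hdrift u hu S1 hS1 hS1c
        push_cast
        nlinarith
    rcases U.eq_empty_or_nonempty with rfl | ⟨u, hu⟩
    · have hSne : S.Nonempty := by
        rw [← Finset.card_pos]
        have : (0:ℝ) < S.card := by
          have : (0:ℝ) ≤ r := Nat.cast_nonneg r
          linarith
        exact_mod_cast this
      obtain ⟨v, hv⟩ := hSne
      have hcard := Finset.card_erase_of_mem hv
      have hpos : 0 < S.card := Finset.card_pos.2 ⟨v, hv⟩
      have := common v ∅ (S.erase v) (hS hv) (by simp) ((Finset.erase_subset _ _).trans hS)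
        (by simp) (by simp) (by simp) ?_ ?_ ?_
      · refine this.trans ?_
        rw [Real.exp_le_exp]
        have := hf0 v (hS hv)
        simp only [Finset.sum_empty]
        nlinarith
      · rw [hcard, Nat.cast_pred hpos]
        have : (0:ℝ) ≤ r := Nat.cast_nonneg r
        linarith
      · simp at hc ⊢; omega
      · intro ω hω
        have hsub : clu ω (∅ ∪ nbr ω v (S.erase v)) (S.erase v \ nbr ω v (S.erase v)) ⊆ clu ω {v} S := by
          have := clu_sub_reveal ω {v} (S.erase v) v (by simp)
          rw [Finset.erase_singleton] at this
          exact this.trans (clu_mono ω (Finset.Subset.refl _) (Finset.erase_subset _ _))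
        refine ⟨?_, fun w hw => ?_⟩
        · refine lt_of_le_of_lt ?_ (hω.2 v hv)
          exact_mod_cast Finset.card_le_card hsub
        · refine lt_of_le_of_lt ?_ (hω.2 w (Finset.mem_of_mem_erase (Finset.mem_sdiff.1 hw).1))
          exact_mod_cast Finset.card_le_card (clu_mono ω (by simp)
            (Finset.sdiff_subset.trans (Finset.erase_subset _ _)))
    · have huS : u ∉ S := Finset.disjoint_left.1 hd hu
      have := common u (U.erase u) S (hU hu) ((Finset.erase_subset _ _).trans hU) hS (by simp)
        huS (hd.mono_left (Finset.erase_subset _ _)) ?_ ?_ ?_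
      · rwa [Finset.sum_erase_add _ _ hu] at this
      · have : (0:ℝ) ≤ r := Nat.cast_nonneg r
        linarith
      · rw [Finset.card_erase_of_mem hu]
        have : 0 < U.card := Finset.card_pos.2 ⟨u, hu⟩
        omega
      · intro ω hω
        refine ⟨lt_of_le_of_lt ?_ hω.1, fun w hw => lt_of_le_of_lt ?_ (hω.2 w (Finset.mem_sdiff.1 hw).1)⟩
        · exact_mod_cast Finset.card_le_card (clu_sub_reveal ω U S u hu)
        · exact_mod_cast Finset.card_le_card (clu_mono ω (by simp) Finset.sdiff_subset)

end Cluster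
end PercAux

namespace PercAux
open Percolation

set_option maxHeartbeats 1000000 in
lemma giant (b τ C ε : ℝ) (hb : 1 ≤ b) (hτ : 0 < τ) (hτC : τ ≤ C) (hε : 0 < ε) (hε1 : ε ≤ 1) :
    ∃ μ > 0, ∃ c > 0, ∃ N0 : ℕ, ∀ (V : Type) [Fintype V] [DecidableEq V] (p : Sym2 V → ℝ)
      (h0 : ∀ e, 0 ≤ p e) (h1 : ∀ e, p e ≤ 1) (hpb : ∀ e, p e ≤ b / Fintype.card V)
      (H : Finset V) (f : V → ℝ), H.Nonempty → (∀ v ∈ H, τ ≤ f v) → (∀ v ∈ H, f v ≤ C) →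
      (∀ u ∈ H, (1 + ε) * f u ≤ ∑ w ∈ H, p s(u, w) * f w) → N0 ≤ Fintype.card V →
      Pr p {ω | ∀ v, ((clu ω {v} Finset.univ).card : ℝ) < μ * Fintype.card V}
        ≤ Real.exp (-c * Fintype.card V) := by
  have hC : 0 < C := hτ.trans_le hτC
  have hb0 : 0 < b := by linarith
  set d := ε * τ / 4 with hd
  have hd0 : 0 < d := by positivity
  set η := ε * τ / (4 * b * C) with hη
  have hη0 : 0 < η := by positivity
  set θ := min (1 / C) (ε * τ / (4 * C ^ 2 * b)) with hθ
  have hθ0 : 0 < θ := by rw [hθ]; positivity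
  set μ := d * η / (8 * C) with hμ
  have hμ0 : 0 < μ := by positivity
  have hdC : d ≤ C / 4 := by
    have : ε * τ ≤ 1 * C := mul_le_mul hε1 hτC hτ.le zero_le_one
    rw [hd]; linarith
  have hμη : μ ≤ η / 2 := by
    rw [hμ, div_le_iff₀ (by positivity)]
    nlinarith
  have hCμ : C * μ = d * η / 8 := by rw [hμ]; field_simp
  have hbCη : b * C * η = ε * τ / 4 := by rw [hη]; field_simp
  have hθC : θ * C ≤ 1 := by
    have : θ ≤ 1 / C := min_le_left _ _
    calc θ * C ≤ 1 / C * C := by gcongr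
      _ = 1 := by field_simp
  have hθ2 : θ * (C ^ 2 * b) ≤ ε * τ / 4 := by
    have : θ ≤ ε * τ / (4 * C ^ 2 * b) := min_le_right _ _
    calc θ * (C ^ 2 * b) ≤ ε * τ / (4 * C ^ 2 * b) * (C ^ 2 * b) := by gcongr
      _ = _ := by field_simp
  refine ⟨μ, hμ0, θ * (d * η / 4), by positivity, ⌈8 / η⌉₊ + 1, ?_⟩
  intro V _ _ p h0 h1 hpb H f hHne hfτ hfC hdr hN
  set N : ℝ := (Fintype.card V : ℝ) with hNdef
  have hN8 : 8 / η ≤ N := by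
    have h1 := Nat.le_ceil (8 / η)
    have h2 : ((⌈8 / η⌉₊ + 1 : ℕ) : ℝ) ≤ N := by rw [hNdef]; exact_mod_cast hN
    push_cast at h2; linarith
  have hN0 : 0 < N := lt_of_lt_of_le (by positivity) hN8
  have hηN : 8 ≤ η * N := by
    rw [div_le_iff₀ hη0] at hN8; linarith
  set T0 := ⌊η * N / 2⌋₊ with hT0
  have hT0le : (T0 : ℝ) ≤ η * N / 2 := Nat.floor_le (by positivity)
  have hT0ge : η * N / 2 - 1 ≤ T0 := by
    have := Nat.lt_floor_add_one (η * N / 2); linarith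
  have hTm : (T0 : ℝ) + μ * N ≤ η * N := by
    have : μ * N ≤ η / 2 * N := by gcongr
    linarith
  have hHcard : η * N ≤ H.card := by
    obtain ⟨u, hu⟩ := hHne
    have h2 : ∑ w ∈ H, p s(u, w) * f w ≤ H.card * (b / N * C) := by
      have := Finset.sum_le_card_nsmul H (fun w => p s(u, w) * f w) (b / N * C) fun w hw =>
        mul_le_mul (hpb _) (hfC w hw) (hτ.le.trans (hfτ w hw)) (by positivity)
      simpa using this
    have h3 := hdr u hu
    have h4 : τ ≤ (1 + ε) * f u := by nlinarith [hfτ u hu]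
    have h5 : τ ≤ H.card * (b / N * C) := by linarith
    have h6 : H.card * (b / N * C) = H.card * (b * C) / N := by field_simp
    rw [h6, le_div_iff₀ hN0] at h5
    have : b * C * (η * N) ≤ b * C * H.card := by
      have e : b * C * (η * N) = ε * τ / 4 * N := by rw [← hbCη]; ring
      rw [e]
      have : ε * τ / 4 ≤ τ := by nlinarith
      nlinarith
    exact le_of_mul_le_mul_left this (by positivity)
  have main := Pr_fail p h0 h1 H f C (μ * N) θ d T0 hfC (fun v hv => hτ.le.trans (hfτ v hv)) hθ0.le
    (hTm.trans hHcard) (by positivity) hC.le ?_ T0 ∅ H (by simp) (Finset.Subset.refl _) (by simp)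
    le_rfl (by simp)
  · refine (Pr_mono h0 h1 ?_).trans (main.trans ?_)
    · intro ω hω
      refine ⟨?_, fun v _ => ?_⟩
      · have : clu ω ∅ H = (∅ : Finset V) := by ext w; simp [mem_clu]
        rw [this]; simp; positivity
      · refine lt_of_le_of_lt ?_ (hω v)
        exact_mod_cast Finset.card_le_card (clu_mono ω (Finset.Subset.refl _) (Finset.subset_univ _))
    · rw [Real.exp_le_exp]
      simp only [Finset.sum_empty, zero_add]
      have h1 : d * η / 4 * N ≤ d * T0 - C * (μ * N) := by
        have e : C * (μ * N) = d * η / 8 * N := by rw [← hCμ]; ring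
        rw [e]
        have h5 : d * (η * N / 2 - 1) ≤ d * T0 := by gcongr
        have h6 := mul_le_mul_of_nonneg_left hηN hd0.le
        linarith only [h5, h6]
      have h7 := mul_le_mul_of_nonneg_left h1 hθ0.le
      linarith only [h7]
  · intro u hu S hS hSc
    have hexp : ∀ w ∈ S, p s(u, w) * (Real.exp (-θ * f w) - 1) ≤
        -θ * (p s(u, w) * f w) + θ ^ 2 * C ^ 2 * (b / N) := by
      intro w hw
      have hw' := hfτ w (hS hw)
      have hwC := hfC w (hS hw)
      have hx0 : 0 ≤ θ * f w := mul_nonneg hθ0.le (by linarith)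
      have hx1 : θ * f w ≤ θ * C := by gcongr
      have := Real.abs_exp_sub_one_sub_id_le (x := -θ * f w) (by
        rw [neg_mul, abs_neg, abs_of_nonneg hx0]; linarith)
      have h3 := (abs_le.1 this).2
      have h4 : Real.exp (-θ * f w) - 1 ≤ -(θ * f w) + (θ * C) ^ 2 := by
        have : (θ * f w) ^ 2 ≤ (θ * C) ^ 2 := by gcongr
        nlinarith
      have h5 := mul_le_mul_of_nonneg_left h4 (h0 s(u, w))
      have h6 : p s(u, w) * (θ * C) ^ 2 ≤ b / N * (θ * C) ^ 2 := by
        gcongr; exact hpb _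
      nlinarith
    have hs := Finset.sum_le_sum hexp
    rw [Finset.sum_add_distrib, ← Finset.mul_sum, Finset.sum_const, nsmul_eq_mul] at hs
    have hScN : (S.card : ℝ) ≤ N := by rw [hNdef]; exact_mod_cast Finset.card_le_univ S
    have hbN : (S.card : ℝ) * (θ ^ 2 * C ^ 2 * (b / N)) ≤ θ * (θ * (C ^ 2 * b)) := by
      calc (S.card : ℝ) * (θ ^ 2 * C ^ 2 * (b / N)) ≤ N * (θ ^ 2 * C ^ 2 * (b / N)) := by gcongr
        _ = _ := by field_simp
    have hdiff : ∑ w ∈ H, p s(u, w) * f w - ∑ w ∈ S, p s(u, w) * f w ≤ ε * τ / 4 := by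
      rw [← Finset.sum_sdiff hS, add_sub_cancel_right]
      have := Finset.sum_le_card_nsmul (H \ S) (fun w => p s(u, w) * f w) (b / N * C) fun w hw => by
        have hw := (Finset.mem_sdiff.1 hw).1
        exact mul_le_mul (hpb _) (hfC w hw) (hτ.le.trans (hfτ w hw)) (by positivity)
      refine this.trans ?_
      rw [nsmul_eq_mul, Finset.card_sdiff_of_subset hS, Nat.cast_sub (Finset.card_le_card hS)]
      calc ((H.card : ℝ) - S.card) * (b / N * C) ≤ (η * N) * (b / N * C) := by
            gcongr; linarith
        _ = b * C * η := by field_simp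
        _ = _ := hbCη
    have h7 := hdr u hu
    have h8 : ε * τ ≤ ε * f u := by gcongr; exact hfτ u hu
    have h9 : d + f u - ∑ w ∈ S, p s(u, w) * f w + θ * (C ^ 2 * b) ≤ 0 := by
      rw [hd]; linarith
    nlinarith

section Grow
variable {V : Type} [Fintype V] [DecidableEq V]

/-- weight of i into S -/
def wtt (β : V → V → ℝ) (i : V) (S : Finset V) : ℝ := ∑ j ∈ S, β i j

/-- vertices in S or with large weight into S -/
def reg (β : V → V → ℝ) (c : ℝ) (S : Finset V) : Finset V :=
  Finset.univ.filter fun i => i ∈ S ∨ c * Fintype.card V ≤ wtt β i S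

def Good (β : V → V → ℝ) (μ c a : ℝ) : Set (Sym2 V → Bool) :=
  {ω | ∃ v0 : V, ∃ S : Finset V, S ⊆ clu ω {v0} Finset.univ ∧ μ * Fintype.card V ≤ S.card ∧
    a * Fintype.card V ≤ (reg β c S).card}

lemma wtt_mono (β : V → V → ℝ) (hβ : ∀ i j, 0 ≤ β i j) (i : V) {S T : Finset V} (h : S ⊆ T) :
    wtt β i S ≤ wtt β i T :=
  Finset.sum_le_sum_of_subset_of_nonneg h fun j _ _ => hβ i j

lemma clu_or_left (ω η : Sym2 V → Bool) (U S : Finset V) :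
    clu ω U S ⊆ clu (fun e => ω e || η e) U S :=
  clu_induction (P := fun w => w ∈ clu (fun e => ω e || η e) U S)
    (fun u hu => subset_clu _ _ _ hu) (fun _ _ _ ha hb h => clu_step ha hb (by simp [h]))

/-- exponential tail for the joined weight -/
lemma joined_tail (β : V → V → ℝ) (hβ : ∀ i j, 0 ≤ β i j) (b : ℝ) (hb : 0 < b)
    (hβb : ∀ i j, β i j ≤ b) (q : Sym2 V → ℝ) (h0 : ∀ e, 0 ≤ q e) (h1 : ∀ e, q e ≤ 1)
    (S Nn : Finset V) (hd : Disjoint S Nn) (ρ : ℝ) (hρ : 0 ≤ ρ)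
    (hS : ∀ j ∈ Nn, ρ ≤ ∑ s ∈ S, q s(j, s)) (i : V) (t : ℝ) (ht : t ≤ wtt β i Nn) :
    Pr q {η | wtt β i (Nn.filter fun j => ∃ s ∈ S, η s(j, s) = true)
        < (1 - Real.exp (-ρ)) * t / 4} ≤ Real.exp (-((1 - Real.exp (-ρ)) * t / (4 * b))) := by
  classical
  set Q := 1 - Real.exp (-ρ) with hQ
  have hQ0 : 0 ≤ Q := by rw [hQ]; simp [hρ]
  let φ : V → (Sym2 V → Bool) → ℝ := fun j η =>
    if ∃ s ∈ S, η s(j, s) = true then Real.exp (-(β i j / b)) else 1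
  have hφ : ∀ η : Sym2 V → Bool, ∏ j ∈ Nn, φ j η =
      Real.exp (-(wtt β i (Nn.filter fun j => ∃ s ∈ S, η s(j, s) = true)) / b) := by
    intro η
    simp only [φ]
    rw [← Finset.prod_filter, ← Real.exp_sum, wtt, neg_div, Finset.sum_div, Finset.sum_neg_distrib]
  have hEφ : ∀ j ∈ Nn, Ex q (φ j) ≤ Real.exp (-(Q / 2 * (β i j / b))) := by
    intro j hj
    have e1 : φ j = fun η => Real.exp (-(β i j / b)) + (1 - Real.exp (-(β i j / b))) *
        ∏ s ∈ S, (if η s(j, s) = true then 0 else 1) := by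
      funext η
      simp only [φ]
      by_cases h : ∃ s ∈ S, η s(j, s) = true
      · rw [if_pos h]
        obtain ⟨s, hs, hs'⟩ := h
        rw [Finset.prod_eq_zero hs (by simp [hs'])]; ring
      · rw [if_neg h, Finset.prod_eq_one]
        · ring
        · intro s hs
          rw [if_neg]; exact fun h' => h ⟨s, hs, h'⟩
    have e2 : Ex q (fun η => ∏ s ∈ S, (if η s(j, s) = true then (0:ℝ) else 1))
        = ∏ s ∈ S, (1 - q s(j, s)) := by
      rw [Ex_indep_family q S (fun w => {s(j, w)})]
      · refine Finset.prod_congr rfl fun w _ => ?_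
        have := Ex_prod_finset q {s(j, w)} (fun e b => if b = true then (0:ℝ) else 1)
        simp only [Finset.prod_singleton] at this
        rw [this]; simp
      · intro a _ b _ hab
        simp only [Set.disjoint_singleton, ne_eq]
        intro h
        rcases Sym2.eq_iff.1 h with h | h
        · exact hab h.2
        · exact hab (h.2.trans h.1)
      · intro w _ ω ω' h
        simp only [h s(j, w) rfl]
    have e3 : ∏ s ∈ S, (1 - q s(j, s)) ≤ Real.exp (-ρ) := by
      calc ∏ s ∈ S, (1 - q s(j, s)) ≤ ∏ s ∈ S, Real.exp (-q s(j, s)) :=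
            Finset.prod_le_prod (fun s _ => by linarith [h1 s(j, s)])
              fun s _ => Real.one_sub_le_exp_neg _
        _ = Real.exp (-∑ s ∈ S, q s(j, s)) := by rw [← Real.exp_sum, Finset.sum_neg_distrib]
        _ ≤ _ := by rw [Real.exp_le_exp]; linarith [hS j hj]
    rw [e1, Ex_add, Ex_const, Ex_mul_left, e2]
    set x := β i j / b with hx
    have hx0 : 0 ≤ x := div_nonneg (hβ i j) hb.le
    have hx1 : x ≤ 1 := by rw [hx, div_le_one hb]; exact hβb i j
    have hlow : x / 2 ≤ 1 - Real.exp (-x) := by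
      have h3 := Real.add_one_le_exp x
      have h4 : Real.exp (-x) * Real.exp x = 1 := by rw [← Real.exp_add]; simp
      have h5 := Real.exp_pos (-x)
      have h6 : Real.exp (-x) * (x + 1) ≤ 1 := (mul_le_mul_of_nonneg_left h3 h5.le).trans h4.le
      have h7 : Real.exp (-x) ≤ 1 / (x + 1) := by rw [le_div_iff₀ (by linarith)]; exact h6
      have h8 : 1 / (x + 1) ≤ 1 - x / 2 := by
        rw [div_le_iff₀ (by linarith)]; nlinarith
      linarith
    have h9 : (1 - Real.exp (-x)) * ∏ s ∈ S, (1 - q s(j, s)) ≤ (1 - Real.exp (-x)) * (1 - Q) := by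
      apply mul_le_mul_of_nonneg_left _ (by linarith)
      rw [hQ]; linarith
    have h10 := Real.add_one_le_exp (-(Q / 2 * x))
    nlinarith
  have hT : ∀ j ∈ Nn, DepOn {e : Sym2 V | ∃ s ∈ S, e = s(j, s)} (φ j) := by
    intro j hj η η' h
    have : (∃ s ∈ S, η s(j, s) = true) ↔ ∃ s ∈ S, η' s(j, s) = true := by
      refine exists_congr fun s => and_congr_right fun hs => ?_
      rw [h s(j, s) ⟨s, hs, rfl⟩]
    simp only [φ, this]
  have hprod : Ex q (fun η => ∏ j ∈ Nn, φ j η) ≤ Real.exp (-(Q / 2 * (t / b))) := by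
    rw [Ex_indep_family q Nn (fun j => {e : Sym2 V | ∃ s ∈ S, e = s(j, s)}) ?_ φ hT]
    · calc ∏ j ∈ Nn, Ex q (φ j) ≤ ∏ j ∈ Nn, Real.exp (-(Q / 2 * (β i j / b))) := by
            refine Finset.prod_le_prod (fun j _ => Ex_nonneg h0 h1 fun η => ?_) hEφ
            simp only [φ]; split_ifs <;> positivity
        _ = Real.exp (-(Q / 2 * (wtt β i Nn / b))) := by
            rw [← Real.exp_sum, Finset.sum_neg_distrib, ← Finset.mul_sum, ← Finset.sum_div]; rfl
        _ ≤ _ := by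
            rw [Real.exp_le_exp]
            have : t / b ≤ wtt β i Nn / b := by gcongr
            nlinarith
    · intro a ha c hc hac
      rw [Set.disjoint_left]
      rintro e ⟨s, hs, rfl⟩ ⟨s', hs', h⟩
      rcases Sym2.eq_iff.1 h with h | h
      · exact hac h.1
      · exact Finset.disjoint_left.1 hd hs' (h.1 ▸ ha)
  have hfin : Pr q {η | wtt β i (Nn.filter fun j => ∃ s ∈ S, η s(j, s) = true) < Q * t / 4}
      ≤ Ex q (fun η => Real.exp (Q * t / (4 * b)) * ∏ j ∈ Nn, φ j η) := by
    refine Pr_le_Ex h0 h1 _ _ (fun η => ?_) fun η hη => ?_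
    · rw [hφ]; positivity
    · rw [hφ, ← Real.exp_add, Real.one_le_exp_iff]
      have h2 : wtt β i (Nn.filter fun j => ∃ s ∈ S, η s(j, s) = true) < Q * t / 4 := hη
      have h3 : wtt β i (Nn.filter fun j => ∃ s ∈ S, η s(j, s) = true) / b ≤ Q * t / 4 / b := by
        gcongr
      have h4 : Q * t / 4 / b = Q * t / (4 * b) := by field_simp
      rw [neg_div]; linarith
  refine hfin.trans ?_
  rw [Ex_mul_left]
  refine (mul_le_mul_of_nonneg_left hprod (Real.exp_pos _).le).trans ?_
  rw [← Real.exp_add, Real.exp_le_exp]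
  apply le_of_eq; field_simp; ring

end Grow
end PercAux

namespace PercAux
open Percolation
section Grow
variable {V : Type} [Fintype V] [DecidableEq V]

def Cut (β : V → V → ℝ) (κ δ : ℝ) : Prop :=
  ∀ A : Finset V, δ * Fintype.card V ≤ A.card → (A.card : ℝ) ≤ (1 - δ) * Fintype.card V →
    κ * (Fintype.card V : ℝ) ^ 2 ≤ ∑ i ∈ Aᶜ, wtt β i A

lemma Good_mono (β : V → V → ℝ) {μ c c' a a' : ℝ} (hc : c' ≤ c) (ha : a' ≤ a) :
    Good β μ c a ⊆ Good β μ c' a' := by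
  rintro ω ⟨v0, S, h1, h2, h3⟩
  refine ⟨v0, S, h1, h2, ?_⟩
  have h4 : reg β c S ⊆ reg β c' S := by
    intro i hi
    simp only [reg, Finset.mem_filter, Finset.mem_univ, true_and] at hi ⊢
    rcases hi with hi | hi
    · exact Or.inl hi
    · refine Or.inr (le_trans ?_ hi); gcongr
  have h5 : ((reg β c S).card : ℝ) ≤ (reg β c' S).card := by
    exact_mod_cast Finset.card_le_card h4
  have h6 : a' * (Fintype.card V : ℝ) ≤ a * Fintype.card V := by gcongr
  linarith

lemma Good_or (β : V → V → ℝ) {μ c a : ℝ} {ω : Sym2 V → Bool} (η : Sym2 V → Bool)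
    (h : ω ∈ Good β μ c a) : (fun e => ω e || η e) ∈ Good β μ c a := by
  obtain ⟨v0, S, h1, h2, h3⟩ := h
  exact ⟨v0, S, h1.trans (clu_or_left _ _ _ _), h2, h3⟩

lemma Pr_empty (p : Sym2 V → ℝ) : Pr p ∅ = 0 := by
  simp [Pr, Ex_const]

set_option maxHeartbeats 1000000 in
lemma grow_step (β : V → V → ℝ) (hβ : ∀ i j, 0 ≤ β i j) (b : ℝ) (hb : 0 < b)
    (hβb : ∀ i j, β i j ≤ b) (q : Sym2 V → ℝ) (h0 : ∀ e, 0 ≤ q e) (h1 : ∀ e, q e ≤ 1)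
    (κ δ μ c a ε : ℝ) (hκ : 0 < κ) (hδμ : δ ≤ μ) (hc : 0 < c) (hcκ : c ≤ κ / 2) (hε : 0 < ε)
    (hN : 0 < (Fintype.card V : ℝ))
    (hq : ∀ i j, ε * (β i j / Fintype.card V) ≤ q s(i, j)) (hcut : Cut β κ δ)
    (ω : Sym2 V → Bool) (hω : ω ∈ Good β μ c a) :
    Pr q {η | (fun e => ω e || η e) ∉ Good β μ (min c ((1 - Real.exp (-(ε * c))) * κ / 16))
      (min (a + κ / (4 * b)) (1 - δ))} ≤
      Fintype.card V * Real.exp (-((1 - Real.exp (-(ε * c))) * κ / (16 * b) * Fintype.card V)) := by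
  set N : ℝ := (Fintype.card V : ℝ) with hNdef
  set Q := 1 - Real.exp (-(ε * c)) with hQ
  have hRHS : 0 ≤ N * Real.exp (-(Q * κ / (16 * b) * N)) := by positivity
  obtain ⟨v0, S, hS1, hS2, hS3⟩ := id hω
  set A := reg β c S with hA
  have hSA : S ⊆ A := by
    intro i hi; simp [hA, reg, hi]
  have hScard : (S.card : ℝ) ≤ A.card := by exact_mod_cast Finset.card_le_card hSA
  by_cases hbig : (1 - δ) * N ≤ A.card
  · have : {η : Sym2 V → Bool | (fun e => ω e || η e) ∉ Good β μ (min c (Q * κ / 16))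
      (min (a + κ / (4 * b)) (1 - δ))} = ∅ := by
      rw [Set.eq_empty_iff_forall_notMem]
      intro η hη
      apply hη
      have : ω ∈ Good β μ c (1 - δ) := ⟨v0, S, hS1, hS2, hbig⟩
      exact Good_mono β (min_le_left _ _) (min_le_right _ _) (Good_or β η this)
    rw [this, Pr_empty]; exact hRHS
  push Not at hbig
  have hδ : δ * N ≤ A.card := by
    have : δ * N ≤ μ * N := by gcongr
    linarith
  have hcutA := hcut A hδ hbig.le
  have hNV : (Finset.univ : Finset V).card = Fintype.card V := rfl
  set Nn := A \ S with hNn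
  set R := Aᶜ.filter (fun i => κ * N / 4 ≤ wtt β i Nn) with hR
  have hsplit : ∀ i, wtt β i A = wtt β i Nn + wtt β i S := fun i => by
    unfold wtt; rw [hNn, Finset.sum_sdiff hSA]
  have hnot : ∀ i ∈ Aᶜ, wtt β i S ≤ c * N := by
    intro i hi
    rw [Finset.mem_compl, hA] at hi
    simp only [reg, Finset.mem_filter, Finset.mem_univ, true_and, not_or, not_le] at hi
    exact hi.2.le
  have hAc : ((Aᶜ).card : ℝ) ≤ N := by rw [hNdef]; exact_mod_cast Finset.card_le_univ _
  have hsum1 : ∑ i ∈ Aᶜ, wtt β i S ≤ N * (c * N) := by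
    have := Finset.sum_le_card_nsmul _ _ _ hnot
    rw [nsmul_eq_mul] at this
    refine this.trans ?_
    gcongr
  have hsum2 : κ * N ^ 2 / 2 ≤ ∑ i ∈ Aᶜ, wtt β i Nn := by
    have e : ∑ i ∈ Aᶜ, wtt β i A = ∑ i ∈ Aᶜ, wtt β i Nn + ∑ i ∈ Aᶜ, wtt β i S := by
      rw [← Finset.sum_add_distrib]; exact Finset.sum_congr rfl fun i _ => hsplit i
    have : N * (c * N) ≤ N * (κ / 2 * N) := by gcongr
    nlinarith
  have hwb : ∀ i, wtt β i Nn ≤ b * N := by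
    intro i
    have := Finset.sum_le_card_nsmul Nn (fun j => β i j) b fun j _ => hβb i j
    rw [nsmul_eq_mul] at this
    have h2 : (Nn.card : ℝ) ≤ N := by rw [hNdef]; exact_mod_cast Finset.card_le_univ _
    unfold wtt
    nlinarith
  have hRcard : κ / (4 * b) * N ≤ R.card := by
    have h2 : ∑ i ∈ Aᶜ, wtt β i Nn ≤ R.card * (b * N) + N * (κ * N / 4) := by
      rw [← Finset.sum_filter_add_sum_filter_not Aᶜ (fun i => κ * N / 4 ≤ wtt β i Nn)]
      apply add_le_add
      · have := Finset.sum_le_card_nsmul R (fun i => wtt β i Nn) (b * N) fun j _ => hwb j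
        rwa [nsmul_eq_mul] at this
      · have := Finset.sum_le_card_nsmul (Aᶜ.filter (fun i => ¬ κ * N / 4 ≤ wtt β i Nn))
          (fun i => wtt β i Nn) (κ * N / 4) fun j hj => by
            have := (Finset.mem_filter.1 hj).2
            push Not at this; exact this.le
        rw [nsmul_eq_mul] at this
        refine this.trans ?_
        gcongr
        rw [hNdef]; exact_mod_cast Finset.card_le_univ _
    have h3 : κ * N / 4 * N ≤ R.card * b * N := by nlinarith
    have h4 := le_of_mul_le_mul_right h3 hN
    have e : κ / (4 * b) * N = (κ * N / 4) / b := by field_simp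
    rw [e, div_le_iff₀ hb]; exact h4
  have htail : ∀ i ∈ R, Pr q {η | wtt β i (Nn.filter fun j => ∃ s ∈ S, η s(j, s) = true)
        < Q * (κ * N / 4) / 4} ≤ Real.exp (-(Q * (κ * N / 4) / (4 * b))) := by
    intro i hi
    refine joined_tail β hβ b hb hβb q h0 h1 S Nn Finset.disjoint_sdiff (ε * c) (by positivity)
      ?_ i _ (Finset.mem_filter.1 hi).2
    intro j hj
    rw [hNn, Finset.mem_sdiff] at hj
    have hjA : j ∈ S ∨ c * N ≤ wtt β j S := by
      have := hj.1; rw [hA] at this; simpa [reg] using this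
    have h2 := hjA.resolve_left hj.2
    calc ε * c = ε / N * (c * N) := by field_simp
      _ ≤ ε / N * wtt β j S := by gcongr
      _ = ∑ s ∈ S, ε * (β j s / N) := by
          unfold wtt; rw [Finset.mul_sum]; exact Finset.sum_congr rfl fun s _ => by ring
      _ ≤ _ := Finset.sum_le_sum fun s _ => hq j s
  have hfinal : {η | (fun e => ω e || η e) ∉ Good β μ (min c (Q * κ / 16))
      (min (a + κ / (4 * b)) (1 - δ))} ⊆ {η | ∃ i ∈ R, η ∈ {η : Sym2 V → Bool |
        wtt β i (Nn.filter fun j => ∃ s ∈ S, η s(j, s) = true) < Q * (κ * N / 4) / 4}} := by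
    intro η hη
    by_contra hcon
    apply hη
    simp only [Set.mem_ofPred_eq, not_exists, not_and, not_lt] at hcon
    set J := Nn.filter fun j => ∃ s ∈ S, η s(j, s) = true with hJ
    refine Good_mono β le_rfl (min_le_left _ _) (a := a + κ / (4 * b)) ⟨v0, S ∪ J, ?_, ?_, ?_⟩
    · intro w hw
      rcases Finset.mem_union.1 hw with hw | hw
      · exact clu_or_left _ _ _ _ (hS1 hw)
      · obtain ⟨s, hs, hs'⟩ := (Finset.mem_filter.1 hw).2
        refine clu_step (clu_or_left _ _ _ _ (hS1 hs)) (Finset.mem_univ _) ?_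
        rw [Sym2.eq_swap] at hs'; simp [hs']
    · refine hS2.trans ?_
      exact_mod_cast Finset.card_le_card Finset.subset_union_left
    · have hsub : A ∪ R ⊆ reg β (min c (Q * κ / 16)) (S ∪ J) := by
        intro i hi
        simp only [reg, Finset.mem_filter, Finset.mem_univ, true_and]
        rcases Finset.mem_union.1 hi with hi | hi
        · have hiA : i ∈ S ∨ c * N ≤ wtt β i S := by rw [hA] at hi; simpa [reg] using hi
          rcases hiA with h | h
          · exact Or.inl (Finset.mem_union_left _ h)
          · refine Or.inr (le_trans ?_ (h.trans (wtt_mono β hβ i Finset.subset_union_left)))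
            gcongr; exact min_le_left _ _
        · refine Or.inr (le_trans ?_ ((hcon i hi).trans (wtt_mono β hβ i Finset.subset_union_right)))
          have : min c (Q * κ / 16) * N ≤ Q * κ / 16 * N := by gcongr; exact min_le_right _ _
          linarith
      have hdis : Disjoint A R := by
        rw [Finset.disjoint_left]; intro i hi hi'
        have := (Finset.mem_filter.1 hi').1
        rw [Finset.mem_compl] at this; exact this hi
      have h2 := Finset.card_le_card hsub
      rw [Finset.card_union_of_disjoint hdis] at h2
      have h3 : (A.card : ℝ) + R.card ≤ (reg β (min c (Q * κ / 16)) (S ∪ J)).card := by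
        exact_mod_cast h2
      rw [add_mul]; linarith
  refine (Pr_mono h0 h1 hfinal).trans ((Pr_exists_le R h0 h1 _).trans ?_)
  have := Finset.sum_le_card_nsmul R _ _ htail
  rw [nsmul_eq_mul] at this
  refine this.trans ?_
  have hRN : (R.card : ℝ) ≤ N := by rw [hNdef]; exact_mod_cast Finset.card_le_univ _
  have e : Q * (κ * N / 4) / (4 * b) = Q * κ / (16 * b) * N := by field_simp; norm_num
  rw [e]
  gcongr

/-- thinned probabilities -/
def pth (p : Sym2 V → ℝ) (θ : ℝ) : Sym2 V → ℝ := fun e => 1 - (1 - p e) ^ θ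

lemma pth_add (p : Sym2 V → ℝ) (h1 : ∀ e, p e < 1) (θ θ' : ℝ) :
    pth p (θ + θ') = fun e => 1 - (1 - pth p θ e) * (1 - pth p θ' e) := by
  funext e
  simp only [pth, sub_sub_cancel]
  rw [Real.rpow_add (by linarith [h1 e])]

lemma pth_one (p : Sym2 V → ℝ) : pth p 1 = p := by
  funext e; simp [pth]

lemma pth_nonneg (p : Sym2 V → ℝ) (h0 : ∀ e, 0 ≤ p e) (h1 : ∀ e, p e < 1) {θ : ℝ} (hθ : 0 ≤ θ) (e) :
    0 ≤ pth p θ e := by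
  have := Real.rpow_le_one (x := 1 - p e) (z := θ) (by linarith [h1 e]) (by linarith [h0 e]) hθ
  simp only [pth]; linarith

lemma pth_le_one (p : Sym2 V → ℝ) (h1 : ∀ e, p e < 1) {θ : ℝ} (e) :
    pth p θ e ≤ 1 := by
  have := Real.rpow_nonneg (x := 1 - p e) (by linarith [h1 e]) θ
  simp only [pth]; linarith

lemma pth_ge (p : Sym2 V → ℝ) (h0 : ∀ e, 0 ≤ p e) (h1 : ∀ e, p e < 1) {θ : ℝ} (hθ : 0 ≤ θ)
    (hθ1 : θ ≤ 1) (e) : θ * p e ≤ pth p θ e := by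
  have := rpow_one_add_le_one_add_mul_self (s := -p e) (by linarith [h1 e]) hθ hθ1
  simp only [pth]
  rw [← sub_eq_add_neg] at this; linarith

lemma pth_le (p : Sym2 V → ℝ) (h0 : ∀ e, 0 ≤ p e) (h1 : ∀ e, p e < 1) {θ : ℝ} (hθ : 0 ≤ θ)
    (hθ1 : θ ≤ 1) (e) : pth p θ e ≤ p e := by
  have := Real.rpow_le_rpow_of_exponent_ge (x := 1 - p e) (by linarith [h1 e]) (by linarith [h0 e]) hθ1
  simp only [pth]
  rw [Real.rpow_one] at this; linarith

lemma Pr_or_le (p q : Sym2 V → ℝ) (hp0 : ∀ e, 0 ≤ p e) (hp1 : ∀ e, p e ≤ 1)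
    (hq0 : ∀ e, 0 ≤ q e) (hq1 : ∀ e, q e ≤ 1) (A B : Set (Sym2 V → Bool)) (r : ℝ) (hr : 0 ≤ r)
    (h : ∀ ω ∈ B, Pr q {η | (fun e => ω e || η e) ∈ A} ≤ r) :
    Pr (fun e => 1 - (1 - p e) * (1 - q e)) A ≤ Pr p Bᶜ + r := by
  have e1 : Pr (fun e => 1 - (1 - p e) * (1 - q e)) A =
      Ex p (fun ω => Pr q {η | (fun e => ω e || η e) ∈ A}) := by
    unfold Pr; rw [Ex_or]; rfl
  rw [e1]
  have : Ex p (fun ω => Pr q {η | (fun e => ω e || η e) ∈ A}) ≤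
      Ex p (fun ω => Bᶜ.indicator (fun _ => 1) ω + r) := by
    refine Ex_mono hp0 hp1 fun ω => ?_
    by_cases hω : ω ∈ B
    · simpa [hω] using h ω hω
    · have := Pr_le_one hq0 hq1 {η | (fun e => ω e || η e) ∈ A}
      simp only [Set.mem_compl_iff, hω, not_false_eq_true, Set.indicator_of_mem]; linarith
  refine this.trans ?_
  rw [Ex_add, Ex_const]; rfl

end Grow

set_option maxHeartbeats 1000000 in
lemma grow_iter (b κ δ μ ε : ℝ) (hb : 0 < b) (hκ : 0 < κ) (hδμ : δ ≤ μ) (hε : 0 < ε) (hε1 : ε ≤ 1)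
    (k : ℕ) : ∃ c > 0, c ≤ κ / 2 ∧ ∃ r > 0, ∀ (V : Type) [Fintype V] [DecidableEq V]
      (β : V → V → ℝ) (hβ : ∀ i j, 0 ≤ β i j) (hβb : ∀ i j, β i j ≤ b) (p : Sym2 V → ℝ)
      (h0 : ∀ e, 0 ≤ p e) (h1 : ∀ e, p e < 1) (hp : ∀ i j, β i j / Fintype.card V ≤ p s(i, j))
      (hN : 0 < (Fintype.card V : ℝ)) (hcut : Cut β κ δ) (θ R : ℝ) (hθ : 0 ≤ θ)
      (hR : Pr (pth p θ) (Good β μ (κ / 2) 0)ᶜ ≤ R),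
      Pr (pth p (θ + k * ε)) (Good β μ c (min (k * (κ / (4 * b))) (1 - δ)))ᶜ ≤
        R + k * (Fintype.card V * Real.exp (- r * Fintype.card V)) := by
  induction k with
  | zero =>
    refine ⟨κ / 2, by positivity, le_rfl, 1, one_pos, ?_⟩
    intro V _ _ β hβ hβb p h0 h1 hp hN hcut θ R hθ hR
    simp only [Nat.cast_zero, zero_mul, add_zero]
    refine (Pr_mono (pth_nonneg p h0 h1 hθ) (fun e => pth_le_one p h1 e) ?_).trans hR
    exact Set.compl_subset_compl.2 (Good_mono β le_rfl (min_le_left _ _))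
  | succ k ih =>
    obtain ⟨c, hc, hcκ, r, hr, ih⟩ := ih
    have hQ : 0 < 1 - Real.exp (-(ε * c)) := by
      have : Real.exp (-(ε * c)) < 1 := by rw [Real.exp_lt_one_iff]; nlinarith
      linarith
    set Q := 1 - Real.exp (-(ε * c)) with hQd
    refine ⟨min c (Q * κ / 16), by positivity, (min_le_left _ _).trans hcκ,
      min r (Q * κ / (16 * b)), by positivity, ?_⟩
    intro V _ _ β hβ hβb p h0 h1 hp hN hcut θ R hθ hR
    have ih' := ih V β hβ hβb p h0 h1 hp hN hcut θ R hθ hR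
    have hθk : 0 ≤ θ + k * ε := by positivity
    have e : θ + ((k + 1 : ℕ) : ℝ) * ε = (θ + k * ε) + ε := by push_cast; ring
    rw [e, pth_add p h1]
    set r' := min r (Q * κ / (16 * b)) with hr'
    set N : ℝ := (Fintype.card V : ℝ) with hNd
    have hx1 : Real.exp (-r * N) ≤ Real.exp (-r' * N) := by
      rw [Real.exp_le_exp]
      have : r' * N ≤ r * N := by gcongr; exact min_le_left _ _
      linarith
    have hx2 : Real.exp (-(Q * κ / (16 * b) * N)) ≤ Real.exp (-r' * N) := by
      rw [Real.exp_le_exp]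
      have : r' * N ≤ Q * κ / (16 * b) * N := by gcongr; exact min_le_right _ _
      linarith
    have hq : ∀ i j, ε * (β i j / Fintype.card V) ≤ pth p ε s(i, j) := fun i j =>
      (mul_le_mul_of_nonneg_left (hp i j) hε.le).trans (pth_ge p h0 h1 hε.le hε1 _)
    have key := Pr_or_le (pth p (θ + k * ε)) (pth p ε) (pth_nonneg p h0 h1 hθk)
      (fun e => pth_le_one p h1 e) (pth_nonneg p h0 h1 hε.le) (fun e => pth_le_one p h1 e)
      (Good β μ (min c (Q * κ / 16)) (min (((k + 1 : ℕ) : ℝ) * (κ / (4 * b))) (1 - δ)))ᶜ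
      (Good β μ c (min (k * (κ / (4 * b))) (1 - δ)))
      (N * Real.exp (-(Q * κ / (16 * b) * N))) (by positivity) ?_
    · have g1 : N * Real.exp (-r * N) ≤ N * Real.exp (-r' * N) := by gcongr
      have g2 : N * Real.exp (-(Q * κ / (16 * b) * N)) ≤ N * Real.exp (-r' * N) := by gcongr
      have g3 : k * (N * Real.exp (-r * N)) ≤ k * (N * Real.exp (-r' * N)) := by gcongr
      refine key.trans ?_
      push_cast
      linarith
    · intro ω hω
      have := grow_step β hβ b hb hβb (pth p ε) (pth_nonneg p h0 h1 hε.le)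
        (fun e => pth_le_one p h1 e) κ δ μ c _ ε hκ hδμ hc hcκ hε hN hq hcut ω hω
      refine (Pr_mono (pth_nonneg p h0 h1 hε.le) (fun e => pth_le_one p h1 e) ?_).trans this
      intro η hη h
      apply hη
      refine Good_mono β le_rfl ?_ h
      refine le_min ?_ (min_le_right _ _)
      push_cast
      rw [min_add]
      have : 0 < κ / (4 * b) := by positivity
      refine le_min ((min_le_left _ _).trans (by linarith)) ((min_le_right _ _).trans (by linarith))
end PercAux

namespace PercAux
open Percolation
section Spr
variable {V : Type} [Fintype V] [DecidableEq V]

def IsComp (ω : Sym2 V → Bool) (C : Finset V) : Prop := ∃ v, clu ω {v} Finset.univ = C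

lemma IsComp_aux (C : Finset V) (ω ω' : Sym2 V → Bool)
    (h : ∀ e ∈ {e : Sym2 V | ∃ a ∈ C, a ∈ e}, ω e = ω' e) (hc : IsComp ω C) : IsComp ω' C := by
  obtain ⟨v, rfl⟩ := hc
  refine ⟨v, Finset.Subset.antisymm ?_ ?_⟩
  · intro w hw
    refine clu_induction (P := fun w => w ∈ clu ω {v} Finset.univ) (fun u hu => subset_clu _ _ _ hu)
      ?_ w hw
    intro a b _ ha hb hab
    refine clu_step ha hb ?_
    rw [h _ ⟨a, ha, by simp⟩]; exact hab
  · intro w hw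
    refine clu_induction (P := fun w => w ∈ clu ω' {v} Finset.univ) (fun u hu => subset_clu _ _ _ hu)
      ?_ w hw
    intro a b ha ha' hb hab
    refine clu_step ha' hb ?_
    rw [← h _ ⟨a, ha, by simp⟩]; exact hab

lemma IsComp_dep (C : Finset V) :
    DepOn {e : Sym2 V | ∃ a ∈ C, a ∈ e} ({ω | IsComp ω C}.indicator fun _ => (1:ℝ)) := by
  intro ω ω' h
  have : IsComp ω C ↔ IsComp ω' C :=
    ⟨IsComp_aux C ω ω' h, IsComp_aux C ω' ω fun e he => (h e he).symm⟩
  by_cases hh : IsComp ω C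
  · rw [Set.indicator_of_mem (s := {ω | IsComp ω C}) hh, Set.indicator_of_mem (s := {ω | IsComp ω C}) (this.1 hh)]
  · rw [Set.indicator_of_notMem (s := {ω | IsComp ω C}) hh, Set.indicator_of_notMem (s := {ω | IsComp ω C}) (fun h => hh (this.2 h))]

lemma sum_IsComp (p : Sym2 V → ℝ) (h0 : ∀ e, 0 ≤ p e) (h1 : ∀ e, p e ≤ 1) :
    ∑ C : Finset V, Pr p {ω | IsComp ω C} ≤ Fintype.card V := by
  unfold Pr
  rw [← Ex_sum, ← Ex_const p (Fintype.card V : ℝ)]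
  refine Ex_mono h0 h1 fun ω => ?_
  have h2 : ∀ C : Finset V, ({ω | IsComp ω C}.indicator (fun _ => (1:ℝ)) ω) ≤
      ∑ v : V, if clu ω {v} Finset.univ = C then (1:ℝ) else 0 := by
    intro C
    by_cases h : IsComp ω C
    · rw [Set.indicator_of_mem (s := {ω | IsComp ω C}) h]
      obtain ⟨v, hv⟩ := h
      refine le_trans ?_ (Finset.single_le_sum (fun v _ => by split_ifs <;> norm_num)
        (Finset.mem_univ v))
      simp [hv]
    · rw [Set.indicator_of_notMem (s := {ω | IsComp ω C}) h]
      exact Finset.sum_nonneg fun v _ => by split_ifs <;> norm_num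
  refine (Finset.sum_le_sum fun C _ => h2 C).trans ?_
  rw [Finset.sum_comm]
  simp

/-- bad event for fixed C, v -/
def BadCv (ω1 ω2 : Sym2 V → Bool) (L : ℝ) (C : Finset V) (v : V) : Prop :=
  let D := clu (fun e => ω1 e || ω2 e) {v} (Cᶜ \ {v})
  L ≤ D.card ∧ ∀ d ∈ D, ∀ a ∈ C, ω2 s(d, a) = false

lemma noedge (p2 : Sym2 V → ℝ) (h0 : ∀ e, 0 ≤ p2 e) (h1 : ∀ e, p2 e ≤ 1) (C D B : Finset V)
    (hDC : Disjoint C D) (σ : ℝ) (hσ : 0 ≤ σ)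
    (hB : ∀ d ∈ D, d ∉ B → σ ≤ ∑ a ∈ C, p2 s(d, a)) :
    Ex p2 (fun ω2 => ∏ d ∈ D, ∏ a ∈ C, if ω2 s(d, a) = true then (0:ℝ) else 1)
      ≤ Real.exp (-(σ * (D \ B).card)) := by
  rw [Ex_indep_family p2 D (fun d => {e | ∃ a ∈ C, e = s(d, a)})]
  · have hin : ∀ d ∈ D, Ex p2 (fun ω2 => ∏ a ∈ C, if ω2 s(d, a) = true then (0:ℝ) else 1)
        = ∏ a ∈ C, (1 - p2 s(d, a)) := by
      intro d hd
      rw [Ex_indep_family p2 C (fun w => {s(d, w)})]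
      · refine Finset.prod_congr rfl fun w _ => ?_
        have := Ex_prod_finset p2 {s(d, w)} (fun e b => if b = true then (0:ℝ) else 1)
        simp only [Finset.prod_singleton] at this
        rw [this]; simp
      · intro a _ b _ hab
        simp only [Set.disjoint_singleton, ne_eq]
        intro h
        rcases Sym2.eq_iff.1 h with h | h
        · exact hab h.2
        · exact hab (h.2.trans h.1)
      · intro w _ ω ω' h
        simp only [h s(d, w) rfl]
    have hle : ∀ d ∈ D, Ex p2 (fun ω2 => ∏ a ∈ C, if ω2 s(d, a) = true then (0:ℝ) else 1)
        ≤ if d ∈ D \ B then Real.exp (-σ) else 1 := by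
      intro d hd
      rw [hin d hd]
      split_ifs with h
      · calc ∏ a ∈ C, (1 - p2 s(d, a)) ≤ ∏ a ∈ C, Real.exp (-p2 s(d, a)) :=
            Finset.prod_le_prod (fun s _ => by linarith [h1 s(d, s)])
              fun s _ => Real.one_sub_le_exp_neg _
        _ = Real.exp (-∑ a ∈ C, p2 s(d, a)) := by rw [← Real.exp_sum, Finset.sum_neg_distrib]
        _ ≤ _ := by
          rw [Real.exp_le_exp]; linarith [hB d hd (Finset.mem_sdiff.1 h).2]
      · exact Finset.prod_le_one (fun s _ => by linarith [h1 s(d, s)])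
          fun s _ => by linarith [h0 s(d, s)]
    refine (Finset.prod_le_prod (fun d hd => ?_) hle).trans ?_
    · rw [hin d hd]; exact Finset.prod_nonneg fun s _ => by linarith [h1 s(d, s)]
    · rw [Finset.prod_ite_mem, Finset.inter_eq_right.2 Finset.sdiff_subset, Finset.prod_const,
        ← Real.exp_nat_mul]
      apply le_of_eq; congr 1; ring
  · intro a ha c hc hac
    rw [Set.disjoint_left]
    rintro e ⟨s, hs, rfl⟩ ⟨s', hs', h⟩
    rcases Sym2.eq_iff.1 h with h | h
    · exact hac h.1
    · exact Finset.disjoint_left.1 hDC hs' (h.1 ▸ ha)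
  · intro d hd ω ω' h
    refine Finset.prod_congr rfl fun a ha => ?_
    rw [h s(d, a) ⟨a, ha, rfl⟩]

lemma inner_bound (p2 : Sym2 V → ℝ) (h0 : ∀ e, 0 ≤ p2 e) (h1 : ∀ e, p2 e ≤ 1) (C B : Finset V)
    (L σ : ℝ) (hσ : 0 ≤ σ) (hB : ∀ d, d ∉ C → d ∉ B → σ ≤ ∑ a ∈ C, p2 s(d, a))
    (ω1 : Sym2 V → Bool) (v : V) (hv : v ∉ C) (g : Finset V → ℝ)
    (hg : ∀ D : Finset V, L ≤ D.card → Real.exp (-(σ * (D \ B).card)) ≤ g D) (hg0 : ∀ D, 0 ≤ g D) :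
    Pr p2 {ω2 | BadCv ω1 ω2 L C v} ≤
      Ex p2 (fun ω2 => g (clu (fun e => ω1 e || ω2 e) {v} (Cᶜ \ {v}))) := by
  set Dd : (Sym2 V → Bool) → Finset V := fun ω2 => clu (fun e => ω1 e || ω2 e) {v} (Cᶜ \ {v}) with hDd
  have hsub : ∀ ω2, Dd ω2 ⊆ Cᶜ := by
    intro ω2 w hw
    have := clu_subset _ _ _ hw
    simp only [Finset.mem_union, Finset.mem_singleton, Finset.mem_sdiff, Finset.mem_compl] at this ⊢
    rcases this with rfl | h
    · exact hv
    · exact h.1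
  have hdep : DepOn {e : Sym2 V | ∃ a ∈ C, a ∈ e}ᶜ Dd := by
    intro ω ω' h
    refine clu_dep {v} (Cᶜ \ {v}) {e : Sym2 V | ∃ a ∈ C, a ∈ e}ᶜ ?_ _ _ fun e he => by rw [h e he]
    intro a ha b hb
    simp only [Set.mem_compl_iff, Set.mem_ofPred_eq, not_exists, not_and, Sym2.mem_iff, not_or]
    intro x hx
    simp only [Finset.mem_union, Finset.mem_singleton, Finset.mem_sdiff, Finset.mem_compl] at ha hb
    refine ⟨?_, ?_⟩
    · rintro rfl
      rcases ha with rfl | h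
      · exact hv hx
      · exact h.1 hx
    · rintro rfl; exact hb.1 hx
  have e1 : ∀ ω2, ({ω2 | BadCv ω1 ω2 L C v}.indicator (fun _ => (1:ℝ)) ω2) ≤
      ∑ D ∈ Finset.univ.filter (fun D : Finset V => Disjoint C D ∧ L ≤ D.card),
        (if Dd ω2 = D then (1:ℝ) else 0) *
        ∏ d ∈ D, ∏ a ∈ C, if ω2 s(d, a) = true then (0:ℝ) else 1 := by
    intro ω2
    have hnn : ∀ D : Finset V, 0 ≤ (if Dd ω2 = D then (1:ℝ) else 0) *
        ∏ d ∈ D, ∏ a ∈ C, if ω2 s(d, a) = true then (0:ℝ) else 1 := fun D =>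
      mul_nonneg (by split_ifs <;> norm_num) (Finset.prod_nonneg fun d _ => Finset.prod_nonneg fun a _ =>
        by split_ifs <;> norm_num)
    by_cases h : BadCv ω1 ω2 L C v
    · rw [Set.indicator_of_mem (s := {ω2 | BadCv ω1 ω2 L C v}) h]
      refine le_trans ?_ (Finset.single_le_sum (fun D _ => hnn D) (a := Dd ω2) ?_)
      · rw [if_pos rfl, one_mul, Finset.prod_eq_one]
        intro d hd
        refine Finset.prod_eq_one fun a ha => ?_
        rw [h.2 d hd a ha]; simp
      · simp only [Finset.mem_filter, Finset.mem_univ, true_and]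
        refine ⟨?_, h.1⟩
        rw [Finset.disjoint_left]; intro a ha ha'
        exact (Finset.mem_compl.1 (hsub ω2 ha')) ha
    · rw [Set.indicator_of_notMem (s := {ω2 | BadCv ω1 ω2 L C v}) h]
      exact Finset.sum_nonneg fun D _ => hnn D
  refine (Ex_mono h0 h1 e1).trans ?_
  rw [Ex_sum]
  have e2 : ∀ D ∈ Finset.univ.filter (fun D : Finset V => Disjoint C D ∧ L ≤ D.card),
      Ex p2 (fun ω2 => (if Dd ω2 = D then (1:ℝ) else 0) *
        ∏ d ∈ D, ∏ a ∈ C, if ω2 s(d, a) = true then (0:ℝ) else 1) ≤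
      Ex p2 (fun ω2 => (if Dd ω2 = D then (1:ℝ) else 0) * g D) := by
    intro D hD
    simp only [Finset.mem_filter, Finset.mem_univ, true_and] at hD
    have hi := Ex_indep p2 {e : Sym2 V | ∃ a ∈ C, a ∈ e}
      (fun ω2 => ∏ d ∈ D, ∏ a ∈ C, if ω2 s(d, a) = true then (0:ℝ) else 1)
      (fun ω2 => if Dd ω2 = D then (1:ℝ) else 0) ?_ ?_
    · have hcomm : (fun ω2 => (if Dd ω2 = D then (1:ℝ) else 0) *
        ∏ d ∈ D, ∏ a ∈ C, if ω2 s(d, a) = true then (0:ℝ) else 1) = (fun ω2 =>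
        (∏ d ∈ D, ∏ a ∈ C, if ω2 s(d, a) = true then (0:ℝ) else 1) *
          (if Dd ω2 = D then (1:ℝ) else 0)) := by funext ω2; ring
      rw [hcomm, hi, Ex_mul_right, mul_comm]
      refine mul_le_mul_of_nonneg_left ?_ (Ex_nonneg h0 h1 fun ω => by split_ifs <;> norm_num)
      refine (noedge p2 h0 h1 C D B hD.1 σ hσ fun d hd hdB => hB d ?_ hdB).trans (hg D hD.2)
      exact fun h => Finset.disjoint_left.1 hD.1 h hd
    · intro ω ω' h
      refine Finset.prod_congr rfl fun d hd => Finset.prod_congr rfl fun a ha => ?_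
      rw [h s(d, a) ⟨a, ha, by simp⟩]
    · intro ω ω' h
      simp only [hdep ω ω' h]
  refine (Finset.sum_le_sum e2).trans ?_
  rw [← Ex_sum]
  refine Ex_mono h0 h1 fun ω2 => ?_
  refine (Finset.sum_le_sum_of_subset_of_nonneg (Finset.filter_subset _ _)
    fun D _ _ => mul_nonneg (by split_ifs <;> norm_num) (hg0 D)).trans ?_
  simp [hDd]

end Spr
end PercAux

namespace PercAux
open Percolation
section Spr
variable {V : Type} [Fintype V] [DecidableEq V]

set_option maxHeartbeats 1000000 in
lemma badC (β : V → V → ℝ) (b : ℝ) (hb : 0 < b) (p1 p2 : Sym2 V → ℝ)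
    (h10 : ∀ e, 0 ≤ p1 e) (h11 : ∀ e, p1 e ≤ 1) (h20 : ∀ e, 0 ≤ p2 e) (h21 : ∀ e, p2 e ≤ 1)
    (hN : 0 < (Fintype.card V : ℝ))
    (hpb : ∀ e, 1 - (1 - p1 e) * (1 - p2 e) ≤ b / Fintype.card V)
    (ε c δ L : ℝ) (hε : 0 ≤ ε) (hc : 0 ≤ c) (hδ0 : 0 ≤ δ) (hL : 0 ≤ L)
    (hδ : b * δ * (Real.exp 2 - 1) ≤ 1)
    (hp2 : ∀ i j, ε * (β i j / Fintype.card V) ≤ p2 s(i, j))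
    (C : Finset V) (hC : (((reg β c C)ᶜ).card : ℝ) ≤ δ * Fintype.card V) (v : V) (hv : v ∉ C) :
    Ex p1 (fun ω1 => ({ω | IsComp ω C}.indicator (fun _ => (1:ℝ)) ω1) *
      Pr p2 {ω2 | BadCv ω1 ω2 L C v}) ≤
      Pr p1 {ω | IsComp ω C} * (Real.exp (-(ε * c * L / 4)) + Real.exp (2 - L / 2)) := by
  set N : ℝ := (Fintype.card V : ℝ) with hNd
  set B := (reg β c C)ᶜ with hB
  set x : V → ℝ := fun w => if w ∈ B then Real.exp 1 else Real.exp (-1) with hx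
  set y : V → ℝ := fun w => if w ∈ B then Real.exp 2 else 1 with hy
  set g : Finset V → ℝ := fun D => Real.exp (-(ε * c * L / 4)) + Real.exp (-(L / 2)) * ∏ w ∈ D, x w
    with hg
  have hx0 : ∀ w, 0 ≤ x w := fun w => by simp only [hx]; split_ifs <;> positivity
  have hg0 : ∀ D, 0 ≤ g D := fun D => by
    have := Finset.prod_nonneg (s := D) fun w _ => hx0 w
    simp only [hg]; positivity
  have hxprod : ∀ D : Finset V, ∏ w ∈ D, x w = Real.exp ((D ∩ B).card - (D \ B).card) := by
    intro D
    rw [← Finset.prod_inter_mul_prod_sdiff D B]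
    rw [Finset.prod_congr rfl (g := fun _ => Real.exp 1), Finset.prod_const,
      Finset.prod_congr (s₁ := D \ B) rfl (g := fun _ => Real.exp (-1)), Finset.prod_const,
      ← Real.exp_nat_mul, ← Real.exp_nat_mul, ← Real.exp_add]
    · congr 1; ring
    · intro w hw; simp [hx, (Finset.mem_sdiff.1 hw).2]
    · intro w hw; simp [hx, (Finset.mem_inter.1 hw).2]
  have hσ : 0 ≤ ε * c := by positivity
  have hgD : ∀ D : Finset V, L ≤ D.card → Real.exp (-(ε * c * (D \ B).card)) ≤ g D := by
    intro D hD
    simp only [hg]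
    rw [hxprod, ← Real.exp_add]
    have hcard : ((D ∩ B).card : ℝ) + (D \ B).card = D.card := by
      exact_mod_cast Finset.card_inter_add_card_sdiff D B
    by_cases h : L / 4 ≤ (D \ B).card
    · have : Real.exp (-(ε * c * (D \ B).card)) ≤ Real.exp (-(ε * c * L / 4)) := by
        rw [Real.exp_le_exp]; nlinarith
      have := Real.exp_pos (-(L / 2) + ((D ∩ B).card - (D \ B).card))
      linarith
    · push Not at h
      have h1 : 1 ≤ Real.exp (-(L / 2) + ((D ∩ B).card - (D \ B).card)) := by
        rw [Real.one_le_exp_iff]; linarith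
      have h2 : Real.exp (-(ε * c * (D \ B).card)) ≤ 1 := by
        rw [Real.exp_le_one_iff]
        have : 0 ≤ ε * c * (D \ B).card := by positivity
        linarith
      have := Real.exp_pos (-(ε * c * L / 4))
      linarith
  have hBC : ∀ d, d ∉ C → d ∉ B → ε * c ≤ ∑ a ∈ C, p2 s(d, a) := by
    intro d hd hdB
    have : c * N ≤ wtt β d C := by
      rw [hB, Finset.mem_compl, not_not] at hdB
      simp only [reg, Finset.mem_filter, Finset.mem_univ, true_and] at hdB
      exact hdB.resolve_left hd
    calc ε * c = ε / N * (c * N) := by field_simp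
      _ ≤ ε / N * wtt β d C := by gcongr
      _ = ∑ s ∈ C, ε * (β d s / N) := by
          unfold wtt; rw [Finset.mul_sum]; exact Finset.sum_congr rfl fun s _ => by ring
      _ ≤ _ := Finset.sum_le_sum fun s _ => hp2 d s
  set h : (Sym2 V → Bool) → ℝ := fun ω1 =>
    Ex p2 (fun ω2 => g (clu (fun e => ω1 e || ω2 e) {v} (Cᶜ \ {v}))) with hh
  have step1 : Ex p1 (fun ω1 => ({ω | IsComp ω C}.indicator (fun _ => (1:ℝ)) ω1) *
      Pr p2 {ω2 | BadCv ω1 ω2 L C v}) ≤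
      Ex p1 (fun ω1 => ({ω | IsComp ω C}.indicator (fun _ => (1:ℝ)) ω1) * h ω1) := by
    refine Ex_mono h10 h11 fun ω1 => mul_le_mul_of_nonneg_left ?_
      (Set.indicator_nonneg (fun _ _ => zero_le_one) _)
    exact inner_bound p2 h20 h21 C B L (ε * c) hσ hBC ω1 v hv g hgD hg0
  have hdep : DepOn {e : Sym2 V | ∃ a ∈ C, a ∈ e}ᶜ h := by
    intro ω ω' hω
    simp only [hh]
    congr 1; funext ω2; congr 1
    refine clu_dep {v} (Cᶜ \ {v}) {e : Sym2 V | ∃ a ∈ C, a ∈ e}ᶜ ?_ _ _ fun e he => by rw [hω e he]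
    intro a ha b hb
    simp only [Set.mem_compl_iff, Set.mem_ofPred_eq, not_exists, not_and, Sym2.mem_iff, not_or]
    intro x hx
    simp only [Finset.mem_union, Finset.mem_singleton, Finset.mem_sdiff, Finset.mem_compl] at ha hb
    refine ⟨?_, ?_⟩
    · rintro rfl
      rcases ha with rfl | h
      · exact hv hx
      · exact h.1 hx
    · rintro rfl; exact hb.1 hx
  refine step1.trans ?_
  rw [Ex_indep p1 _ _ _ (IsComp_dep C) hdep]
  refine mul_le_mul_of_nonneg_left ?_ (Pr_nonneg h10 h11 _)
  have e3 : Ex p1 h = Ex (fun e => 1 - (1 - p1 e) * (1 - p2 e))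
      (fun ω => g (clu ω {v} (Cᶜ \ {v}))) := by rw [Ex_or]
  have hp0 : ∀ e, 0 ≤ 1 - (1 - p1 e) * (1 - p2 e) := fun e => by
    nlinarith [h10 e, h11 e, h20 e, h21 e, mul_nonneg (h10 e) (sub_nonneg.2 (h21 e))]
  have hp1 : ∀ e, 1 - (1 - p1 e) * (1 - p2 e) ≤ 1 := fun e => by
    have := mul_nonneg (sub_nonneg.2 (h11 e)) (sub_nonneg.2 (h21 e)); linarith
  rw [e3]
  simp only [hg]
  rw [Ex_add, Ex_const, Ex_mul_left]
  have he2 : 1 ≤ Real.exp 2 := by rw [Real.one_le_exp_iff]; norm_num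
  have key := Ex_clu_prod (fun e => 1 - (1 - p1 e) * (1 - p2 e)) hp0 hp1 x y hx0
    (fun w => by simp only [hy]; split_ifs; exacts [he2, le_rfl]) Cᶜ ?_ _ {v} (Cᶜ \ {v})
    (by
      intro w hw
      simp only [Finset.mem_union, Finset.mem_singleton, Finset.mem_sdiff, Finset.mem_compl] at hw ⊢
      rcases hw with rfl | hw
      · exact hv
      · exact hw.1)
    (by simp) rfl
  · rw [Finset.prod_singleton] at key
    have hyv : y v ≤ Real.exp 2 := by simp only [hy]; split_ifs; exacts [le_rfl, he2]
    have : Real.exp (2 - L / 2) = Real.exp (-(L / 2)) * Real.exp 2 := by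
      rw [← Real.exp_add]; congr 1; ring
    rw [this]
    gcongr
    exact key.trans hyv
  · intro u hu
    have h1 : ∏ w ∈ Cᶜ, (1 + (1 - (1 - p1 s(u, w)) * (1 - p2 s(u, w))) * (y w - 1)) ≤ Real.exp 1 := by
      calc ∏ w ∈ Cᶜ, (1 + (1 - (1 - p1 s(u, w)) * (1 - p2 s(u, w))) * (y w - 1))
          ≤ ∏ w ∈ Cᶜ, Real.exp (if w ∈ B then b / N * (Real.exp 2 - 1) else 0) := by
            refine Finset.prod_le_prod (fun w _ => ?_) fun w _ => ?_
            · have : 0 ≤ y w - 1 := by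
                simp only [hy]; split_ifs
                · linarith
                · simp
              have := mul_nonneg (hp0 s(u, w)) this
              linarith
            · simp only [hy]
              split_ifs with h
              · have h2 := Real.add_one_le_exp (b / N * (Real.exp 2 - 1))
                have h3 := mul_le_mul_of_nonneg_right (hpb s(u, w)) (sub_nonneg.2 he2)
                linarith
              · simp
        _ = Real.exp (∑ w ∈ Cᶜ, if w ∈ B then b / N * (Real.exp 2 - 1) else 0) := by
            rw [Real.exp_sum]
        _ ≤ _ := by
            rw [Real.exp_le_exp, ← Finset.sum_filter, Finset.sum_const, nsmul_eq_mul]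
            have h4 : ((Cᶜ.filter (fun w => w ∈ B)).card : ℝ) ≤ δ * N := by
              refine le_trans ?_ hC
              exact_mod_cast Finset.card_le_card fun w hw => (Finset.mem_filter.1 hw).2
            calc _ ≤ δ * N * (b / N * (Real.exp 2 - 1)) := by
                  have : 0 ≤ Real.exp 2 - 1 := by linarith
                  gcongr
              _ = b * δ * (Real.exp 2 - 1) := by field_simp
              _ ≤ 1 := hδ
    refine (mul_le_mul_of_nonneg_left h1 (hx0 u)).trans ?_
    simp only [hx, hy]
    split_ifs
    · rw [← Real.exp_add]; norm_num
    · rw [← Real.exp_add]; norm_num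

def Bad (β : V → V → ℝ) (c δ L : ℝ) (ω1 ω2 : Sym2 V → Bool) : Prop :=
  ∃ C : Finset V, ∃ v : V, IsComp ω1 C ∧ (((reg β c C)ᶜ).card : ℝ) ≤ δ * Fintype.card V ∧ v ∉ C ∧
    BadCv ω1 ω2 L C v

lemma bad_bound (β : V → V → ℝ) (b : ℝ) (hb : 0 < b) (p1 p2 : Sym2 V → ℝ)
    (h10 : ∀ e, 0 ≤ p1 e) (h11 : ∀ e, p1 e ≤ 1) (h20 : ∀ e, 0 ≤ p2 e) (h21 : ∀ e, p2 e ≤ 1)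
    (hN : 0 < (Fintype.card V : ℝ))
    (hpb : ∀ e, 1 - (1 - p1 e) * (1 - p2 e) ≤ b / Fintype.card V)
    (ε c δ L : ℝ) (hε : 0 ≤ ε) (hc : 0 ≤ c) (hδ0 : 0 ≤ δ) (hL : 0 ≤ L)
    (hδ : b * δ * (Real.exp 2 - 1) ≤ 1)
    (hp2 : ∀ i j, ε * (β i j / Fintype.card V) ≤ p2 s(i, j)) :
    Ex p1 (fun ω1 => Pr p2 {ω2 | Bad β c δ L ω1 ω2}) ≤
      (Fintype.card V : ℝ) ^ 2 * (Real.exp (-(ε * c * L / 4)) + Real.exp (2 - L / 2)) := by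
  classical
  set K := Real.exp (-(ε * c * L / 4)) + Real.exp (2 - L / 2) with hK
  have hK0 : 0 ≤ K := by positivity
  set P : Finset (Finset V × V) := Finset.univ.filter fun x =>
    (((reg β c x.1)ᶜ).card : ℝ) ≤ δ * Fintype.card V ∧ x.2 ∉ x.1 with hP
  have e1 : ∀ ω1, Pr p2 {ω2 | Bad β c δ L ω1 ω2} ≤ ∑ x ∈ P,
      ({ω | IsComp ω x.1}.indicator (fun _ => (1:ℝ)) ω1) * Pr p2 {ω2 | BadCv ω1 ω2 L x.1 x.2} := by
    intro ω1
    refine (Pr_mono h20 h21 (B := {ω2 | ∃ x ∈ P, ω2 ∈ {ω2 | IsComp ω1 x.1 ∧ BadCv ω1 ω2 L x.1 x.2}})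
      ?_).trans ((Pr_exists_le P h20 h21 _).trans (Finset.sum_le_sum fun x hx => ?_))
    · rintro ω2 ⟨C, v, h1, h2, h3, h4⟩
      exact ⟨(C, v), by simp [hP, h2, h3], h1, h4⟩
    · by_cases h : IsComp ω1 x.1
      · rw [Set.indicator_of_mem (s := {ω | IsComp ω x.1}) h, one_mul]
        exact Pr_mono h20 h21 fun ω h => h.2
      · rw [Set.indicator_of_notMem (s := {ω | IsComp ω x.1}) h, zero_mul]
        have : {ω2 | IsComp ω1 x.1 ∧ BadCv ω1 ω2 L x.1 x.2} = ∅ := by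
          rw [Set.eq_empty_iff_forall_notMem]; intro ω2 h'; exact h h'.1
        rw [this, Pr_empty]
  refine (Ex_mono h10 h11 e1).trans ?_
  rw [Ex_sum]
  calc _ ≤ ∑ x ∈ P, Pr p1 {ω | IsComp ω x.1} * K := by
        refine Finset.sum_le_sum fun x hx => ?_
        simp only [hP, Finset.mem_filter, Finset.mem_univ, true_and] at hx
        exact badC β b hb p1 p2 h10 h11 h20 h21 hN hpb ε c δ L hε hc hδ0 hL hδ hp2 x.1 hx.1 x.2 hx.2
    _ ≤ ∑ x : Finset V × V, Pr p1 {ω | IsComp ω x.1} * K :=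
        Finset.sum_le_sum_of_subset_of_nonneg (Finset.filter_subset _ _) fun x _ _ =>
          mul_nonneg (Pr_nonneg h10 h11 _) hK0
    _ = (Fintype.card V : ℝ) * (∑ C : Finset V, Pr p1 {ω | IsComp ω C}) * K := by
        rw [Fintype.sum_prod_type]
        simp only [Finset.sum_const, Finset.card_univ, nsmul_eq_mul]
        rw [← Finset.mul_sum, ← Finset.sum_mul]; ring
    _ ≤ (Fintype.card V : ℝ) * (Fintype.card V) * K := by
        gcongr; exact sum_IsComp p1 h10 h11
    _ = _ := by ring

lemma clu_symm (ω : Sym2 V → Bool) {v w : V} (h : w ∈ clu ω {v} Finset.univ) :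
    v ∈ clu ω {w} Finset.univ := by
  have trans' : ∀ a b, b ∈ clu ω {a} Finset.univ → ∀ c, c ∈ clu ω {b} Finset.univ →
      c ∈ clu ω {a} Finset.univ := fun a b hb =>
    clu_induction (P := fun c => c ∈ clu ω {a} Finset.univ)
      (fun u hu => by rw [Finset.mem_singleton] at hu; exact hu ▸ hb)
      fun _ _ _ ha hb h => clu_step ha hb h
  refine clu_induction (P := fun w => v ∈ clu ω {w} Finset.univ) (fun u hu => ?_)
    (fun a b _ ha hb hab => ?_) w h
  · rw [Finset.mem_singleton] at hu; subst hu; exact subset_clu _ _ _ (by simp)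
  · refine trans' b a ?_ v ha
    refine clu_step (subset_clu _ _ _ (Finset.mem_singleton_self b)) (Finset.mem_univ _) ?_
    rw [Sym2.eq_swap]; exact hab

lemma clu_trans (ω : Sym2 V → Bool) {a b c : V} (hb : b ∈ clu ω {a} Finset.univ)
    (hc : c ∈ clu ω {b} Finset.univ) : c ∈ clu ω {a} Finset.univ :=
  clu_induction (P := fun c => c ∈ clu ω {a} Finset.univ)
      (fun u hu => by rw [Finset.mem_singleton] at hu; exact hu ▸ hb)
      (fun _ _ _ ha hb h => clu_step ha hb h) c hc

lemma reach_iff (ω : Sym2 V → Bool) (v w : V) :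
    (graphOf ω).Reachable v w ↔ w ∈ clu ω {v} Finset.univ := by
  constructor
  · rintro ⟨p⟩
    induction p with
    | nil => exact subset_clu _ _ _ (by simp)
    | cons h p ih =>
      refine clu_trans ω ?_ ih
      refine clu_step (subset_clu _ _ _ (Finset.mem_singleton_self _)) (Finset.mem_univ _) ?_
      rw [graphOf, SimpleGraph.fromRel_adj] at h
      rcases h.2 with h | h
      · exact h
      · rw [Sym2.eq_swap]; exact h
  · intro h
    refine clu_induction (P := fun w => (graphOf ω).Reachable v w) (fun u hu => ?_)
      (fun a b _ ha hb hab => ?_) w h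
    · rw [Finset.mem_singleton] at hu; subst hu; exact SimpleGraph.Reachable.refl _
    · by_cases hne : a = b
      · exact hne ▸ ha
      · refine ha.trans (SimpleGraph.Adj.reachable ?_)
        rw [graphOf, SimpleGraph.fromRel_adj]
        exact ⟨hne, Or.inl hab⟩

lemma compSize_eq (ω : Sym2 V → Bool) (v : V) :
    compSize (graphOf ω) v = (clu ω {v} Finset.univ).card := by
  unfold compSize
  rw [← Set.ncard_coe_finset]
  congr 1; ext w; simp [reach_iff]

lemma det_end (β : V → V → ℝ) (hβ : ∀ i j, 0 ≤ β i j) (μ c δ L : ℝ) (hL : 0 ≤ L)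
    (ω1 ω2 : Sym2 V → Bool) (hG : ω1 ∈ Good β μ c (1 - δ)) (hB : ¬ Bad β c δ L ω1 ω2) :
    (C2 (graphOf (fun e => ω1 e || ω2 e)) : ℝ) ≤ L := by
  set G : Sym2 V → Bool := fun e => ω1 e || ω2 e with hGd
  obtain ⟨v0, S, hS, -, hreg⟩ := hG
  set C := clu ω1 {v0} Finset.univ with hC
  have hCG : C ⊆ clu G {v0} Finset.univ := clu_or_left _ _ _ _
  have hregC : (((reg β c C)ᶜ).card : ℝ) ≤ δ * Fintype.card V := by
    have h1 : reg β c S ⊆ reg β c C := by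
      intro i hi
      simp only [reg, Finset.mem_filter, Finset.mem_univ, true_and] at hi ⊢
      rcases hi with hi | hi
      · exact Or.inl (hS hi)
      · exact Or.inr (hi.trans (wtt_mono β hβ i hS))
    have h2 : ((reg β c S).card : ℝ) ≤ (reg β c C).card := by exact_mod_cast Finset.card_le_card h1
    have h3 : ((reg β c C)ᶜ.card : ℝ) + (reg β c C).card = Fintype.card V := by
      exact_mod_cast Finset.card_compl_add_card (reg β c C)
    linarith
  have key : ∀ v, Disjoint (clu G {v} Finset.univ) C → ((clu G {v} Finset.univ).card : ℝ) ≤ L := by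
    intro v hv
    by_contra hcon
    push Not at hcon
    apply hB
    have hvC : v ∉ C := Finset.disjoint_left.1 hv (subset_clu _ _ _ (by simp))
    have hD : clu G {v} (Cᶜ \ {v}) = clu G {v} Finset.univ := by
      refine Finset.Subset.antisymm (clu_mono G (Finset.Subset.refl _) (Finset.subset_univ _)) ?_
      intro w hw
      refine clu_induction (P := fun w => w ∈ clu G {v} (Cᶜ \ {v})) (fun u hu => subset_clu _ _ _ hu)
        (fun a b ha ha' hb hab => ?_) w hw
      by_cases hbv : b = v
      · subst hbv; exact subset_clu _ _ _ (by simp)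
      · refine clu_step ha' ?_ hab
        simp only [Finset.mem_sdiff, Finset.mem_compl, Finset.mem_singleton, hbv, not_false_eq_true,
          and_true]
        exact Finset.disjoint_left.1 hv (clu_step ha (Finset.mem_univ _) hab)
    refine ⟨C, v, ⟨v0, rfl⟩, hregC, hvC, ?_⟩
    unfold BadCv
    simp only
    rw [← hGd, hD]
    refine ⟨hcon.le, fun d hd a ha => ?_⟩
    by_contra hne
    have : a ∈ clu G {v} Finset.univ :=
      clu_step hd (Finset.mem_univ _) (by simp [hGd, Bool.eq_true_of_not_eq_false hne])
    exact Finset.disjoint_left.1 hv this ha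
  have key2 : ∀ v, ¬ Disjoint (clu G {v} Finset.univ) C → v0 ∈ clu G {v} Finset.univ := by
    intro v hv
    rw [Finset.not_disjoint_iff] at hv
    obtain ⟨w, hw, hwC⟩ := hv
    exact clu_trans G hw (clu_symm G (hCG hwC))
  have hC2 : C2 (graphOf G) ≤ ⌊L⌋₊ := by
    unfold C2
    refine csSup_le' ?_
    rintro m ⟨v, w, hvw, rfl⟩
    rw [compSize_eq, compSize_eq]
    rw [reach_iff] at hvw
    by_cases h1 : Disjoint (clu G {v} Finset.univ) C
    · exact (min_le_left _ _).trans (Nat.le_floor (key v h1))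
    · by_cases h2 : Disjoint (clu G {w} Finset.univ) C
      · exact (min_le_right _ _).trans (Nat.le_floor (key w h2))
      · exact absurd (clu_trans G (key2 v h1) (clu_symm G (key2 w h2))) hvw
  calc (C2 (graphOf G) : ℝ) ≤ (⌊L⌋₊ : ℝ) := by exact_mod_cast hC2
    _ ≤ L := Nat.floor_le hL

lemma sprinkle (β : V → V → ℝ) (hβ : ∀ i j, 0 ≤ β i j) (b : ℝ) (hb : 0 < b) (p1 p2 : Sym2 V → ℝ)
    (h10 : ∀ e, 0 ≤ p1 e) (h11 : ∀ e, p1 e ≤ 1) (h20 : ∀ e, 0 ≤ p2 e) (h21 : ∀ e, p2 e ≤ 1)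
    (hN : 0 < (Fintype.card V : ℝ))
    (hpb : ∀ e, 1 - (1 - p1 e) * (1 - p2 e) ≤ b / Fintype.card V)
    (ε μ c δ L : ℝ) (hε : 0 ≤ ε) (hc : 0 ≤ c) (hδ0 : 0 ≤ δ) (hL : 0 ≤ L)
    (hδ : b * δ * (Real.exp 2 - 1) ≤ 1)
    (hp2 : ∀ i j, ε * (β i j / Fintype.card V) ≤ p2 s(i, j)) :
    Pr (fun e => 1 - (1 - p1 e) * (1 - p2 e)) {ω | (C2 (graphOf ω) : ℝ) ≤ L}ᶜ ≤
      Pr p1 (Good β μ c (1 - δ))ᶜ +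
      (Fintype.card V : ℝ) ^ 2 * (Real.exp (-(ε * c * L / 4)) + Real.exp (2 - L / 2)) := by
  have e1 : Pr (fun e => 1 - (1 - p1 e) * (1 - p2 e)) {ω | (C2 (graphOf ω) : ℝ) ≤ L}ᶜ =
      Ex p1 (fun ω => Pr p2 {η | (fun e => ω e || η e) ∈ {ω : Sym2 V → Bool | (C2 (graphOf ω) : ℝ) ≤ L}ᶜ}) := by
    unfold Pr; rw [Ex_or]; rfl
  rw [e1]
  refine le_trans ?_ (add_le_add_right (bad_bound β b hb p1 p2 h10 h11 h20 h21 hN hpb ε c δ L hε hc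
    hδ0 hL hδ hp2) _)
  unfold Pr
  rw [← Ex_add]
  refine Ex_mono h10 h11 fun ω1 => ?_
  by_cases h : ω1 ∈ Good β μ c (1 - δ)
  · have hn : ω1 ∉ (Good β μ c (1 - δ))ᶜ := fun h' => h' h
    rw [Set.indicator_of_notMem hn, zero_add]
    refine Pr_mono h20 h21 fun ω2 h2 => ?_
    by_contra hcon
    exact h2 (det_end β hβ μ c δ L hL ω1 ω2 h hcon)
  · rw [Set.indicator_of_mem (show ω1 ∈ (Good β μ c (1 - δ))ᶜ from h)]
    have h3 := Pr_le_one h20 h21 {η | (fun e => ω1 e || η e) ∈ {ω : Sym2 V → Bool | (C2 (graphOf ω) : ℝ) ≤ L}ᶜ}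
    have h4 := Pr_nonneg h20 h21 {ω2 | Bad β c δ L ω1 ω2}
    unfold Pr at h3 h4
    linarith

end Spr
end PercAux

namespace PercAux
open Percolation
section Spec
variable {V : Type} [Fintype V] [DecidableEq V]

def qf (M : V → V → ℝ) (u : V → ℝ) : ℝ := ∑ i, ∑ j, M i j * (u i * u j)

def ns (u : V → ℝ) : ℝ := ∑ i, u i ^ 2

lemma ns_nonneg (u : V → ℝ) : 0 ≤ ns u := Finset.sum_nonneg fun i _ => sq_nonneg _

lemma qf_smul (M : V → V → ℝ) (u : V → ℝ) (t : ℝ) : qf M (fun i => t * u i) = t ^ 2 * qf M u := by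
  unfold qf; rw [Finset.mul_sum]
  refine Finset.sum_congr rfl fun i _ => ?_
  rw [Finset.mul_sum]; exact Finset.sum_congr rfl fun j _ => by ring

lemma ns_smul (u : V → ℝ) (t : ℝ) : ns (fun i => t * u i) = t ^ 2 * ns u := by
  unfold ns; rw [Finset.mul_sum]; exact Finset.sum_congr rfl fun j _ => by ring

lemma ns_eq_zero {u : V → ℝ} (h : ns u = 0) : u = 0 := by
  funext i
  have := (Finset.sum_eq_zero_iff_of_nonneg (fun i _ => sq_nonneg (u i))).1 h i (Finset.mem_univ i)
  simpa using this

lemma qf_pert (M : V → V → ℝ) (hs : ∀ i j, M i j = M j i) (u : V → ℝ) (k : V) (t : ℝ) :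
    qf M (fun i => u i + if i = k then t else 0) =
      qf M u + 2 * t * (∑ j, M k j * u j) + t ^ 2 * M k k := by
  unfold qf
  have : ∀ i j, M i j * ((u i + if i = k then t else 0) * (u j + if j = k then t else 0)) =
      M i j * (u i * u j) + (if i = k then t * (M i j * u j) else 0) +
      (if j = k then t * (M i j * u i) else 0) + (if i = k then if j = k then t ^ 2 * M i j else 0 else 0) := by
    intro i j; split_ifs <;> ring
  simp only [this, Finset.sum_add_distrib]
  have e1 : ∑ i, ∑ j, (if i = k then t * (M i j * u j) else 0) = t * ∑ j, M k j * u j := by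
    rw [Finset.sum_comm]; simp [Finset.mul_sum]
  have e2 : ∑ i, ∑ j, (if j = k then t * (M i j * u i) else 0) = t * ∑ j, M k j * u j := by
    simp [Finset.mul_sum]
    exact Finset.sum_congr rfl fun i _ => by rw [hs i k]
  have e3 : ∑ i, ∑ j, (if i = k then if j = k then t ^ 2 * M i j else 0 else 0) = t ^ 2 * M k k := by
    rw [Finset.sum_eq_single k]
    · simp
    · intro i _ hi; simp [hi]
    · simp
  rw [e1, e2, e3]; ring

lemma ns_pert (u : V → ℝ) (k : V) (t : ℝ) :
    ns (fun i => u i + if i = k then t else 0) = ns u + 2 * t * u k + t ^ 2 := by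
  unfold ns
  have : ∀ i, (u i + if i = k then t else 0) ^ 2 = u i ^ 2 +
     (if i = k then 2 * t * u i + t ^ 2 else 0) := by intro i; split_ifs <;> ring
  simp only [this, Finset.sum_add_distrib]
  simp; ring

/-- top Rayleigh quotient on H -/
lemma top_exists (M : V → V → ℝ) (h0 : ∀ i j, 0 ≤ M i j) (H : Finset V) (hH : H.Nonempty) :
    ∃ u : V → ℝ, (∀ i, 0 ≤ u i) ∧ (∀ i, i ∉ H → u i = 0) ∧ ns u = 1 ∧
      ∀ w : V → ℝ, (∀ i, i ∉ H → w i = 0) → qf M w ≤ qf M u * ns w := by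
  set K : Set (V → ℝ) := {u | (∀ i, i ∉ H → u i = 0) ∧ ns u = 1} with hK
  have hcomp : IsCompact K := by
    rw [Metric.isCompact_iff_isClosed_bounded]
    constructor
    · rw [hK]
      refine IsClosed.inter ?_ ?_
      · have : {u : V → ℝ | ∀ i, i ∉ H → u i = 0} = ⋂ i, ⋂ (_ : i ∉ H), {u : V → ℝ | u i = 0} := by
          ext u; simp
        change IsClosed {u : V → ℝ | ∀ i, i ∉ H → u i = 0}
        rw [this]
        exact isClosed_iInter fun i => isClosed_iInter fun _ =>
          isClosed_eq (continuous_apply i) continuous_const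
      · exact isClosed_eq (by unfold ns; fun_prop) continuous_const
    · refine (Metric.isBounded_closedBall (x := (0 : V → ℝ)) (r := 1)).subset ?_
      intro u hu
      rw [mem_closedBall_zero_iff, pi_norm_le_iff_of_nonneg zero_le_one]
      intro i
      rw [Real.norm_eq_abs, ← sq_le_one_iff_abs_le_one]
      rw [← hu.2]
      exact Finset.single_le_sum (f := fun i => u i ^ 2) (fun i _ => sq_nonneg _) (Finset.mem_univ i)
  have hne : K.Nonempty := by
    obtain ⟨k, hk⟩ := hH
    refine ⟨fun i => if i = k then 1 else 0, ?_, ?_⟩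
    · intro i hi
      have : i ≠ k := by rintro rfl; exact hi hk
      simp [this]
    · simp [ns]
  obtain ⟨u, huK, humax⟩ := hcomp.exists_isMaxOn hne (f := qf M) (by unfold qf; fun_prop)
  have habs : qf M u ≤ qf M (fun i => |u i|) := by
    refine Finset.sum_le_sum fun i _ => Finset.sum_le_sum fun j _ => ?_
    refine mul_le_mul_of_nonneg_left ?_ (h0 i j)
    rw [← abs_mul]; exact le_abs_self _
  refine ⟨fun i => |u i|, fun i => abs_nonneg _, fun i hi => by simp [huK.1 i hi], ?_, ?_⟩
  · have := huK.2; unfold ns at this ⊢; simpa using this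
  · intro w hw
    refine le_trans ?_ (mul_le_mul_of_nonneg_right habs (ns_nonneg w))
    by_cases hz : ns w = 0
    · rw [ns_eq_zero hz]; simp [qf, ns]
    · have hpos : 0 < ns w := lt_of_le_of_ne (ns_nonneg w) (Ne.symm hz)
      set s := (Real.sqrt (ns w))⁻¹ with hs
      have hs2 : s ^ 2 = (ns w)⁻¹ := by rw [hs, inv_pow, Real.sq_sqrt hpos.le]
      have := humax (a := fun i => s * w i) ⟨fun i hi => by simp [hw i hi], by
        rw [ns_smul, hs2]; field_simp⟩
      simp only [Set.mem_ofPred_eq] at this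
      rw [qf_smul, hs2] at this
      rw [inv_mul_le_iff₀ hpos] at this
      linarith

set_option maxHeartbeats 1000000 in
lemma spectral (M : V → V → ℝ) (hs : ∀ i j, M i j = M j i) (h0 : ∀ i j, 0 ≤ M i j)
    (hd : ∀ i, M i i = 0) (b : ℝ) (hb : 0 < b) (hN : 0 < (Fintype.card V : ℝ))
    (hMb : ∀ i j, M i j ≤ b / Fintype.card V) (l κ : ℝ) (hκ : 0 < κ) (hl : κ < l)
    (u0 : V → ℝ) (hu0 : l * ns u0 < qf M u0) :
    ∃ H : Finset V, H.Nonempty ∧ ∃ f : V → ℝ, (∀ i ∈ H, Real.sqrt (κ / (b + κ)) ≤ f i) ∧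
      (∀ i ∈ H, f i ≤ b / (l - κ)) ∧ ∀ i ∈ H, (l - κ) * f i ≤ ∑ j ∈ H, M i j * f j := by
  classical
  set N : ℝ := (Fintype.card V : ℝ) with hNd
  choose! U hU1 hU2 hU3 hU4 using top_exists M h0
  have hVne : (Finset.univ : Finset V).Nonempty := by
    rw [Finset.univ_nonempty_iff, ← Fintype.card_pos_iff]; rw [hNd] at hN; exact_mod_cast hN
  obtain ⟨H, hH, hmax⟩ := Finset.exists_max_image (Finset.univ.filter fun H : Finset V => H.Nonempty)
    (fun H => qf M (U H) - κ * H.card / N) ⟨Finset.univ, by simpa using hVne⟩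
  simp only [Finset.mem_filter, Finset.mem_univ, true_and] at hH hmax
  set u := U H with hu
  set L := qf M u with hL
  have hu1 := hU1 H hH
  rw [← hu] at hu1
  have hu2 := hU2 H hH
  rw [← hu] at hu2
  have hu3 := hU3 H hH
  rw [← hu] at hu3
  have hu4 := hU4 H hH
  rw [← hu] at hu4
  have hLl : l - κ ≤ L := by
    have h1 := hmax Finset.univ hVne
    have h2 := hU4 Finset.univ hVne u0 (by simp)
    have h3 : l ≤ qf M (U Finset.univ) := by
      by_contra hcon
      push Not at hcon
      have := mul_le_mul_of_nonneg_right hcon.le (ns_nonneg u0)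
      linarith
    have h4 : κ * ((Finset.univ : Finset V).card : ℝ) / N = κ := by
      rw [Finset.card_univ, ← hNd]; field_simp
    rw [h4] at h1
    have h5 : 0 ≤ κ * H.card / N := by positivity
    linarith
  have hL0 : 0 < L := by linarith
  have heig : ∀ i ∈ H, ∑ j, M i j * u j = L * u i := by
    intro k hk
    set a := (∑ j, M k j * u j) - L * u k with ha
    have h1 : ∀ t : ℝ, 2 * t * a ≤ t ^ 2 * L := by
      intro t
      have := hu4 (fun i => u i + if i = k then t else 0) (fun i hi => by
        rw [hu2 i hi, if_neg]; simp; rintro rfl; exact hi hk)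
      rw [qf_pert M hs, ns_pert, hu3, hd] at this
      rw [ha]; nlinarith
    have h2 := h1 (a / L)
    have e1 : 2 * (a / L) * a = 2 * (a ^ 2 / L) := by ring
    have e2 : (a / L) ^ 2 * L = a ^ 2 / L := by field_simp
    rw [e1, e2] at h2
    have h3 : a ^ 2 / L ≤ 0 := by linarith
    have h4 : a ^ 2 ≤ 0 := by
      rw [div_le_iff₀ hL0] at h3; linarith
    have : a = 0 := by nlinarith
    linarith
  have hLb : L ≤ b := by
    have hsum : (∑ i, u i) ^ 2 ≤ N := by
      have := sq_sum_le_card_mul_sum_sq (s := (Finset.univ : Finset V)) (f := u)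
      rw [Finset.card_univ] at this
      change _ ≤ N * ns u at this
      rw [hu3] at this; linarith
    calc L ≤ ∑ i, ∑ j, b / N * (u i * u j) := Finset.sum_le_sum fun i _ => Finset.sum_le_sum fun j _ =>
          mul_le_mul_of_nonneg_right (hMb i j) (mul_nonneg (hu1 i) (hu1 j))
      _ = b / N * (∑ i, u i) ^ 2 := by
          rw [sq, Finset.sum_mul_sum, Finset.mul_sum]
          exact Finset.sum_congr rfl fun i _ => by rw [Finset.mul_sum]
      _ ≤ b / N * N := by gcongr
      _ = b := by field_simp
  have hlow : ∀ i ∈ H, κ / (N * (b + κ)) ≤ u i ^ 2 := by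
    intro k hk
    have h1 := qf_pert M hs u k (-u k)
    have h2 := ns_pert u k (-u k)
    rw [hd, heig k hk] at h1
    rw [hu3] at h2
    set w : V → ℝ := fun i => u i + if i = k then -u k else 0 with hw
    have hwk : ∀ i, i ∉ H.erase k → w i = 0 := by
      intro i hi
      by_cases hik : i = k
      · simp [hw, hik]
      · simp only [hw, if_neg hik, add_zero]
        exact hu2 i fun h => hi (Finset.mem_erase.2 ⟨hik, h⟩)
    have hne : (H.erase k).Nonempty := by
      rw [Finset.nonempty_iff_ne_empty]
      intro hemp
      have hw0 : w = 0 := by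
        funext i; exact hwk i (by rw [hemp]; simp)
      rw [hw0] at h1 h2
      have q0 : qf M (0 : V → ℝ) = 0 := by simp [qf]
      have n0 : ns (0 : V → ℝ) = 0 := by simp [ns]
      rw [q0] at h1; rw [n0] at h2
      nlinarith
    have h3 := hmax _ hne
    have h4 := hU4 _ hne w hwk
    rw [Finset.card_erase_of_mem hk, Nat.cast_sub (Finset.card_pos.2 hH)] at h3
    have h5 : qf M (U (H.erase k)) ≤ L - κ / N := by
      have : κ * (((H.card : ℝ)) - (1:ℕ)) / N = κ * H.card / N - κ / N := by push_cast; ring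
      rw [this] at h3; linarith
    have h6 : qf M w ≤ (L - κ / N) * ns w := h4.trans (mul_le_mul_of_nonneg_right h5 (ns_nonneg w))
    rw [h1, h2] at h6
    have hκN : 0 < κ / N := by positivity
    have h7 : κ / N ≤ u k ^ 2 * (L + κ / N) := by nlinarith
    have hN1 : 1 ≤ N := by
      rw [hNd]; exact_mod_cast Finset.card_pos.2 hVne
    have h8 : κ / N ≤ κ := by rw [div_le_iff₀ hN]; nlinarith
    have h9 : κ / N ≤ u k ^ 2 * (b + κ) := h7.trans (by gcongr)
    rw [show κ / (N * (b + κ)) = κ / N / (b + κ) by field_simp, div_le_iff₀ (by positivity)]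
    exact h9
  have hsq : 0 < Real.sqrt N := Real.sqrt_pos.2 hN
  refine ⟨H, hH, fun i => Real.sqrt N * u i, ?_, ?_, ?_⟩
  · intro i hi
    apply Real.sqrt_le_iff.2
    refine ⟨mul_nonneg hsq.le (hu1 i), ?_⟩
    rw [mul_pow, Real.sq_sqrt hN.le]
    have := mul_le_mul_of_nonneg_left (hlow i hi) hN.le
    refine le_trans (le_of_eq ?_) this
    field_simp
  · intro i hi
    have hlk : 0 < l - κ := by linarith
    rw [le_div_iff₀ hlk]
    have hsum : ∑ j, u j ≤ Real.sqrt N := by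
      apply Real.le_sqrt_of_sq_le
      have := sq_sum_le_card_mul_sum_sq (s := (Finset.univ : Finset V)) (f := u)
      rw [Finset.card_univ] at this
      change _ ≤ N * ns u at this
      rw [hu3] at this; linarith
    have h1 : L * u i ≤ b / N * Real.sqrt N := by
      rw [← heig i hi]
      calc ∑ j, M i j * u j ≤ ∑ j, b / N * u j := Finset.sum_le_sum fun j _ =>
            mul_le_mul_of_nonneg_right (hMb i j) (hu1 j)
        _ = b / N * ∑ j, u j := by rw [Finset.mul_sum]
        _ ≤ _ := by gcongr
    calc Real.sqrt N * u i * (l - κ) ≤ Real.sqrt N * u i * L := by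
          have := hu1 i; gcongr
      _ = Real.sqrt N * (L * u i) := by ring
      _ ≤ Real.sqrt N * (b / N * Real.sqrt N) := by gcongr
      _ = b / N * (Real.sqrt N * Real.sqrt N) := by ring
      _ = b := by rw [Real.mul_self_sqrt hN.le]; field_simp
  · intro i hi
    have e : ∑ j ∈ H, M i j * (Real.sqrt N * u j) = Real.sqrt N * (L * u i) := by
      rw [← heig i hi, Finset.mul_sum]
      rw [← Finset.sum_subset (Finset.subset_univ H)]
      · exact Finset.sum_congr rfl fun j _ => by ring
      · intro j _ hj; rw [hu2 j hj]; ring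
    rw [e]
    have := hu1 i
    calc (l - κ) * (Real.sqrt N * u i) ≤ L * (Real.sqrt N * u i) := by gcongr
      _ = _ := by ring

/-- powers of the matrix -/
lemma qf_exists (M : V → V → ℝ) (hs : ∀ i j, M i j = M j i) (h0 : ∀ i j, 0 ≤ M i j) (l : ℝ)
    (hl : 0 ≤ l) (h : ∀ u, qf M u ≤ l * ns u) (u : V → ℝ) :
    ns (fun i => ∑ j, M i j * u j) ≤ l ^ 2 * ns u := by
  have hneg : ∀ u, -(l * ns u) ≤ qf M u := by
    intro u
    have h1 : -qf M u ≤ qf M (fun i => |u i|) := by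
      unfold qf; rw [← Finset.sum_neg_distrib]
      refine Finset.sum_le_sum fun i _ => ?_
      rw [← Finset.sum_neg_distrib]
      refine Finset.sum_le_sum fun j _ => ?_
      rw [← mul_neg]
      refine mul_le_mul_of_nonneg_left ?_ (h0 i j)
      rw [← abs_mul]; exact neg_le_abs _
    have h2 := h (fun i => |u i|)
    have h3 : ns (fun i => |u i|) = ns u := by simp [ns]
    rw [h3] at h2; linarith
  set v : V → ℝ := fun i => ∑ j, M i j * u j with hv
  -- polarization
  have hpol : ∀ t : ℝ, 4 * t * ns v ≤ l * (2 * ns u + 2 * t ^ 2 * ns v) := by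
    intro t
    have h1 := h (fun i => u i + t * v i)
    have h2 := hneg (fun i => u i - t * v i)
    have e1 : ns (fun i => u i + t * v i) + ns (fun i => u i - t * v i) =
        2 * ns u + 2 * t ^ 2 * ns v := by
      unfold ns; rw [← Finset.sum_add_distrib, Finset.mul_sum, Finset.mul_sum, ← Finset.sum_add_distrib]
      exact Finset.sum_congr rfl fun i _ => by ring
    have e2 : qf M (fun i => u i + t * v i) - qf M (fun i => u i - t * v i) = 4 * t * ns v := by
      have e3 : ns v = ∑ i, ∑ j, M i j * (v i * u j) := by
        unfold ns
        refine Finset.sum_congr rfl fun i _ => ?_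
        rw [sq]; nth_rewrite 2 [hv]; simp only; rw [Finset.mul_sum]
        exact Finset.sum_congr rfl fun j _ => by ring
      have e4 : ns v = ∑ i, ∑ j, M i j * (u i * v j) := by
        rw [e3, Finset.sum_comm]
        refine Finset.sum_congr rfl fun i _ => Finset.sum_congr rfl fun j _ => ?_
        rw [hs j i]; ring
      have e5 : 4 * t * ns v = 2 * t * ns v + 2 * t * ns v := by ring
      rw [e5]; nth_rewrite 1 [e3]; rw [e4]
      unfold qf
      simp only [Finset.mul_sum, ← Finset.sum_add_distrib, ← Finset.sum_sub_distrib]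
      exact Finset.sum_congr rfl fun i _ => Finset.sum_congr rfl fun j _ => by ring
    nlinarith
  rcases hl.eq_or_lt with rfl | hlpos
  · have := hpol 1; nlinarith [ns_nonneg v, ns_nonneg u]
  · have h1 := hpol (1 / l)
    have e : l * (2 * ns u + 2 * (1 / l) ^ 2 * ns v) = 2 * l * ns u + 2 * (1 / l) * ns v := by
      field_simp
    rw [e] at h1
    have h2 : 1 / l * ns v ≤ l * ns u := by linarith
    rw [one_div, inv_mul_le_iff₀ hlpos] at h2
    nlinarith

end Spec
end PercAux

namespace PercAux
open Percolation

set_option maxHeartbeats 2000000 in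
lemma finite_main (β : ∀ n : ℕ, Fin n → Fin n → ℝ) (b l : ℝ) (hb : 1 ≤ b)
    (hsym : ∀ n i j, β n i j = β n j i) (hnn : ∀ n i j, 0 ≤ β n i j) (hdiag : ∀ n i, β n i i = 0)
    (hβb : ∀ n i j, β n i j ≤ b) (hl : 1 < l) (hl2 : l ≤ 2)
    (H1 : ∀ᶠ n : ℕ in atTop, ∃ u : Fin n → ℝ, l * ns u < qf (fun i j => β n i j / n) u)
    (H2 : ∀ δ > 0, ∃ κ > 0, ∀ᶠ n : ℕ in atTop, Cut (β n) κ δ) :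
    ∃ A : ℝ, Tendsto (fun n : ℕ => percMeasure (β n) (1 / n)
        {ω | (C2 (graphOf ω) : ℝ) ≤ A * Real.log n}) atTop (nhds 1) := by
  have hb0 : 0 < b := by linarith
  set s := (l - 1) / 4 with hs
  have hs0 : 0 < s := by rw [hs]; linarith
  have hs1 : s ≤ 1 / 4 := by rw [hs]; linarith
  have hls : l - s = 1 + 3 * s := by rw [hs]; ring
  set τ := Real.sqrt (s / (b + s)) with hτ
  have hτ0 : 0 < τ := by rw [hτ]; positivity
  set C := max τ (b / (l - s)) with hC
  obtain ⟨μ, hμ, cg, hcg, N0, hgiant⟩ := giant b τ C s hb hτ0 (le_max_left _ _) hs0 (by linarith)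
  have he2 : 0 < Real.exp 2 - 1 := by
    have : (1:ℝ) < Real.exp 2 := by rw [Real.one_lt_exp_iff]; norm_num
    linarith
  set δ := min μ (1 / (b * (Real.exp 2 - 1))) with hδ
  have hδ0 : 0 < δ := by rw [hδ]; positivity
  have hδb : b * δ * (Real.exp 2 - 1) ≤ 1 := by
    have : δ ≤ 1 / (b * (Real.exp 2 - 1)) := min_le_right _ _
    rw [le_div_iff₀ (by positivity)] at this
    linarith
  obtain ⟨κ, hκ, hcut⟩ := H2 δ hδ0
  set k := ⌈4 * b / κ⌉₊ with hk
  have hkκ : 1 ≤ k * (κ / (4 * b)) := by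
    have h1 : 4 * b / κ ≤ k := Nat.le_ceil _
    rw [div_le_iff₀ hκ] at h1
    rw [mul_div_assoc', le_div_iff₀ (by positivity)]; linarith
  set ε := s / (k + 1) with hε
  have hε0 : 0 < ε := by positivity
  have hkε : k * ε + ε = s := by rw [hε]; field_simp
  have hε1 : ε ≤ 1 := by nlinarith [mul_nonneg (Nat.cast_nonneg (α := ℝ) k) hε0.le]
  obtain ⟨c, hc, hcκ, r, hr, hiter⟩ := grow_iter b κ δ μ ε hb0 hκ (min_le_left _ _) hε0 hε1 k
  set A := 12 / (ε * c) + 6 with hA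
  have hA0 : 0 < A := by positivity
  have hA1 : 3 ≤ ε * c * A / 4 := by
    rw [hA]
    have : ε * c * (12 / (ε * c) + 6) = 12 + 6 * (ε * c) := by field_simp
    rw [this]
    have : 0 < ε * c := by positivity
    linarith
  refine ⟨A, ?_⟩
  -- the failure bound
  set F : ℕ → ℝ := fun n => (Real.exp (-cg * n) + k * (n * Real.exp (-r * n)))
    + (1 + Real.exp 2) * (1 / (n : ℝ)) with hF
  have hFlim : Tendsto F atTop (𝓝 0) := by
    have hn : Tendsto (fun n : ℕ => (n : ℝ)) atTop atTop := tendsto_natCast_atTop_atTop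
    have t1 : Tendsto (fun n : ℕ => Real.exp (-cg * n)) atTop (𝓝 0) := by
      have := (Real.tendsto_exp_neg_atTop_nhds_zero.comp (hn.const_mul_atTop hcg))
      refine this.congr fun n => by simp
    have t2 : Tendsto (fun n : ℕ => (n : ℝ) * Real.exp (-r * n)) atTop (𝓝 0) := by
      have := (Real.tendsto_pow_mul_exp_neg_atTop_nhds_zero 1).comp (hn.const_mul_atTop hr)
      have h2 := this.const_mul (1 / r)
      rw [mul_zero] at h2
      refine h2.congr fun n => ?_
      simp only [Function.comp, pow_one]
      field_simp
    have t3 : Tendsto (fun n : ℕ => 1 / (n : ℝ)) atTop (𝓝 0) := tendsto_one_div_atTop_nhds_zero_nat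
    have := (t1.add (t2.const_mul (k : ℝ))).add (t3.const_mul (1 + Real.exp 2))
    rw [mul_zero, mul_zero, add_zero, add_zero] at this
    exact this
  have hmain : ∀ᶠ n : ℕ in atTop, 1 - F n ≤
      Pr (fun e => min (1 / (n : ℝ) * sym2Val (β n) e) 1) {ω | (C2 (graphOf ω) : ℝ) ≤ A * Real.log n} := by
    filter_upwards [H1, hcut, eventually_ge_atTop N0, eventually_gt_atTop ⌈b⌉₊,
      eventually_ge_atTop 1] with n ⟨u0, hu0⟩ hcutn hnN0 hnb hn1
    have hn0 : 0 < (n : ℝ) := by exact_mod_cast hn1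
    have hbn : b < n := lt_of_le_of_lt (Nat.le_ceil b) (by exact_mod_cast hnb)
    have hcard : (Fintype.card (Fin n) : ℝ) = n := by simp
    set p : Sym2 (Fin n) → ℝ := fun e => min (1 / (n : ℝ) * sym2Val (β n) e) 1 with hp
    have hbn1 : b / n < 1 := by rw [div_lt_one hn0]; exact hbn
    have hpv : ∀ i j, p s(i, j) = β n i j / n := by
      intro i j
      have e1 : sym2Val (β n) s(i, j) = β n i j := by
        simp only [sym2Val, Sym2.lift_mk]; rw [hsym n j i]; ring
      simp only [hp]
      rw [e1, min_eq_left]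
      · ring
      · have : β n i j / n ≤ b / n := by gcongr; exact hβb n i j
        rw [one_div_mul_eq_div]; linarith
    have hp0 : ∀ e, 0 ≤ p e := by
      intro e; induction e using Sym2.ind with
      | _ i j => rw [hpv]; have := hnn n i j; positivity
    have hpb : ∀ e, p e ≤ b / n := by
      intro e; induction e using Sym2.ind with
      | _ i j => rw [hpv]; gcongr; exact hβb n i j
    have hp1 : ∀ e, p e < 1 := fun e => (hpb e).trans_lt hbn1
    have hθ0 : 0 ≤ 1 - s := by linarith
    -- giant
    obtain ⟨H, hHne, f, hf1, hf2, hf3⟩ := spectral (fun i j => β n i j / n)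
      (fun i j => by rw [hsym n i j]) (fun i j => div_nonneg (hnn n i j) hn0.le)
      (fun i => by rw [hdiag]; simp) b hb0 (by rw [hcard]; exact hn0)
      (fun i j => by rw [hcard]; have := hβb n i j; gcongr) l s hs0 (by linarith) u0 hu0
    have hg := hgiant (Fin n) (pth p (1 - s)) (pth_nonneg p hp0 hp1 hθ0)
      (fun e => pth_le_one p hp1 e)
      (fun e => by rw [hcard]; exact (pth_le p hp0 hp1 hθ0 (by linarith) e).trans (hpb e))
      H f hHne hf1 (fun v hv => (hf2 v hv).trans (le_max_right _ _)) (by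
        intro u hu
        have h1 : ∀ w ∈ H, (1 - s) * (β n u w / n * f w) ≤ pth p (1 - s) s(u, w) * f w := by
          intro w hw
          have := pth_ge p hp0 hp1 hθ0 (by linarith) s(u, w)
          rw [hpv] at this
          have h3 := mul_le_mul_of_nonneg_right this (hτ0.le.trans (hf1 w hw))
          linarith
        have h2 := Finset.sum_le_sum h1
        rw [← Finset.mul_sum] at h2
        have h3 := mul_le_mul_of_nonneg_left (hf3 u hu) hθ0
        rw [hls] at h3
        have hfu : 0 ≤ f u := hτ0.le.trans (hf1 u hu)
        have h4 : (1 + s) * f u ≤ (1 - s) * ((1 + 3 * s) * f u) := by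
          have h5 : 1 + s ≤ (1 - s) * (1 + 3 * s) := by nlinarith
          have := mul_le_mul_of_nonneg_right h5 hfu
          linarith
        linarith) (by simpa using hnN0)
    have hgood : Pr (pth p (1 - s)) (Good (β n) μ (κ / 2) 0)ᶜ ≤ Real.exp (-cg * n) := by
      rw [hcard] at hg
      refine (Pr_mono (pth_nonneg p hp0 hp1 hθ0) (fun e => pth_le_one p hp1 e) ?_).trans hg
      intro ω hω v
      by_contra hcon
      push Not at hcon
      apply hω
      exact ⟨v, clu ω {v} Finset.univ, Finset.Subset.refl _, by rw [hcard]; exact hcon, by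
        rw [zero_mul]; positivity⟩
    have hit := hiter (Fin n) (β n) (hnn n) (hβb n) p hp0 hp1
      (fun i j => by rw [hcard, hpv]) (by rw [hcard]; exact hn0) hcutn (1 - s) _ hθ0 hgood
    rw [hcard, min_eq_right (by linarith)] at hit
    set θ := 1 - s + k * ε with hθ
    have hθε : θ + ε = 1 := by rw [hθ]; linarith
    have hθp : 0 ≤ θ := by positivity
    have hL : 0 ≤ A * Real.log n := mul_nonneg hA0.le (Real.log_natCast_nonneg n)
    have hpe : (fun e => 1 - (1 - pth p θ e) * (1 - pth p ε e)) = p := by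
      rw [← pth_add p hp1, hθε, pth_one]
    have hspr := sprinkle (β n) (hnn n) b hb0 (pth p θ) (pth p ε) (pth_nonneg p hp0 hp1 hθp)
      (fun e => pth_le_one p hp1 e) (pth_nonneg p hp0 hp1 hε0.le)
      (fun e => pth_le_one p hp1 e) (by rw [hcard]; exact hn0)
      (fun e => by rw [hcard]; exact (congrFun hpe e).le.trans (hpb e))
      ε μ c δ (A * Real.log n) hε0.le hc.le hδ0.le hL hδb
      (fun i j => by
        rw [hcard, ← hpv]; exact pth_ge p hp0 hp1 hε0.le hε1 _)
    rw [hpe, hcard, Pr_compl] at hspr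
    have hlog : Real.exp (-3 * Real.log n) = 1 / (n : ℝ) ^ 3 := by
      have : -3 * Real.log n = -(((3 : ℕ) : ℝ) * Real.log n) := by push_cast; ring
      rw [this, Real.exp_neg, Real.exp_nat_mul, Real.exp_log hn0, one_div]
    have hlog0 : 0 ≤ Real.log n := Real.log_natCast_nonneg n
    have x1 : Real.exp (-(ε * c * (A * Real.log n) / 4)) ≤ 1 / (n : ℝ) ^ 3 := by
      rw [← hlog, Real.exp_le_exp]
      have := mul_le_mul_of_nonneg_right hA1 hlog0
      linarith
    have x2 : Real.exp (2 - A * Real.log n / 2) ≤ Real.exp 2 * (1 / (n : ℝ) ^ 3) := by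
      rw [← hlog, ← Real.exp_add, Real.exp_le_exp]
      have hA2 : 6 ≤ A := by
        rw [hA]; have : 0 < 12 / (ε * c) := by positivity
        linarith
      have := mul_le_mul_of_nonneg_right hA2 hlog0
      linarith
    have x3 : (n : ℝ) ^ 2 * (Real.exp (-(ε * c * (A * Real.log n) / 4)) +
        Real.exp (2 - A * Real.log n / 2)) ≤ (1 + Real.exp 2) * (1 / (n : ℝ)) := by
      calc _ ≤ (n : ℝ) ^ 2 * (1 / (n : ℝ) ^ 3 + Real.exp 2 * (1 / (n : ℝ) ^ 3)) := by gcongr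
        _ = _ := by field_simp
    simp only [hF]
    linarith
  have hlim : Tendsto (fun n : ℕ => Pr (fun e => min (1 / (n : ℝ) * sym2Val (β n) e) 1)
      {ω | (C2 (graphOf ω) : ℝ) ≤ A * Real.log n}) atTop (𝓝 1) := by
    have h1 : Tendsto (fun n => 1 - F n) atTop (𝓝 1) := by
      simpa using hFlim.const_sub 1
    refine tendsto_of_tendsto_of_tendsto_of_le_of_le' h1 tendsto_const_nhds hmain ?_
    refine Eventually.of_forall fun n => ?_
    refine Pr_le_one (fun e => ?_) (fun e => min_le_right _ _) _
    refine le_min (mul_nonneg (by positivity) ?_) zero_le_one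
    induction e using Sym2.ind with
    | _ i j =>
      simp only [sym2Val, Sym2.lift_mk]
      have := hnn n i j; have := hnn n j i; positivity
  have := ENNReal.tendsto_ofReal hlim
  rw [ENNReal.ofReal_one] at this
  refine this.congr fun n => ?_
  rw [percMeasure_eq]
  intro e
  refine mul_nonneg (by positivity) ?_
  induction e using Sym2.ind with
  | _ i j =>
    simp only [sym2Val, Sym2.lift_mk]
    have := hnn n i j; have := hnn n j i; positivity
end PercAux

namespace PercAux
open Percolation

structure Ker {Ω : Type} [MeasurableSpace Ω] (μ : Measure Ω) (K : Ω → Ω → ℝ) (b : ℝ) : Prop where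
  meas : Measurable (Function.uncurry K)
  nn : ∀ x y, 0 ≤ K x y
  le : ∀ x y, K x y ≤ b
  sym : ∀ x y, K x y = K y x
  mass : μ.real Set.univ ≤ 1

def PP {Ω : Type} [MeasurableSpace Ω] (μ : Measure Ω) (K : Ω → Ω → ℝ) : ℕ → Ω → Ω → ℝ
  | 0 => K
  | (l + 1) => fun x y => ∫ z, PP μ K l x z * K z y ∂μ

section
variable {Ω : Type} [MeasurableSpace Ω] {μ : Measure Ω} [IsFiniteMeasure μ] {K : Ω → Ω → ℝ} {b : ℝ}

theorem PP_meas (h : Ker μ K b) (l : ℕ) : Measurable (Function.uncurry (PP μ K l)) := by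
  induction l with
  | zero => exact h.meas
  | succ l ih =>
    have : StronglyMeasurable (fun p : (Ω × Ω) × Ω => PP μ K l p.1.1 p.2 * K p.2 p.1.2) := by
      apply Measurable.stronglyMeasurable
      have h1 : Measurable (fun p : (Ω × Ω) × Ω => Function.uncurry (PP μ K l) (p.1.1, p.2)) :=
        ih.comp (by fun_prop)
      have h2 : Measurable (fun p : (Ω × Ω) × Ω => Function.uncurry K (p.2, p.1.2)) :=
        h.meas.comp (by fun_prop)
      exact h1.mul h2
    exact (this.integral_prod_right' (ν := μ)).measurable

theorem PP_nn (h : Ker μ K b) (l : ℕ) : ∀ x y, 0 ≤ PP μ K l x y := by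
  induction l with
  | zero => exact h.nn
  | succ l ih => exact fun x y => integral_nonneg fun z => mul_nonneg (ih x z) (h.nn z y)

theorem int_le_const (hm : μ.real Set.univ ≤ 1) {f : Ω → ℝ} {c : ℝ} (hc : 0 ≤ c)
    (hf : ∀ x, f x ≤ c) : ∫ x, f x ∂μ ≤ c := by
  by_cases hi : Integrable f μ
  · calc ∫ x, f x ∂μ ≤ ∫ x, c ∂μ := integral_mono hi (integrable_const c) hf
      _ = μ.real Set.univ * c := by simp
      _ ≤ 1 * c := mul_le_mul_of_nonneg_right hm hc
      _ = c := one_mul c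
  · rw [integral_undef hi]; exact hc

theorem bdd_int {f : Ω → ℝ} {c : ℝ} (hm : Measurable f) (h0 : ∀ x, 0 ≤ f x)
    (hf : ∀ x, f x ≤ c) : Integrable f μ :=
  Integrable.of_bound hm.aestronglyMeasurable c
    (Eventually.of_forall fun x => by rw [Real.norm_of_nonneg (h0 x)]; exact hf x)

theorem PP_le (h : Ker μ K b) (hb : 0 ≤ b) (l : ℕ) : ∀ x y, PP μ K l x y ≤ b ^ (l + 1) := by
  induction l with
  | zero => intro x y; simpa [PP] using h.le x y
  | succ l ih =>
    intro x y
    refine int_le_const h.mass (by positivity) fun z => ?_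
    rw [pow_succ]
    exact mul_le_mul (ih x z) (h.le z y) (h.nn z y) (by positivity)

theorem PP_comp_meas (h : Ker μ K b) (l : ℕ) {α : Type} [MeasurableSpace α] {f g : α → Ω}
    (hf : Measurable f) (hg : Measurable g) : Measurable fun a => PP μ K l (f a) (g a) :=
  (PP_meas h l).comp (hf.prodMk hg)

def DD (μ : Measure Ω) [IsFiniteMeasure μ] (K : Ω → Ω → ℝ) {V ι : Type} [Fintype V] [Fintype ι] (s t : ι → V) (l : ι → ℕ) : ℝ :=
  ∫ x : V → Ω, ∏ i, PP μ K (l i) (x (s i)) (x (t i)) ∂(Measure.pi fun _ => μ)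

theorem DD_meas (h : Ker μ K b) {V ι : Type} [Fintype V] [Fintype ι] (s t : ι → V) (l : ι → ℕ) :
    Measurable (fun x : V → Ω => ∏ i, PP μ K (l i) (x (s i)) (x (t i))) :=
  Finset.measurable_prod _ fun i _ =>
    PP_comp_meas h _ (measurable_pi_apply _) (measurable_pi_apply _)

theorem DD_int (h : Ker μ K b) (hb : 0 ≤ b) {V ι : Type} [Fintype V] [Fintype ι] (s t : ι → V) (l : ι → ℕ) :
    Integrable (fun x : V → Ω => ∏ i, PP μ K (l i) (x (s i)) (x (t i))) (Measure.pi fun _ => μ) := by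
  refine bdd_int (c := ∏ i, b ^ (l i + 1)) (DD_meas h s t l) (fun x => Finset.prod_nonneg fun i _ => PP_nn h _ _ _)
    fun x => Finset.prod_le_prod (fun i _ => PP_nn h _ _ _) fun i _ => PP_le h hb _ _ _

def sS {V ι : Type} (s : ι → V) : Option ι → Option V
  | none => none
  | some i => some (s i)
def tT {V ι : Type} [DecidableEq ι] (t : ι → V) (i0 : ι) : Option ι → Option V
  | none => some (t i0)
  | some i => if i = i0 then none else some (t i)
def lL {ι : Type} [DecidableEq ι] (l : ι → ℕ) (i0 : ι) : Option ι → ℕ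
  | none => 0
  | some i => if i = i0 then l i - 1 else l i

theorem DD_rec (h : Ker μ K b) (hb : 0 ≤ b) {V ι : Type} [Fintype V] [Fintype ι] [DecidableEq ι]
    (s t : ι → V) (l : ι → ℕ) (i0 : ι) (hl : 1 ≤ l i0) :
    DD μ K s t l = DD μ K (sS s) (tT t i0) (lL l i0) := by
  obtain ⟨k, hk⟩ : ∃ k, l i0 = k + 1 := ⟨l i0 - 1, by omega⟩
  have hI := DD_int h hb (sS s) (tT t i0) (lL l i0)
  set G : (Option V → Ω) → ℝ := fun x => ∏ i, PP μ K (lL l i0 i) (x (sS s i)) (x (tT t i0 i)) with hG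
  have mp : MeasurePreserving (MeasurableEquiv.piOptionEquivProd (fun _ : Option V => Ω)).symm
      ((Measure.pi fun _ : V => μ).prod μ) (Measure.pi fun _ : Option V => μ) :=
    ⟨MeasurableEquiv.measurable _, Measure.pi_map_piOptionEquivProd (fun _ : Option V => μ)⟩
  have e1 : DD μ K (sS s) (tT t i0) (lL l i0) = ∫ x, G x ∂(Measure.pi fun _ : Option V => μ) := rfl
  have hE : ∀ x : Option V → Ω, MeasurableEquiv.piOptionEquivProd (fun _ : Option V => Ω) x
      = (fun v => x (some v), x none) := fun x => rfl
  have hE1 : ∀ (y : V → Ω) (z : Ω) v, (MeasurableEquiv.piOptionEquivProd (fun _ : Option V => Ω)).symm (y, z) (some v) = y v := by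
    intro y z v
    have := hE ((MeasurableEquiv.piOptionEquivProd (fun _ : Option V => Ω)).symm (y, z))
    rw [MeasurableEquiv.apply_symm_apply] at this
    exact (congrFun (congrArg Prod.fst this) v).symm
  have hE2 : ∀ (y : V → Ω) (z : Ω), (MeasurableEquiv.piOptionEquivProd (fun _ : Option V => Ω)).symm (y, z) none = z := by
    intro y z
    have := hE ((MeasurableEquiv.piOptionEquivProd (fun _ : Option V => Ω)).symm (y, z))
    rw [MeasurableEquiv.apply_symm_apply] at this
    exact (congrArg Prod.snd this).symm
  have hI2 := (mp.integrable_comp_emb (MeasurableEquiv.measurableEmbedding _)).2 hI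
  rw [e1, ← mp.integral_comp (MeasurableEquiv.measurableEmbedding _)]
  rw [show (∫ x, G ((MeasurableEquiv.piOptionEquivProd (fun _ : Option V => Ω)).symm x) ∂((Measure.pi fun _ : V => μ).prod μ)) =
    ∫ y, ∫ z, G ((MeasurableEquiv.piOptionEquivProd (fun _ : Option V => Ω)).symm (y, z)) ∂μ ∂(Measure.pi fun _ : V => μ) from
    integral_prod _ hI2]
  unfold DD
  congr 1
  funext y
  rw [← Finset.mul_prod_erase _ _ (Finset.mem_univ i0), hk]
  change (∫ z, PP μ K k (y (s i0)) z * K z (y (t i0)) ∂μ) * _ = _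
  rw [← integral_mul_const]
  congr 1
  funext z
  simp only [hG]
  rw [Fintype.prod_option, ← Finset.mul_prod_erase _ _ (Finset.mem_univ i0)]
  have : ∏ i ∈ Finset.univ.erase i0, PP μ K (lL l i0 (some i))
      ((MeasurableEquiv.piOptionEquivProd (fun _ : Option V => Ω)).symm (y, z) (sS s (some i)))
      ((MeasurableEquiv.piOptionEquivProd (fun _ : Option V => Ω)).symm (y, z) (tT t i0 (some i)))
      = ∏ i ∈ Finset.univ.erase i0, PP μ K (l i) (y (s i)) (y (t i)) := by
    refine Finset.prod_congr rfl fun i hi => ?_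
    have hne := Finset.ne_of_mem_erase hi
    simp [lL, sS, tT, hne, hE1]
  rw [this]
  simp only [lL, sS, tT, if_true, hE1, hE2, hk, Nat.add_sub_cancel, PP]
  ring
end

def Adm {V ι : Type} (s t : ι → V) (l : ι → ℕ) : Prop :=
  (∀ i, s i ≠ t i) ∧ ∀ i i', i ≠ i' → s(s i, t i) = s(s i', t i') → 1 ≤ l i ∨ 1 ≤ l i'

theorem Adm_rec {V ι : Type} [DecidableEq ι] (s t : ι → V) (l : ι → ℕ) (i0 : ι)
    (h : Adm s t l) : Adm (sS s) (tT t i0) (lL l i0) := by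
  obtain ⟨h1, h2⟩ := h
  constructor
  · rintro (_ | i)
    · simp [sS, tT]
    · by_cases hi : i = i0
      · simp [sS, tT, hi]
      · simp [sS, tT, hi, h1]
  · rintro (_ | i) (_ | i') hne he
    · exact absurd rfl hne
    · by_cases hi : i' = i0
      · subst hi
        have := h1 i'
        simp [sS, tT] at he
        exact absurd he.symm this
      · simp [sS, tT, hi] at he
    · by_cases hi : i = i0
      · subst hi
        have := h1 i
        simp [sS, tT] at he
        exact absurd he this
      · simp [sS, tT, hi] at he
    · have hne2 : i ≠ i' := fun h => hne (by rw [h])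
      by_cases hi : i = i0
      · subst hi
        have : i' ≠ i := hne2.symm
        simp [sS, tT, this] at he
      · by_cases hi' : i' = i0
        · subst hi'
          simp [sS, tT, hi] at he
        · have := h2 i i' hne2 (by simpa [sS, tT, hi, hi'] using he)
          simpa [lL, hi, hi'] using this

theorem lL_sum {ι : Type} [Fintype ι] [DecidableEq ι] (l : ι → ℕ) (i0 : ι) (h : 1 ≤ l i0) :
    ∑ i, lL l i0 i + 1 = ∑ i, l i := by
  rw [Fintype.sum_option, ← Finset.add_sum_erase _ _ (Finset.mem_univ i0), ← Finset.add_sum_erase _ l (Finset.mem_univ i0)]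
  have : ∑ i ∈ Finset.univ.erase i0, lL l i0 (some i) = ∑ i ∈ Finset.univ.erase i0, l i := by
    refine Finset.sum_congr rfl fun i hi => ?_
    simp [lL, Finset.ne_of_mem_erase hi]
  rw [this]
  simp [lL]
  omega

def eProd {k : ℕ} {Ω : Type} [MeasurableSpace Ω] (μ : Measure Ω) [IsFiniteMeasure μ] (K : Ω → Ω → ℝ) (F : SimpleGraph (Fin k)) : ℝ :=
  ∫ x : Fin k → Ω, edgeProd F (fun i j => K (x i) (x j)) ∂(Measure.pi fun _ => μ)

theorem DD_base {V ι : Type} [Fintype V] [Fintype ι] (s t : ι → V) (l : ι → ℕ)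
    (h0 : ∀ i, l i = 0) (h : Adm s t l) : ∃ (k : ℕ) (F : SimpleGraph (Fin k)),
    ∀ (Ω : Type) [MeasurableSpace Ω] (μ : Measure Ω) [IsFiniteMeasure μ] (K : Ω → Ω → ℝ),
      (∀ x y, K x y = K y x) → DD μ K s t l = eProd μ K F := by
  classical
  set φ := Fintype.equivFin V
  have hinj : Function.Injective (fun i => s(φ (s i), φ (t i))) := by
    intro i i' he
    by_contra hne
    have := h.2 i i' hne (by simpa using he)
    rw [h0, h0] at this; omega
  refine ⟨Fintype.card V, SimpleGraph.fromEdgeSet (Set.range (fun i => s(φ (s i), φ (t i)))), ?_⟩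
  intro Ω _ μ _ K hK
  have mp := measurePreserving_piCongrLeft (fun _ : Fin (Fintype.card V) => μ) φ
  unfold DD eProd
  rw [← mp.integral_comp (MeasurableEquiv.measurableEmbedding _)]
  congr 1
  funext x
  have hap : ∀ v, MeasurableEquiv.piCongrLeft (fun _ : Fin (Fintype.card V) => Ω) φ x (φ v) = x v := by
    intro v
    exact Equiv.piCongrLeft_apply_apply _ _ _ _
  unfold edgeProd
  have hes : (SimpleGraph.fromEdgeSet (Set.range (fun i => s(φ (s i), φ (t i))))).edgeFinset
      = Finset.univ.image (fun i => s(φ (s i), φ (t i))) := by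
    ext e
    rw [SimpleGraph.mem_edgeFinset, SimpleGraph.edgeSet_fromEdgeSet]
    simp only [Set.mem_sdiff, Set.mem_range, Finset.mem_image, Finset.mem_univ, true_and]
    constructor
    · exact fun h => h.1
    · rintro ⟨i, rfl⟩
      refine ⟨⟨i, rfl⟩, ?_⟩
      simp [h.1 i]
  have key : ∏ e ∈ Finset.univ.image (fun i => s(φ (s i), φ (t i))),
      sym2Val (fun i j => K (MeasurableEquiv.piCongrLeft (fun _ : Fin (Fintype.card V) => Ω) φ x i)
        (MeasurableEquiv.piCongrLeft (fun _ : Fin (Fintype.card V) => Ω) φ x j)) e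
      = ∏ i, PP μ K (l i) (x (s i)) (x (t i)) := by
    rw [Finset.prod_image fun a _ b _ hab => hinj hab]
    refine Finset.prod_congr rfl fun i _ => ?_
    rw [h0]
    simp only [sym2Val, Sym2.lift_mk, hap, PP]
    rw [hK (x (t i)) (x (s i))]; ring
  rw [← key, ← hes]
  refine Finset.prod_congr ?_ fun _ _ => rfl
  ext e; simp only [SimpleGraph.mem_edgeFinset]

end PercAux

namespace PercAux
open Percolation

def un (n : ℕ) : Measure (Fin n) := ((n : NNReal)⁻¹) • Measure.count

instance (n : ℕ) : IsFiniteMeasure (un n) := by unfold un; infer_instance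

theorem un_singleton (n : ℕ) (i : Fin n) : (un n).real {i} = 1 / (n : ℝ) := by
  simp [un, Measure.real]

theorem un_mass (n : ℕ) : (un n).real Set.univ ≤ 1 := by
  have h : (un n) Set.univ = ((n : NNReal)⁻¹ : NNReal) * (n : ENNReal) := by
    unfold un
    rw [Measure.smul_apply, Measure.count_apply MeasurableSet.univ, ENNReal.smul_def]
    simp
  rw [Measure.real, h]
  rcases Nat.eq_zero_or_pos n with rfl | hn
  · simp
  · simp; rw [inv_mul_cancel₀]; positivity

theorem un_integral (n : ℕ) (f : Fin n → ℝ) : ∫ i, f i ∂(un n) = (∑ i, f i) / n := by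
  rw [integral_fintype (hf := Integrable.of_finite)]
  simp only [un_singleton, smul_eq_mul]
  rw [← Finset.mul_sum]; ring

theorem un_pi_integral (n k : ℕ) (f : (Fin k → Fin n) → ℝ) :
    ∫ x, f x ∂(Measure.pi fun _ : Fin k => un n) = (∑ x, f x) / (n : ℝ) ^ k := by
  rw [integral_fintype (hf := Integrable.of_finite)]
  have : ∀ x : Fin k → Fin n, (Measure.pi fun _ : Fin k => un n).real {x} = 1 / (n : ℝ) ^ k := by
    intro x
    rw [Measure.real, Measure.pi_singleton, ENNReal.toReal_prod]
    have : ∀ i, ((un n) {x i}).toReal = 1 / (n : ℝ) := fun i => un_singleton n (x i)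
    simp [this]
  simp only [this, smul_eq_mul]
  rw [← Finset.mul_sum]; ring

def mu : Measure ℝ := volume.restrict I01
instance : IsProbabilityMeasure mu := ⟨by simp [mu, I01]⟩

theorem eProd_G {n k : ℕ} (β : Fin n → Fin n → ℝ) (F : SimpleGraph (Fin k)) :
    eProd (un n) β F = homDensityG β F := un_pi_integral n k _

theorem eProd_W {k : ℕ} (W : ℝ → ℝ → ℝ) (F : SimpleGraph (Fin k)) :
    eProd mu W F = homDensityW W F := by
  unfold eProd homDensityW mu
  rw [← Measure.restrict_pi_pi]
  rfl

section
variable {β : ∀ n : ℕ, Fin n → Fin n → ℝ} {W : ℝ → ℝ → ℝ} {b : ℝ}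

theorem DD_tendsto (hb : 0 ≤ b) (hG : ∀ n, Ker (un n) (β n) b) (hW : Ker mu W b)
    (hc : ConvergesTo β W) (N : ℕ) : ∀ {V ι : Type} [Fintype V] [Fintype ι] (s t : ι → V) (l : ι → ℕ),
    ∑ i, l i = N → Adm s t l →
    Tendsto (fun n => DD (un n) (β n) s t l) atTop (𝓝 (DD mu W s t l)) := by
  classical
  induction N with
  | zero =>
    intro V ι _ _ s t l hl ha
    have h0 : ∀ i, l i = 0 := fun i => by
      have := Finset.sum_eq_zero_iff.1 hl i (Finset.mem_univ i); exact this
    obtain ⟨k, F, hF⟩ := DD_base s t l h0 ha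
    rw [hF _ _ _ hW.sym, eProd_W]
    refine (hc k F).congr fun n => ?_
    rw [hF _ _ _ (hG n).sym, eProd_G]
  | succ N ih =>
    intro V ι _ _ s t l hl ha
    obtain ⟨i0, hi0⟩ : ∃ i0, 1 ≤ l i0 := by
      by_contra hcon
      push Not at hcon
      have : ∑ i, l i = 0 := Finset.sum_eq_zero fun i _ => by have := hcon i; omega
      omega
    rw [DD_rec hW hb s t l i0 hi0]
    refine (ih (sS s) (tT t i0) (lL l i0) ?_ (Adm_rec s t l i0 ha)).congr fun n => ?_
    · have := lL_sum l i0 hi0; omega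
    · rw [DD_rec (hG n) hb s t l i0 hi0]
end

section
variable {Ω : Type} [MeasurableSpace Ω] {μ : Measure Ω} [IsFiniteMeasure μ] {K : Ω → Ω → ℝ} {b : ℝ}

theorem DD_pair {ι : Type} [Fintype ι] (l : ι → ℕ) :
    DD μ K (fun _ : ι => (0 : Fin 2)) (fun _ => 1) l = ∫ p, ∏ i, PP μ K (l i) p.1 p.2 ∂(μ.prod μ) := by
  have mp := measurePreserving_finTwoArrow μ
  rw [← mp.integral_comp (MeasurableEquiv.measurableEmbedding _)]
  rfl

end

section
variable {β : ∀ n : ℕ, Fin n → Fin n → ℝ} {W : ℝ → ℝ → ℝ} {b : ℝ}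

theorem path_tendsto (hb : 0 ≤ b) (hG : ∀ n, Ker (un n) (β n) b) (hW : Ker mu W b)
    (hc : ConvergesTo β W) (l : ℕ) :
    Tendsto (fun n => ∫ p, PP (un n) (β n) l p.1 p.2 ∂((un n).prod (un n))) atTop
      (𝓝 (∫ p, PP mu W l p.1 p.2 ∂(mu.prod mu))) := by
  have := DD_tendsto hb hG hW hc _ (fun _ : Unit => (0 : Fin 2)) (fun _ => 1) (fun _ => l) rfl
    ⟨fun _ => Fin.zero_ne_one, fun i i' h => absurd rfl h⟩
  simpa [DD_pair] using this

theorem theta_tendsto (hb : 0 ≤ b) (hG : ∀ n, Ker (un n) (β n) b) (hW : Ker mu W b)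
    (hc : ConvergesTo β W) {ι : Type} [Fintype ι] (l : ι → ℕ) :
    Tendsto (fun n => ∫ p, ∏ i, PP (un n) (β n) (l i + 1) p.1 p.2 ∂((un n).prod (un n))) atTop
      (𝓝 (∫ p, ∏ i, PP mu W (l i + 1) p.1 p.2 ∂(mu.prod mu))) := by
  have := DD_tendsto hb hG hW hc _ (fun _ : ι => (0 : Fin 2)) (fun _ => 1) (fun i => l i + 1) rfl
    ⟨fun _ => Fin.zero_ne_one, fun i i' h _ => Or.inl (Nat.le_add_left 1 _)⟩
  simpa [DD_pair] using this

end

section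
variable {Ω : Type} [MeasurableSpace Ω] {μ : Measure Ω} [IsFiniteMeasure μ] {K : Ω → Ω → ℝ} {b : ℝ}

def KK (μ : Measure Ω) (K : Ω → Ω → ℝ) (b : ℝ) (m : ℕ) (x y : Ω) : ℝ :=
  ∑ l : Fin m, (1 / (2 * b)) ^ ((l : ℕ) + 2) * PP μ K (l + 1) x y

def QQ (μ : Measure Ω) (K : Ω → Ω → ℝ) (b : ℝ) (m : ℕ) : ℝ :=
  ∫ p, (1 - KK μ K b m p.1 p.2) ^ m ∂(μ.prod μ)

theorem QQ_eq (h : Ker μ K b) (hb : 0 ≤ b) (m : ℕ) : QQ μ K b m =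
    ∑ j ∈ Finset.range (m + 1), ((-1) ^ j * (m.choose j : ℝ)) * ∑ f : Fin j → Fin m,
      (∏ i, (1 / (2 * b)) ^ ((f i : ℕ) + 2)) * ∫ p, ∏ i, PP μ K ((f i : ℕ) + 1) p.1 p.2 ∂(μ.prod μ) := by
  have hint : ∀ (j : ℕ) (f : Fin j → Fin m), Integrable (fun p : Ω × Ω => ∏ i, PP μ K ((f i : ℕ) + 1) p.1 p.2) (μ.prod μ) := by
    intro j f
    refine bdd_int (c := ∏ i, b ^ ((f i : ℕ) + 1 + 1)) ?_ (fun x => Finset.prod_nonneg fun i _ => PP_nn h _ _ _)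
      fun x => Finset.prod_le_prod (fun i _ => PP_nn h _ _ _) fun i _ => PP_le h hb _ _ _
    exact Finset.measurable_prod _ fun i _ => PP_comp_meas h _ measurable_fst measurable_snd
  unfold QQ
  have : ∀ p : Ω × Ω, (1 - KK μ K b m p.1 p.2) ^ m = ∑ j ∈ Finset.range (m + 1), ((-1) ^ j * (m.choose j : ℝ)) *
      ∑ f : Fin j → Fin m, (∏ i, (1 / (2 * b)) ^ ((f i : ℕ) + 2)) * ∏ i, PP μ K ((f i : ℕ) + 1) p.1 p.2 := by
    intro p
    rw [sub_eq_add_neg, add_comm, add_pow]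
    refine Finset.sum_congr rfl fun j _ => ?_
    rw [neg_pow, KK, Fintype.sum_pow]
    simp only [one_pow, mul_one, Finset.prod_mul_distrib]
    ring
  simp only [this]
  rw [integral_finsetSum]
  · refine Finset.sum_congr rfl fun j _ => ?_
    rw [integral_const_mul, integral_finsetSum]
    · simp only [integral_const_mul]
    · exact fun f _ => (hint j f).const_mul _
  · exact fun j _ => (integrable_finsetSum _ fun f _ => (hint j f).const_mul _).const_mul _
end

section
variable {β : ∀ n : ℕ, Fin n → Fin n → ℝ} {W : ℝ → ℝ → ℝ} {b : ℝ}
theorem QQ_tendsto (hb : 0 ≤ b) (hG : ∀ n, Ker (un n) (β n) b) (hW : Ker mu W b)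
    (hc : ConvergesTo β W) (m : ℕ) :
    Tendsto (fun n => QQ (un n) (β n) b m) atTop (𝓝 (QQ mu W b m)) := by
  rw [QQ_eq hW hb]
  have : (fun n => QQ (un n) (β n) b m) = fun n => _ := funext fun n => QQ_eq (hG n) hb m
  rw [this]
  refine tendsto_finsetSum _ fun j _ => Tendsto.const_mul _ (tendsto_finsetSum _ fun f _ => Tendsto.const_mul _ ?_)
  exact theta_tendsto hb hG hW hc (fun i => (f i : ℕ))
end
end PercAux

namespace PercAux
open Percolation

theorem un_prod_integral (n : ℕ) (f : Fin n → Fin n → ℝ) :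
    ∫ p, f p.1 p.2 ∂((un n).prod (un n)) = (∑ i, ∑ j, f i j) / (n : ℝ) ^ 2 := by
  rw [integral_prod _ Integrable.of_finite]
  simp only [un_integral]
  rw [← Finset.sum_div, div_div, pow_two]

theorem KK_nn {Ω : Type} [MeasurableSpace Ω] {μ : Measure Ω} [IsFiniteMeasure μ] {K : Ω → Ω → ℝ} {b : ℝ}
    (h : Ker μ K b) (hb : 1 ≤ b) (m : ℕ) (x y : Ω) : 0 ≤ KK μ K b m x y :=
  Finset.sum_nonneg fun l _ => mul_nonneg (by positivity) (PP_nn h _ _ _)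

theorem KK_le {Ω : Type} [MeasurableSpace Ω] {μ : Measure Ω} [IsFiniteMeasure μ] {K : Ω → Ω → ℝ} {b : ℝ}
    (h : Ker μ K b) (hb : 1 ≤ b) (m : ℕ) (x y : Ω) : KK μ K b m x y ≤ 1 := by
  have hb0 : 0 < b := by linarith
  have h1 : KK μ K b m x y ≤ ∑ l : Fin m, (1 / 2 : ℝ) ^ ((l : ℕ) + 2) := by
    refine Finset.sum_le_sum fun l _ => ?_
    calc (1 / (2 * b)) ^ ((l : ℕ) + 2) * PP μ K (l + 1) x y
        ≤ (1 / (2 * b)) ^ ((l : ℕ) + 2) * b ^ ((l : ℕ) + 2) :=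
          mul_le_mul_of_nonneg_left (PP_le h hb0.le _ _ _) (by positivity)
      _ = (1 / 2 : ℝ) ^ ((l : ℕ) + 2) := by
          rw [← mul_pow]; congr 1; field_simp
  have h2 : ∀ m : ℕ, ∑ l : Fin m, (1 / 2 : ℝ) ^ ((l : ℕ) + 2) = 1 / 2 - (1 / 2) ^ (m + 1) := by
    intro m
    rw [Fin.sum_univ_eq_sum_range (fun l => (1 / 2 : ℝ) ^ (l + 2))]
    induction m with
    | zero => norm_num
    | succ m ih => rw [Finset.sum_range_succ, ih]; ring
  rw [h2] at h1
  have : (0 : ℝ) ≤ (1 / 2) ^ (m + 1) := by positivity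
  linarith

theorem PP_cut {n : ℕ} {β : Fin n → Fin n → ℝ} {b : ℝ} (h : Ker (un n) β b) (hb : 1 ≤ b)
    (A : Finset (Fin n)) (l : ℕ) :
    ∑ i ∈ Aᶜ, ∑ j ∈ A, PP (un n) β l i j ≤ (l + 1) * b ^ l * ∑ i ∈ Aᶜ, ∑ j ∈ A, β i j := by
  have hb0 : 0 < b := by linarith
  induction l with
  | zero => simp [PP]
  | succ l ih =>
    rcases Nat.eq_zero_or_pos n with hn | hn
    · subst hn; rw [Finset.eq_empty_of_isEmpty Aᶜ]; simp
    have hn0 : (0 : ℝ) < n := by exact_mod_cast hn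
    have hcardle : ∀ B : Finset (Fin n), (B.card : ℝ) ≤ n := fun B => by
      have := Finset.card_le_univ B; rw [Fintype.card_fin] at this; exact_mod_cast this
    have e1 : ∑ i ∈ Aᶜ, ∑ j ∈ A, PP (un n) β (l + 1) i j =
        (∑ z, ∑ i ∈ Aᶜ, ∑ j ∈ A, PP (un n) β l i z * β z j) / n := by
      simp only [PP, un_integral]
      simp only [← Finset.sum_div]
      congr 1
      rw [Finset.sum_comm (s := Finset.univ)]
      refine Finset.sum_congr rfl fun i _ => ?_
      rw [Finset.sum_comm]
    rw [e1, div_le_iff₀ hn0, ← Finset.sum_add_sum_compl A]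
    have a1 : ∑ z ∈ A, ∑ i ∈ Aᶜ, ∑ j ∈ A, PP (un n) β l i z * β z j ≤
        (n * b) * ∑ i ∈ Aᶜ, ∑ j ∈ A, PP (un n) β l i j := by
      rw [Finset.sum_comm, Finset.mul_sum]
      refine Finset.sum_le_sum fun i _ => ?_
      rw [Finset.mul_sum]
      refine Finset.sum_le_sum fun z _ => ?_
      rw [← Finset.mul_sum, mul_comm]
      refine mul_le_mul_of_nonneg_right ?_ (PP_nn h _ _ _)
      calc ∑ j ∈ A, β z j ≤ ∑ j ∈ A, b := Finset.sum_le_sum fun j _ => h.le _ _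
        _ = A.card * b := by simp
        _ ≤ n * b := mul_le_mul_of_nonneg_right (hcardle A) hb0.le
    have a2 : ∑ z ∈ Aᶜ, ∑ i ∈ Aᶜ, ∑ j ∈ A, PP (un n) β l i z * β z j ≤
        (n * b ^ (l + 1)) * ∑ i ∈ Aᶜ, ∑ j ∈ A, β i j := by
      rw [Finset.mul_sum]
      refine Finset.sum_le_sum fun z _ => ?_
      simp only [← Finset.mul_sum]
      rw [← Finset.sum_mul]
      refine mul_le_mul_of_nonneg_right ?_ (Finset.sum_nonneg fun j _ => h.nn _ _)
      calc ∑ i ∈ Aᶜ, PP (un n) β l i z ≤ ∑ j ∈ Aᶜ, b ^ (l + 1) := Finset.sum_le_sum fun j _ => PP_le h hb0.le _ _ _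
        _ = Aᶜ.card * b ^ (l + 1) := by rw [Finset.sum_const, nsmul_eq_mul]
        _ ≤ n * b ^ (l + 1) := mul_le_mul_of_nonneg_right (hcardle _) (by positivity)
    have a3 := mul_le_mul_of_nonneg_left ih (by positivity : (0 : ℝ) ≤ n * b)
    calc _ ≤ n * b * ((l + 1) * b ^ l * ∑ i ∈ Aᶜ, ∑ j ∈ A, β i j) + (n * b ^ (l + 1)) * ∑ i ∈ Aᶜ, ∑ j ∈ A, β i j := by linarith
      _ = _ := by push_cast; ring

theorem QQ_cut {n : ℕ} {β : Fin n → Fin n → ℝ} {b δ : ℝ} (h : Ker (un n) β b) (hb : 1 ≤ b)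
    (hδ : 0 < δ) (m : ℕ) (hm : 1 ≤ m) (hQ : QQ (un n) β b m < δ ^ 2 / 2) :
    Cut β (δ ^ 2 / (2 * m ^ 2 * (m + 1))) δ := by
  have hb0 : 0 < b := by linarith
  intro A hA1 hA2
  have hm0 : (0 : ℝ) < m := by exact_mod_cast hm
  simp only [Fintype.card_fin] at hA1 hA2 ⊢
  rcases Nat.eq_zero_or_pos n with hn | hn
  · subst hn; rw [Finset.eq_empty_of_isEmpty Aᶜ]; simp
  have hn0 : (0 : ℝ) < n := by exact_mod_cast hn
  unfold wtt
  have hAc : δ * n ≤ (Aᶜ.card : ℝ) := by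
    have : (A.card : ℝ) + Aᶜ.card = n := by
      have := Finset.card_add_card_compl A
      rw [Fintype.card_fin] at this; exact_mod_cast this
    linarith
  unfold QQ at hQ
  rw [un_prod_integral n (fun i j => (1 - KK (un n) β b m i j) ^ m), div_lt_iff₀ (by positivity)] at hQ
  have s1 : ∑ i ∈ Aᶜ, ∑ j ∈ A, (1 - m * KK (un n) β b m i j) ≤ ∑ i, ∑ j, (1 - KK (un n) β b m i j) ^ m := by
    have hp : ∀ i j, 0 ≤ (1 - KK (un n) β b m i j) ^ m := fun i j => pow_nonneg (by linarith [KK_le h hb m i j]) _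
    calc _ ≤ ∑ i ∈ Aᶜ, ∑ j ∈ A, (1 - KK (un n) β b m i j) ^ m := by
          refine Finset.sum_le_sum fun i _ => Finset.sum_le_sum fun j _ => ?_
          have := one_add_mul_le_pow (a := -KK (un n) β b m i j) (by linarith [KK_le h hb m i j]) m
          rw [← sub_eq_add_neg] at this
          linarith
      _ ≤ ∑ i ∈ Aᶜ, ∑ j, (1 - KK (un n) β b m i j) ^ m :=
          Finset.sum_le_sum fun i _ => Finset.sum_le_sum_of_subset_of_nonneg (Finset.subset_univ _) fun j _ _ => hp i j
      _ ≤ _ := Finset.sum_le_sum_of_subset_of_nonneg (Finset.subset_univ _) fun i _ _ => Finset.sum_nonneg fun j _ => hp i j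
  have s2 : ∑ i ∈ Aᶜ, ∑ j ∈ A, (1 - m * KK (un n) β b m i j) =
      Aᶜ.card * A.card - m * ∑ i ∈ Aᶜ, ∑ j ∈ A, KK (un n) β b m i j := by
    simp only [Finset.sum_sub_distrib, Finset.sum_const, nsmul_eq_mul, mul_one, Finset.mul_sum]
  have s3 : (δ * n) * (δ * n) ≤ (Aᶜ.card : ℝ) * A.card := mul_le_mul hAc hA1 (by positivity) (by positivity)
  set cut := ∑ i ∈ Aᶜ, ∑ j ∈ A, β i j with hcut
  have hcut0 : 0 ≤ cut := Finset.sum_nonneg fun i _ => Finset.sum_nonneg fun j _ => h.nn _ _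
  have s4 : ∑ i ∈ Aᶜ, ∑ j ∈ A, KK (un n) β b m i j ≤ m * (m + 1) * cut := by
    have : ∑ i ∈ Aᶜ, ∑ j ∈ A, KK (un n) β b m i j = ∑ l : Fin m, (1 / (2 * b)) ^ ((l : ℕ) + 2) * ∑ i ∈ Aᶜ, ∑ j ∈ A, PP (un n) β (l + 1) i j := by
      unfold KK
      simp only [Finset.mul_sum]
      rw [Finset.sum_comm' (s := Finset.univ) (t' := Aᶜ) (s' := fun _ => Finset.univ) (h := by simp)]
      refine Finset.sum_congr rfl fun i _ => ?_
      rw [Finset.sum_comm]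
    rw [this]
    calc _ ≤ ∑ l : Fin m, ((m : ℝ) + 1) * cut := by
          refine Finset.sum_le_sum fun l _ => ?_
          have hl : ((l : ℕ) : ℝ) + 1 ≤ m := by exact_mod_cast l.2
          have c1 := PP_cut h hb A ((l : ℕ) + 1)
          have c2 : (1 / (2 * b)) ^ ((l : ℕ) + 2) * b ^ ((l : ℕ) + 1) ≤ 1 := by
            calc _ ≤ (1 / (2 * b)) ^ ((l : ℕ) + 2) * b ^ ((l : ℕ) + 2) :=
                  mul_le_mul_of_nonneg_left (pow_le_pow_right₀ hb (by omega)) (by positivity)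
              _ = (1 / 2) ^ ((l : ℕ) + 2) := by rw [← mul_pow]; congr 1; field_simp
              _ ≤ 1 := pow_le_one₀ (by norm_num) (by norm_num)
          have c3 := mul_le_mul_of_nonneg_left c1 (by positivity : (0 : ℝ) ≤ (1 / (2 * b)) ^ ((l : ℕ) + 2))
          refine c3.trans ?_
          rw [← hcut]
          push_cast
          calc _ = ((1 / (2 * b)) ^ ((l : ℕ) + 2) * b ^ ((l : ℕ) + 1)) * (((l : ℕ) + 1 + 1) * cut) := by ring
            _ ≤ 1 * (((l : ℕ) + 1 + 1) * cut) := mul_le_mul_of_nonneg_right c2 (by positivity)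
            _ ≤ _ := by rw [one_mul]; exact mul_le_mul_of_nonneg_right (by linarith) hcut0
      _ = _ := by rw [Finset.sum_const, Finset.card_univ, Fintype.card_fin, nsmul_eq_mul]; ring
  have s5 := mul_le_mul_of_nonneg_left s4 hm0.le
  rw [div_mul_eq_mul_div, div_le_iff₀ (by positivity)]
  rw [s2] at s1
  nlinarith
end PercAux

namespace PercAux
open Percolation

section
variable {W : ℝ → ℝ → ℝ} {b : ℝ}

theorem irr_use (hW : Ker mu W b) (hirr : Percolation.Irreducible W) (A : Set ℝ) (hA : MeasurableSet A)
    (h : ∀ᵐ x ∂mu, x ∈ A → ∀ᵐ y ∂mu, y ∉ A → W x y = 0) : mu A = 0 ∨ mu A = 1 := by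
  by_contra hcon
  push Not at hcon
  have hI : MeasurableSet I01 := measurableSet_Icc
  have hv : volume (A ∩ I01) = mu A := by rw [mu, Measure.restrict_apply hA]
  refine hirr ⟨A ∩ I01, hA.inter hI, Set.inter_subset_right, ?_, ?_, ?_⟩
  · rw [hv]; exact pos_iff_ne_zero.2 hcon.1
  · rw [hv]; exact lt_of_le_of_ne prob_le_one hcon.2
  · have hm : MeasurableSet {p : ℝ × ℝ | p.1 ∈ A → p.2 ∉ A → W p.1 p.2 = 0} := by
      have h1 : MeasurableSet {p : ℝ × ℝ | p.1 ∈ A} := measurable_fst hA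
      have h2 : MeasurableSet {p : ℝ × ℝ | p.2 ∈ A} := measurable_snd hA
      have h3 : MeasurableSet {p : ℝ × ℝ | W p.1 p.2 = 0} := hW.meas (measurableSet_singleton 0)
      exact MeasurableSet.imp h1 (MeasurableSet.imp h2.compl h3)
    have key : ∀ᵐ p ∂(mu.prod mu), p.1 ∈ A → p.2 ∉ A → W p.1 p.2 = 0 := by
      rw [Measure.ae_prod_iff_ae_ae hm]
      filter_upwards [h] with x hx
      by_cases hxA : x ∈ A
      · filter_upwards [hx hxA] with y hy _ using hy
      · exact Eventually.of_forall fun y h => absurd h hxA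
    rw [mu, Measure.prod_restrict, ae_restrict_iff' (hI.prod hI)] at key
    filter_upwards [key] with p hp h1 h2
    exact hp ⟨h1.2, h2.1⟩ h1.1 fun h => h2.2 ⟨h, h2.1⟩

def dg (W : ℝ → ℝ → ℝ) (x : ℝ) : ℝ := ∫ y, W x y ∂mu

theorem sec_meas (hW : Ker mu W b) (l : ℕ) (x : ℝ) : Measurable (PP mu W l x) :=
  PP_comp_meas hW l measurable_const measurable_id

theorem sec_int (hW : Ker mu W b) (hb : 0 ≤ b) (l : ℕ) (x : ℝ) : Integrable (PP mu W l x) mu :=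
  bdd_int (sec_meas hW l x) (PP_nn hW l x) (PP_le hW hb l x)

theorem dg_meas (hW : Ker mu W b) : Measurable (dg W) :=
  (hW.meas.stronglyMeasurable.integral_prod_right' (ν := mu)).measurable

theorem dg_zero (hW : Ker mu W b) (hb : 0 ≤ b) (x : ℝ) : dg W x = 0 ↔ ∀ᵐ y ∂mu, W x y = 0 := by
  unfold dg
  rw [integral_eq_zero_iff_of_nonneg (hW.nn x) (sec_int hW hb 0 x)]
  rfl

theorem opNorm_wit (hsup : 1 < opNorm W) : ∃ f : ℝ → ℝ, Measurable f ∧ IntegrableOn (fun x => f x ^ 2) I01 ∧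
    l2norm f ≤ 1 ∧ 1 < l2norm (applyT W f) := by
  unfold opNorm at hsup
  obtain ⟨r, ⟨f, hf, hfi, hf1, hrf⟩, hr⟩ := exists_lt_of_lt_csSup (by
    refine ⟨l2norm (applyT W fun _ => 0), fun _ => 0, measurable_const, by simp, by simp [l2norm], rfl⟩) hsup
  exact ⟨f, hf, hfi, hf1, hrf ▸ hr⟩

theorem dg_pos (hW : Ker mu W b) (hb : 0 ≤ b) (hirr : Percolation.Irreducible W) (hsup : 1 < opNorm W) :
    ∀ᵐ x ∂mu, dg W x ≠ 0 := by
  have hm : MeasurableSet {x | dg W x = 0} := dg_meas hW (measurableSet_singleton 0)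
  rcases irr_use hW hirr {x | dg W x = 0} hm (by
    refine Eventually.of_forall fun x hx => ?_
    filter_upwards [(dg_zero hW hb x).1 hx] with y hy _ using hy) with h0 | h1
  · exact compl_mem_ae_iff.2 h0
  · exfalso
    have hae : ∀ᵐ x ∂mu, dg W x = 0 := (prob_compl_eq_zero_iff hm).2 h1
    obtain ⟨f, hf, hfi, hf1, hr⟩ := opNorm_wit hsup
    have : ∫ x in I01, applyT W f x ^ 2 = 0 := by
      change ∫ x, applyT W f x ^ 2 ∂mu = 0
      rw [integral_congr_ae (g := fun _ => 0)]
      · simp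
      · filter_upwards [hae] with x hx
        have : applyT W f x = 0 := by
          unfold applyT
          change ∫ y, W x y * f y ∂mu = 0
          rw [integral_congr_ae (g := fun _ => 0)]
          · simp
          · filter_upwards [(dg_zero hW hb x).1 hx] with y hy
            simp [hy]
        simp [this]
    unfold l2norm at hr
    rw [this, Real.sqrt_zero] at hr
    linarith

theorem reach_pos (hW : Ker mu W b) (hb : 0 ≤ b) (hirr : Percolation.Irreducible W) (hsup : 1 < opNorm W) :
    ∀ᵐ x ∂mu, ∀ᵐ y ∂mu, ∃ l, 0 < PP mu W (l + 1) x y := by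
  have hd := dg_pos hW hb hirr hsup
  filter_upwards [hd] with x hx
  set B : Set ℝ := {y | ∃ l, 0 < PP mu W (l + 1) x y} with hB
  have hBm : MeasurableSet B := by
    have : B = ⋃ l, {y | 0 < PP mu W (l + 1) x y} := by ext y; simp [hB]
    rw [this]
    exact MeasurableSet.iUnion fun l => measurableSet_lt measurable_const (sec_meas hW _ x)
  rcases irr_use hW hirr Bᶜ hBm.compl (by
    refine Eventually.of_forall fun z hz => ?_
    have : ∀ l, ∀ᵐ y ∂mu, PP mu W (l + 1) x y * W y z = 0 := by
      intro l
      have h0 : ∫ y, PP mu W (l + 1) x y * W y z ∂mu = 0 := by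
        by_contra hne
        exact hz ⟨l + 1, lt_of_le_of_ne (PP_nn hW (l + 2) x z) (Ne.symm hne)⟩
      rw [integral_eq_zero_iff_of_nonneg] at h0
      · exact h0
      · exact fun y => mul_nonneg (PP_nn hW _ _ _) (hW.nn _ _)
      · have hm : Measurable fun y => W y z := hW.meas.comp (measurable_id.prodMk measurable_const)
        refine bdd_int (c := b ^ (l + 1 + 1) * b) ((sec_meas hW _ x).mul hm) (fun y => mul_nonneg (PP_nn hW _ _ _) (hW.nn _ _)) fun y => ?_
        exact mul_le_mul (PP_le hW hb _ _ _) (hW.le _ _) (hW.nn _ _) (by positivity)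
    filter_upwards [ae_all_iff.2 this] with y hy hyB
    obtain ⟨l, hl⟩ : y ∈ B := not_not.1 hyB
    rw [hW.sym]
    exact (mul_eq_zero.1 (hy l)).resolve_left hl.ne') with h0 | h1
  · exact h0
  · exfalso
    apply hx
    have hae : ∀ᵐ y ∂mu, y ∈ Bᶜ := by
      have := (prob_compl_eq_zero_iff (μ := mu) hBm.compl).2 h1
      exact this
    have i0 : ∫ y, PP mu W 1 x y ∂mu = 0 := by
      rw [integral_congr_ae (g := fun _ => 0)]
      · simp
      · filter_upwards [hae] with y hy
        by_contra hne
        exact hy ⟨0, lt_of_le_of_ne (PP_nn hW 1 x y) (Ne.symm hne)⟩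
    have hpm : Measurable fun p : ℝ × ℝ => W x p.2 * W p.2 p.1 := by
      have h1 : Measurable fun p : ℝ × ℝ => W x p.2 := hW.meas.comp (measurable_const.prodMk measurable_snd)
      have h2 : Measurable fun p : ℝ × ℝ => W p.2 p.1 := hW.meas.comp (measurable_snd.prodMk measurable_fst)
      exact h1.mul h2
    have hpi : Integrable (Function.uncurry fun y z : ℝ => W x z * W z y) (mu.prod mu) := by
      refine bdd_int (c := b * b) hpm (fun p => mul_nonneg (hW.nn _ _) (hW.nn _ _)) fun p => ?_
      exact mul_le_mul (hW.le _ _) (hW.le _ _) (hW.nn _ _) hb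
    have i1 : ∫ z, W x z * dg W z ∂mu = 0 := by
      rw [← i0]
      change _ = ∫ y, ∫ z, W x z * W z y ∂mu ∂mu
      rw [integral_integral_swap hpi]
      congr 1
      funext z
      rw [integral_const_mul]; rfl
    have hdn : ∀ z, 0 ≤ dg W z := fun z => integral_nonneg (hW.nn z)
    rw [integral_eq_zero_iff_of_nonneg] at i1
    · rw [dg_zero hW hb]
      filter_upwards [hd, i1] with z h1 h2
      exact (mul_eq_zero.1 h2).resolve_right h1
    · exact fun z => mul_nonneg (hW.nn _ _) (hdn z)
    · refine bdd_int (c := b * b) ((sec_meas hW 0 x).mul (dg_meas hW)) (fun z => mul_nonneg (hW.nn _ _) (hdn z)) fun z => ?_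
      exact mul_le_mul (hW.le _ _) (int_le_const hW.mass hb (hW.le z)) (hdn z) hb

theorem QQ_zero (hW : Ker mu W b) (hb : 1 ≤ b) (hirr : Percolation.Irreducible W) (hsup : 1 < opNorm W) :
    Tendsto (fun m => QQ mu W b m) atTop (𝓝 0) := by
  have hb0 : 0 < b := by linarith
  have hKm : ∀ m, Measurable fun p : ℝ × ℝ => (1 - KK mu W b m p.1 p.2) ^ m := by
    intro m
    refine (measurable_const.sub ?_).pow_const m
    exact Finset.measurable_sum _ fun l _ => (PP_comp_meas hW _ measurable_fst measurable_snd).const_mul _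
  have hmeas : MeasurableSet {p : ℝ × ℝ | ∃ l, 0 < PP mu W (l + 1) p.1 p.2} := by
    have : {p : ℝ × ℝ | ∃ l, 0 < PP mu W (l + 1) p.1 p.2} = ⋃ l, {p : ℝ × ℝ | 0 < PP mu W (l + 1) p.1 p.2} := by
      ext y; simp
    rw [this]
    exact MeasurableSet.iUnion fun l => measurableSet_lt measurable_const (PP_comp_meas hW _ measurable_fst measurable_snd)
  have hae : ∀ᵐ p ∂(mu.prod mu), ∃ l, 0 < PP mu W (l + 1) p.1 p.2 :=
    (Measure.ae_prod_iff_ae_ae hmeas).2 (reach_pos hW hb0.le hirr hsup)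
  have h0 : ∀ m x y, 0 ≤ 1 - KK mu W b m x y := fun m x y => by linarith [KK_le hW hb m x y]
  have := tendsto_integral_of_dominated_convergence (μ := mu.prod mu)
    (F := fun m (p : ℝ × ℝ) => (1 - KK mu W b m p.1 p.2) ^ m) (f := fun _ => 0) (fun _ => 1)
    (fun m => (hKm m).aestronglyMeasurable) (integrable_const 1)
    (fun m => Eventually.of_forall fun p => by
      rw [Real.norm_of_nonneg (pow_nonneg (h0 _ _ _) _)]
      exact pow_le_one₀ (h0 _ _ _) (by linarith [KK_nn hW hb m p.1 p.2]))
    (by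
      filter_upwards [hae] with p hp
      obtain ⟨l, hl⟩ := hp
      set c := (1 / (2 * b)) ^ (l + 2) * PP mu W (l + 1) p.1 p.2 with hc
      have hc0 : 0 < c := by positivity
      have hck : ∀ m, l < m → c ≤ KK mu W b m p.1 p.2 := by
        intro m hm
        exact Finset.single_le_sum (f := fun l : Fin m => (1 / (2 * b)) ^ ((l : ℕ) + 2) * PP mu W (l + 1) p.1 p.2)
          (fun i _ => mul_nonneg (by positivity) (PP_nn hW _ _ _)) (Finset.mem_univ (⟨l, hm⟩ : Fin m))
      have hc1 : c ≤ 1 := (hck (l + 1) (by omega)).trans (KK_le hW hb _ _ _)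
      refine tendsto_of_tendsto_of_tendsto_of_le_of_le' tendsto_const_nhds
        (tendsto_pow_atTop_nhds_zero_of_lt_one (r := 1 - c) (by linarith) (by linarith)) ?_ ?_
      · exact Eventually.of_forall fun m => pow_nonneg (h0 _ _ _) _
      · filter_upwards [eventually_gt_atTop l] with m hm
        exact pow_le_pow_left₀ (h0 _ _ _) (by linarith [hck m hm]) m)
  rw [integral_zero] at this
  exact this

theorem H2_proof {β : ∀ n : ℕ, Fin n → Fin n → ℝ} (hb : 1 ≤ b) (hG : ∀ n, Ker (un n) (β n) b) (hW : Ker mu W b)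
    (hc : ConvergesTo β W) (hirr : Percolation.Irreducible W) (hsup : 1 < opNorm W) :
    ∀ δ > 0, ∃ κ > 0, ∀ᶠ n in atTop, Cut (β n) κ δ := by
  intro δ hδ
  obtain ⟨m, hm1, hm⟩ := (((QQ_zero hW hb hirr hsup).eventually_lt_const
    (show (0 : ℝ) < δ ^ 2 / 2 by positivity)).and (eventually_ge_atTop 1)).exists
  have hm0 : (0 : ℝ) < m := by exact_mod_cast hm
  refine ⟨δ ^ 2 / (2 * m ^ 2 * (m + 1)), by positivity, ?_⟩
  filter_upwards [(QQ_tendsto (by linarith) hG hW hc m).eventually_lt_const hm1] with n hn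
  exact QQ_cut (hG n) hb hδ m hm hn
end
end PercAux

namespace PercAux
open Percolation

section
variable {Ω : Type} [MeasurableSpace Ω] {μ : Measure Ω} [IsFiniteMeasure μ] {K : Ω → Ω → ℝ} {b : ℝ}

def TT (μ : Measure Ω) (K : Ω → Ω → ℝ) (g : Ω → ℝ) (x : Ω) : ℝ := ∫ y, K x y * g y ∂μ

def Bd (g : Ω → ℝ) : Prop := Measurable g ∧ ∃ c, ∀ x, |g x| ≤ c

theorem Bd.int {g : Ω → ℝ} (h : Bd g) : Integrable g μ := by
  obtain ⟨hm, c, hc⟩ := h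
  exact Integrable.of_bound hm.aestronglyMeasurable c (Eventually.of_forall hc)

theorem int_mul_Bd {g h : Ω → ℝ} (hg : Integrable g μ) (hh : Bd h) : Integrable (fun x => g x * h x) μ := by
  obtain ⟨hm, c, hc⟩ := hh
  exact hg.mul_bdd (c := c) hm.aestronglyMeasurable (Eventually.of_forall hc)

theorem sec_Bd (hK : Ker μ K b) (x : Ω) : Bd (K x) :=
  ⟨hK.meas.comp (measurable_const.prodMk measurable_id), b, fun y => by
    rw [abs_of_nonneg (hK.nn _ _)]; exact hK.le _ _⟩

theorem sec_mul_int (hK : Ker μ K b) {g : Ω → ℝ} (hg : Integrable g μ) (x : Ω) :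
    Integrable (fun y => K x y * g y) μ := by
  have := int_mul_Bd hg (sec_Bd hK x)
  simpa [mul_comm] using this

theorem TT_Bd (hK : Ker μ K b) (hb : 0 ≤ b) {g : Ω → ℝ} (hm : Measurable g) (hg : Integrable g μ) : Bd (TT μ K g) := by
  constructor
  · have : Measurable fun p : Ω × Ω => K p.1 p.2 * g p.2 := hK.meas.mul (hm.comp measurable_snd)
    exact (this.stronglyMeasurable.integral_prod_right' (ν := μ)).measurable
  · refine ⟨b * ∫ y, |g y| ∂μ, fun x => ?_⟩
    calc |TT μ K g x| ≤ ∫ y, |K x y * g y| ∂μ := abs_integral_le_integral_abs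
      _ ≤ ∫ y, b * |g y| ∂μ := by
        refine integral_mono (sec_mul_int hK hg x).abs (hg.abs.const_mul b) fun y => ?_
        rw [abs_mul, abs_of_nonneg (hK.nn _ _)]
        exact mul_le_mul_of_nonneg_right (hK.le _ _) (abs_nonneg _)
      _ = _ := integral_const_mul _ _

theorem TT_it_Bd (hK : Ker μ K b) (hb : 0 ≤ b) {g : Ω → ℝ} (hg : Bd g) (k : ℕ) : Bd ((TT μ K)^[k] g) := by
  induction k with
  | zero => exact hg
  | succ k ih => rw [Function.iterate_succ_apply']; exact TT_Bd hK hb ih.1 ih.int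

theorem TT_adj (hK : Ker μ K b) {g h : Ω → ℝ} (hg : Integrable g μ) (hgm : Measurable g) (hh : Bd h) :
    ∫ x, TT μ K g x * h x ∂μ = ∫ x, g x * TT μ K h x ∂μ := by
  have hint : Integrable (fun p : Ω × Ω => (K p.1 p.2 * h p.1) * g p.2) (μ.prod μ) := by
    have h1 : Integrable (fun p : Ω × Ω => g p.2) (μ.prod μ) := hg.comp_snd μ
    obtain ⟨hm, c, hc⟩ := hh
    have h2 : Bd (fun p : Ω × Ω => K p.1 p.2 * h p.1) := by
      refine ⟨hK.meas.mul (hm.comp measurable_fst), b * c, fun p => ?_⟩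
      rw [abs_mul, abs_of_nonneg (hK.nn _ _)]
      exact mul_le_mul (hK.le _ _) (hc _) (abs_nonneg _) ((hK.nn p.1 p.1).trans (hK.le _ _))
    have := int_mul_Bd h1 h2
    simpa [mul_comm] using this
  have e1 : ∀ x, TT μ K g x * h x = ∫ y, (K x y * h x) * g y ∂μ := by
    intro x
    rw [TT, ← integral_mul_const]
    congr 1; funext y; ring
  have e2 : ∀ y, g y * TT μ K h y = ∫ x, (K x y * h x) * g y ∂μ := by
    intro y
    rw [TT, ← integral_const_mul]
    congr 1; funext x; rw [hK.sym y x]; ring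
  simp only [e1, e2]
  exact integral_integral_swap hint

theorem TT_it_adj (hK : Ker μ K b) (hb : 0 ≤ b) (k : ℕ) : ∀ {g h : Ω → ℝ}, Bd g → Bd h →
    ∫ x, (TT μ K)^[k] g x * h x ∂μ = ∫ x, g x * (TT μ K)^[k] h x ∂μ := by
  induction k with
  | zero => intro g h _ _; rfl
  | succ k ih =>
    intro g h hg hh
    rw [Function.iterate_succ_apply', Function.iterate_succ_apply]
    rw [TT_adj hK (TT_it_Bd hK hb hg k).int (TT_it_Bd hK hb hg k).1 hh]
    exact ih hg (TT_Bd hK hb hh.1 hh.int)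

theorem TT_mono (hK : Ker μ K b) {g h : Ω → ℝ} (hg : Integrable g μ) (hh : Integrable h μ) (hgh : ∀ x, g x ≤ h x) (x : Ω) :
    TT μ K g x ≤ TT μ K h x :=
  integral_mono (sec_mul_int hK hg x) (sec_mul_int hK hh x) fun y => mul_le_mul_of_nonneg_left (hgh y) (hK.nn _ _)

theorem TT_it_mono (hK : Ker μ K b) (hb : 0 ≤ b) {g h : Ω → ℝ} (hg : Bd g) (hh : Bd h) (hgh : ∀ x, g x ≤ h x) (k : ℕ) :
    ∀ x, (TT μ K)^[k] g x ≤ (TT μ K)^[k] h x := by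
  induction k with
  | zero => exact hgh
  | succ k ih =>
    rw [Function.iterate_succ_apply', Function.iterate_succ_apply']
    exact TT_mono hK (TT_it_Bd hK hb hg k).int (TT_it_Bd hK hb hh k).int ih

theorem TT_it_smul (c : ℝ) (g : Ω → ℝ) (k : ℕ) :
    (TT μ K)^[k] (fun x => c * g x) = fun x => c * (TT μ K)^[k] g x := by
  induction k with
  | zero => rfl
  | succ k ih =>
    rw [Function.iterate_succ_apply', Function.iterate_succ_apply', ih]
    funext x
    unfold TT
    rw [← integral_const_mul]
    congr 1; funext y; ring

theorem PP_TT (hK : Ker μ K b) (hb : 0 ≤ b) (l : ℕ) : ∀ {h : Ω → ℝ}, Bd h → ∀ x,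
    ∫ y, PP μ K l x y * h y ∂μ = (TT μ K)^[l + 1] h x := by
  induction l with
  | zero => intro h hh x; rfl
  | succ l ih =>
    intro h hh x
    rw [Function.iterate_succ_apply, ← ih (TT_Bd hK hb hh.1 hh.int)]
    have hPm : Measurable (PP μ K l x) := PP_comp_meas hK l measurable_const measurable_id
    have hint : Integrable (fun p : Ω × Ω => (PP μ K l x p.2 * K p.2 p.1) * h p.1) (μ.prod μ) := by
      obtain ⟨hm, c, hc⟩ := hh
      refine Bd.int ⟨((hPm.comp measurable_snd).mul
        (hK.meas.comp (measurable_snd.prodMk measurable_fst))).mul (hm.comp measurable_fst),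
        (b ^ (l + 1) * b) * c, fun p => ?_⟩
      rw [abs_mul, abs_of_nonneg (mul_nonneg (PP_nn hK _ _ _) (hK.nn _ _))]
      refine mul_le_mul (mul_le_mul (PP_le hK hb _ _ _) (hK.le _ _) (hK.nn _ _) (by positivity)) (hc _) (abs_nonneg _) (by positivity)
    have e1 : ∀ y, PP μ K (l + 1) x y * h y = ∫ z, (PP μ K l x z * K z y) * h y ∂μ := by
      intro y
      rw [integral_mul_const]; rfl
    have e2 : ∀ z, PP μ K l x z * TT μ K h z = ∫ y, (PP μ K l x z * K z y) * h y ∂μ := by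
      intro z
      rw [TT, ← integral_const_mul]
      congr 1; funext y; ring
    simp only [e1, e2]
    exact integral_integral_swap hint

theorem PP_total (hK : Ker μ K b) (hb : 0 ≤ b) (l : ℕ) :
    ∫ p, PP μ K l p.1 p.2 ∂(μ.prod μ) = ∫ x, (TT μ K)^[l + 1] (fun _ => 1) x ∂μ := by
  rw [integral_prod (fun p : Ω × Ω => PP μ K l p.1 p.2)
    (bdd_int (PP_meas hK l) (fun p => PP_nn hK l _ _) (fun p => PP_le hK hb l _ _))]
  congr 1; funext x
  rw [← PP_TT hK hb l (h := fun _ => 1) ⟨measurable_const, 1, fun _ => by simp⟩]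
  simp

theorem growth (hK : Ker μ K b) (hb : 0 ≤ b) {g : Ω → ℝ} (hgm : Measurable g) (hg0 : ∀ x, 0 ≤ g x)
    (hgi : Integrable g μ) (hg2 : Integrable (fun x => g x ^ 2) μ) (r : ℝ) (hr : 0 < r)
    (h1 : r * ∫ x, g x ^ 2 ∂μ ≤ ∫ x, TT μ K g x ^ 2 ∂μ) (j : ℕ) :
    r * ∫ x, (TT μ K)^[j] g x ^ 2 ∂μ ≤ ∫ x, (TT μ K)^[j + 1] g x ^ 2 ∂μ := by
  have hB : ∀ j, Bd ((TT μ K)^[j + 1] g) := by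
    intro j
    rw [Function.iterate_succ_apply]
    exact TT_it_Bd hK hb (TT_Bd hK hb hgm hgi) j
  have hsq : ∀ j, Measurable ((TT μ K)^[j] g) ∧ Integrable ((TT μ K)^[j] g) μ ∧ Integrable (fun x => (TT μ K)^[j] g x ^ 2) μ := by
    intro j
    cases j with
    | zero => exact ⟨hgm, hgi, hg2⟩
    | succ j =>
      refine ⟨(hB j).1, (hB j).int, ?_⟩
      simpa [pow_two] using int_mul_Bd (μ := μ) (hB j).int (hB j)
  induction j with
  | zero => exact h1
  | succ j ih =>
    have e : ∫ x, (TT μ K)^[j + 1] g x ^ 2 ∂μ = ∫ x, (TT μ K)^[j] g x * (TT μ K)^[j + 2] g x ∂μ := by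
      have := TT_adj hK (hsq j).2.1 (hsq j).1 (hB j)
      rw [← Function.iterate_succ_apply' (TT μ K) j, ← Function.iterate_succ_apply' (TT μ K) (j + 1)] at this
      rw [← this]
      congr 1; funext x; rw [pow_two]
    have hle : 2 * ∫ x, (TT μ K)^[j] g x * (TT μ K)^[j + 2] g x ∂μ ≤
        r * ∫ x, (TT μ K)^[j] g x ^ 2 ∂μ + (1 / r) * ∫ x, (TT μ K)^[j + 2] g x ^ 2 ∂μ := by
      rw [← integral_const_mul, ← integral_const_mul, ← integral_const_mul, ← integral_add
        ((hsq j).2.2.const_mul _) ((hsq (j + 2)).2.2.const_mul _)]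
      refine integral_mono ((int_mul_Bd (hsq j).2.1 (hB (j + 1))).const_mul 2)
        (((hsq j).2.2.const_mul _).add ((hsq (j + 2)).2.2.const_mul _)) fun x => ?_
      simp only
      set u := (TT μ K)^[j] g x
      set v := (TT μ K)^[j + 2] g x
      have : r * u ^ 2 + 1 / r * v ^ 2 - 2 * (u * v) = (1 / r) * (r * u - v) ^ 2 := by field_simp; ring
      have h2 : 0 ≤ (1 / r) * (r * u - v) ^ 2 := by positivity
      linarith
    rw [← e] at hle
    have h3 : ∫ x, (TT μ K)^[j + 1] g x ^ 2 ∂μ ≤ (1 / r) * ∫ x, (TT μ K)^[j + 2] g x ^ 2 ∂μ := by linarith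
    rw [one_div, inv_mul_eq_div, le_div_iff₀ hr] at h3
    change r * ∫ x, (TT μ K)^[j + 1] g x ^ 2 ∂μ ≤ ∫ x, (TT μ K)^[j + 2] g x ^ 2 ∂μ
    linarith
end
end PercAux

namespace PercAux
open Percolation

theorem disc_bound {n : ℕ} {β : Fin n → Fin n → ℝ} {b l : ℝ} (hK : Ker (un n) β b) (hl : 0 ≤ l) (hn : 0 < n)
    (h : ∀ u : Fin n → ℝ, qf (fun i j => β i j / n) u ≤ l * ns u) (k : ℕ) :
    ∫ x, (TT (un n) β)^[k] (fun _ => 1) x ∂(un n) ≤ l ^ k := by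
  have hn0 : (0 : ℝ) < n := by exact_mod_cast hn
  have hT : ∀ u : Fin n → ℝ, TT (un n) β u = fun i => ∑ j, (β i j / n) * u j := by
    intro u; funext i
    rw [TT, un_integral, Finset.sum_div]
    exact Finset.sum_congr rfl fun j _ => by ring
  have hs : ns ((TT (un n) β)^[k] (fun _ => 1)) ≤ (l ^ k) ^ 2 * n := by
    induction k with
    | zero => simp [ns]
    | succ k ih =>
      rw [Function.iterate_succ_apply', hT]
      have := qf_exists (fun i j => β i j / n) (fun i j => by simp only [hK.sym i j])
        (fun i j => div_nonneg (hK.nn _ _) hn0.le) l hl h ((TT (un n) β)^[k] (fun _ => 1))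
      refine this.trans ?_
      have h2 := mul_le_mul_of_nonneg_left ih (sq_nonneg l)
      calc _ ≤ _ := h2
        _ = _ := by ring
  rw [un_integral, div_le_iff₀ hn0]
  have hcs := sq_sum_le_card_mul_sum_sq (s := Finset.univ) (f := (TT (un n) β)^[k] (fun _ => 1))
  rw [Finset.card_univ, Fintype.card_fin] at hcs
  unfold ns at hs
  refine abs_le_of_sq_le_sq' ?_ (by positivity) |>.2
  calc _ ≤ _ := hcs
    _ ≤ n * ((l ^ k) ^ 2 * n) := mul_le_mul_of_nonneg_left hs hn0.le
    _ = _ := by ring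

theorem W_growth {W : ℝ → ℝ → ℝ} {b : ℝ} (hb : 1 ≤ b) (hW : Ker mu W b) (hsup : 1 < opNorm W) :
    ∃ l : ℝ, 1 < l ∧ l ≤ 2 ∧ ∃ k : ℕ, l ^ (k + 1) < ∫ p, PP mu W k p.1 p.2 ∂(mu.prod mu) := by
  have hb0 : 0 < b := by linarith
  obtain ⟨f, hfm, hf2, hf1, hTf⟩ := opNorm_wit hsup
  change Integrable (fun x => f x ^ 2) mu at hf2
  unfold l2norm at hf1 hTf
  change Real.sqrt (∫ x, f x ^ 2 ∂mu) ≤ 1 at hf1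
  change 1 < Real.sqrt (∫ x, TT mu W f x ^ 2 ∂mu) at hTf
  rw [Real.sqrt_le_left (by norm_num), one_pow] at hf1
  rw [Real.lt_sqrt (by norm_num)] at hTf
  have hfi : Integrable f mu := by
    refine Integrable.mono' ((integrable_const (1 : ℝ)).add hf2) hfm.aestronglyMeasurable (Eventually.of_forall fun x => ?_)
    simp only [Pi.add_apply, Real.norm_eq_abs]
    have := sq_abs (f x)
    nlinarith [sq_nonneg (|f x| - 1), abs_nonneg (f x)]
  set g : ℝ → ℝ := fun x => |f x| with hg
  have hgm : Measurable g := hfm.abs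
  have hgi : Integrable g mu := hfi.abs
  have hg2e : (fun x => g x ^ 2) = fun x => f x ^ 2 := by funext x; simp [hg]
  have hg2 : Integrable (fun x => g x ^ 2) mu := by rw [hg2e]; exact hf2
  have hB1 : Bd (TT mu W g) := TT_Bd hW hb0.le hgm hgi
  have sqint : ∀ {u : ℝ → ℝ}, Bd u → Integrable (fun x => u x ^ 2) mu := by
    intro u hu
    simpa [pow_two] using int_mul_Bd (μ := mu) hu.int hu
  set r := ∫ x, TT mu W g x ^ 2 ∂mu with hr
  have hr1 : 1 < r := by
    have : ∫ x, TT mu W f x ^ 2 ∂mu ≤ r := by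
      refine integral_mono (sqint (TT_Bd hW hb0.le hfm hfi)) (sqint hB1) fun x => ?_
      refine sq_le_sq' ?_ ?_
      · have : ∫ y, -(W x y * g y) ∂mu ≤ ∫ y, W x y * f y ∂mu :=
          integral_mono (sec_mul_int hW hgi x).neg (sec_mul_int hW hfi x) fun y => by
            have := mul_le_mul_of_nonneg_left (neg_abs_le (f y)) (hW.nn x y)
            simp only [hg]; linarith
        rw [integral_neg] at this
        exact this
      · exact TT_mono hW hfi hgi (fun y => le_abs_self _) x
    linarith
  have hr0 : 0 < r := by linarith
  have hgr := growth hW hb0.le hgm (fun x => abs_nonneg _) hgi hg2 r hr0 (by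
    rw [hg2e]; rw [← hr]; nlinarith)
  have hN : ∀ j, r ^ (j + 1) ≤ ∫ x, (TT mu W)^[j + 1] g x ^ 2 ∂mu := by
    intro j
    induction j with
    | zero => simp [hr]
    | succ j ih =>
      refine le_trans ?_ (hgr (j + 1))
      rw [pow_succ']
      exact mul_le_mul_of_nonneg_left ih hr0.le
  have hg1b : ∃ c, 0 ≤ c ∧ ∀ x, TT mu W g x ≤ c := by
    obtain ⟨_, c, hc⟩ := hB1
    exact ⟨c, (abs_nonneg _).trans (hc 0), fun x => (le_abs_self _).trans (hc x)⟩
  obtain ⟨c, hc0, hc⟩ := hg1b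
  have hone : Bd (fun _ : ℝ => (1 : ℝ)) := ⟨measurable_const, 1, fun _ => by simp⟩
  have hcB : Bd (fun _ : ℝ => c * (1 : ℝ)) := ⟨measurable_const, |c * 1|, fun _ => le_rfl⟩
  have hup : ∀ j, ∫ x, (TT mu W)^[j + 1] g x ^ 2 ∂mu ≤ c * c * ∫ x, (TT mu W)^[j + j] (fun _ => 1) x ∂mu := by
    intro j
    have e : ∫ x, (TT mu W)^[j + 1] g x ^ 2 ∂mu = ∫ x, TT mu W g x * (TT mu W)^[j + j] (TT mu W g) x ∂mu := by
      rw [Function.iterate_add_apply (TT mu W) j j, ← TT_it_adj hW hb0.le j hB1 (TT_it_Bd hW hb0.le hB1 j)]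
      congr 1; funext x
      rw [Function.iterate_succ_apply, pow_two]
    have hnn1 : ∀ k x, 0 ≤ (TT mu W)^[k] (fun _ => (1 : ℝ)) x := by
      intro k
      induction k with
      | zero => intro x; simp
      | succ k ih =>
        intro x; rw [Function.iterate_succ_apply']
        exact integral_nonneg fun y => mul_nonneg (hW.nn _ _) (ih y)
    rw [e, ← integral_const_mul]
    refine integral_mono (int_mul_Bd hB1.int (TT_it_Bd hW hb0.le hB1 (j + j)))
      ((TT_it_Bd hW hb0.le hone (j + j)).int.const_mul _) fun x => ?_
    have hle := TT_it_mono hW hb0.le hB1 hcB (fun x => by rw [mul_one]; exact hc x) (j + j) x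
    rw [TT_it_smul] at hle
    have h0 : 0 ≤ TT mu W g x := integral_nonneg fun y => mul_nonneg (hW.nn _ _) (abs_nonneg _)
    simp only
    calc TT mu W g x * (TT mu W)^[j + j] (TT mu W g) x
        ≤ TT mu W g x * (c * (TT mu W)^[j + j] (fun _ => 1) x) := mul_le_mul_of_nonneg_left hle h0
      _ ≤ c * (c * (TT mu W)^[j + j] (fun _ => 1) x) :=
          mul_le_mul_of_nonneg_right (hc x) (mul_nonneg hc0 (hnn1 _ _))
      _ = _ := by ring
  set t := min ((r - 1) / 4) (1 / 4) with ht
  have ht0 : 0 < t := lt_min (by linarith) (by norm_num)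
  have ht1 : t ≤ (r - 1) / 4 := min_le_left _ _
  have ht2 : t ≤ 1 / 4 := min_le_right _ _
  have hlr : (1 + t) ^ 2 < r := by nlinarith
  refine ⟨1 + t, by linarith, by linarith, ?_⟩
  have hq : 1 < r / (1 + t) ^ 2 := by rw [lt_div_iff₀ (by positivity)]; linarith
  obtain ⟨j, hj1, hj2⟩ := (((tendsto_pow_atTop_atTop_of_one_lt hq).eventually_gt_atTop (c * c)).and
    (eventually_ge_atTop 1)).exists
  obtain ⟨i, rfl⟩ : ∃ i, j = i + 1 := ⟨j - 1, by omega⟩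
  refine ⟨2 * i + 1, ?_⟩
  rw [PP_total hW hb0.le]
  have hidx : 2 * i + 1 + 1 = (i + 1) + (i + 1) := by ring
  rw [hidx]
  have h1 := (hN (i + 1)).trans (hup (i + 1))
  set I := ∫ x, (TT mu W)^[(i + 1) + (i + 1)] (fun _ => 1) x ∂mu
  rw [div_pow, lt_div_iff₀ (by positivity)] at hj1
  have h2 : r ^ (i + 1) ≤ r ^ (i + 1 + 1) := pow_le_pow_right₀ hr1.le (by omega)
  have h3 : c * c * ((1 + t) ^ ((i + 1) + (i + 1))) < c * c * I := by
    have : (1 + t) ^ ((i + 1) + (i + 1)) = ((1 + t) ^ 2) ^ (i + 1) := by rw [← pow_mul]; congr 1; ring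
    rw [this]; linarith
  exact lt_of_mul_lt_mul_left h3 (mul_nonneg hc0 hc0)

theorem H1_proof {β : ∀ n : ℕ, Fin n → Fin n → ℝ} {W : ℝ → ℝ → ℝ} {b : ℝ} (hb : 1 ≤ b)
    (hG : ∀ n, Ker (un n) (β n) b) (hW : Ker mu W b)
    (hc : ConvergesTo β W) (hsup : 1 < opNorm W) :
    ∃ l : ℝ, 1 < l ∧ l ≤ 2 ∧ ∀ᶠ n : ℕ in atTop, ∃ u : Fin n → ℝ, l * ns u < qf (fun i j => β n i j / n) u := by
  have hb0 : 0 ≤ b := by linarith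
  obtain ⟨l, hl1, hl2, k, hk⟩ := W_growth hb hW hsup
  refine ⟨l, hl1, hl2, ?_⟩
  filter_upwards [(path_tendsto hb0 hG hW hc k).eventually_const_lt hk, eventually_gt_atTop 0] with n hn hn0
  by_contra hcon
  push Not at hcon
  rw [PP_total (hG n) hb0] at hn
  exact absurd (disc_bound (hG n) (by linarith) hn0 hcon (k + 1)) (not_le.2 hn)

end PercAux

open Percolation MeasureTheory Filter Topology in
/-- If `(G_n)` converges to an irreducible graphon `W` with
`‖T_W‖ > 1`, then there is a constant `A` such that whp the second largest component of
`G_n(1/n)` has at most `A log n` vertices. -/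
theorem supercritical_second_component_log_bound
    (β : ∀ n : ℕ, Fin n → Fin n → ℝ) (βmax : ℝ)
    (hsym : ∀ n i j, β n i j = β n j i)
    (hnonneg : ∀ n i j, 0 ≤ β n i j)
    (hdiag : ∀ n i, β n i i = 0)
    (hbound : ∀ n i j, β n i j ≤ βmax)
    (W : ℝ → ℝ → ℝ) (hW : IsGraphon W) (hconv : ConvergesTo β W)
    (hirr : Percolation.Irreducible W) (hsup : 1 < opNorm W) :
    ∃ A : ℝ, Tendsto
      (fun n : ℕ => percMeasure (β n) (1 / n)
        {ω | (C2 (graphOf ω) : ℝ) ≤ A * Real.log n})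
      atTop (nhds 1) := by
  obtain ⟨hWm, hWn, hWs, M, hWM⟩ := hW
  have hb : 1 ≤ max (max βmax M) 1 := le_max_right _ _
  have hβb : ∀ n i j, β n i j ≤ max (max βmax M) 1 := fun n i j =>
    (hbound n i j).trans ((le_max_left _ _).trans (le_max_left _ _))
  have hKW : PercAux.Ker PercAux.mu W (max (max βmax M) 1) :=
    ⟨hWm, hWn, fun x y => (hWM x y).trans ((le_max_right _ _).trans (le_max_left _ _)), hWs, by simp⟩
  have hKG : ∀ n, PercAux.Ker (PercAux.un n) (β n) (max (max βmax M) 1) := fun n =>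
    ⟨measurable_of_finite _, hnonneg n, hβb n, hsym n, PercAux.un_mass n⟩
  obtain ⟨l, hl1, hl2, h1⟩ := PercAux.H1_proof hb hKG hKW hconv hsup
  exact PercAux.finite_main β _ l hb hsym hnonneg hdiag hβb hl1 hl2 h1
    (PercAux.H2_proof hb hKG hKW hconv hirr hsup)
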